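/- Let d ≥ 2 and let B be a collision kernel satisfying the standing assumptions (1.1) and the Lipschitz assumption (1.2). Let ε ∈ (0,1], λ ∈ [1,∞), p ∈ (8,∞) and T ∈ [0,∞). Suppose (μ_t^N)_{t≥0} and (μ_t^{N′})_{t≥0} are Kac processes in 𝒮_N and 𝒮_{N′}, N ≤ N′, with respect to a common filtration, satisfying ∫|v|^p μ_0^N(dv) ≤ λ and ∫|v|^p μ_0^{N′}(dv) ≤ λ. Then there is a constant C = C(B,d,ε,λ,p,T) < ∞ such that: if d ≥ 3, with probability exceeding 1 − ε, W(μ_t^N, μ_t^{N′}) ≤ C (W(μ_0^N, μ_0^{N′}) + N^{−1/d}) for all t ∈ [0,T]; and if d = 2, with probability exceeding 1 − ε, W(μ_t^N, μ_t^{N′}) ≤ C (W(μ_0^N, μ_0^{N′}) + N^{−1/2} log N) for all t ∈ [0,T]. -/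

import Mathlib

open MeasureTheory ProbabilityTheory Filter
open scoped ENNReal NNReal RealInnerProductSpace

noncomputable section

abbrev Vd (d : ℕ) := EuclideanSpace ℝ (Fin d)

namespace KacModel

variable {d : ℕ}

/-- Post-collision velocity `v' = (v+v*)/2 + |v-v*|σ/2`. -/
def postV (v vs σ : Vd d) : Vd d := (2:ℝ)⁻¹ • (v + vs) + ((2:ℝ)⁻¹ * ‖v - vs‖) • σ

/-- Post-collision velocity `v'_* = (v+v*)/2 - |v-v*|σ/2`. -/
def postVs (v vs σ : Vd d) : Vd d := (2:ℝ)⁻¹ • (v + vs) - ((2:ℝ)⁻¹ * ‖v - vs‖) • σ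

/-- The unit sphere `S^{d-1}` regarded as a subset of `ℝ^d`. -/
def unitSphere (d : ℕ) : Set (Vd d) := {σ | ‖σ‖ = 1}

/-- Standing assumptions (1.1) on a collision kernel, regarded as a family of
measures on `ℝ^d` carried by the unit sphere. -/
structure IsCollisionKernel (B : Vd d → Measure (Vd d)) : Prop where
  measurable : ∀ s : Set (Vd d), MeasurableSet s → Measurable fun v => B v s
  prob : ∀ u : Vd d, ‖u‖ = 1 → IsProbabilityMeasure (B u)
  support : ∀ u : Vd d, ‖u‖ = 1 → B u ((unitSphere d \ {u, -u})ᶜ) = 0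
  scaling : ∀ (c : ℝ), 0 ≤ c → ∀ u : Vd d, ‖u‖ = 1 →
    B (c • u) = ENNReal.ofReal c • B u
  symm : ∀ (R : Vd d ≃ₗᵢ[ℝ] Vd d) (u : Vd d), ‖u‖ = 1 → B (R u) = (B u).map R

/-- Total variation distance between two finite measures (dual formulation). -/
def tvDist {E : Type*} [MeasurableSpace E] (μ ν : Measure E) : ℝ :=
  ⨆ f : {f : E → ℝ // Measurable f ∧ ∀ x, |f x| ≤ 1},
    ((∫ x, f.1 x ∂μ) - ∫ x, f.1 x ∂ν)

/-- The Lipschitz assumption (1.2). -/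
def IsLipschitzKernel (B : Vd d → Measure (Vd d)) (κ : ℝ) : Prop :=
  1 ≤ κ ∧ ∀ v v' : Vd d, tvDist (B v) (B v') ≤ κ * ‖v - v'‖

/-- The Boltzmann sphere 𝒮. -/
def boltzmannSphere (d : ℕ) : Set (Measure (Vd d)) :=
  {μ | IsProbabilityMeasure μ ∧ (∫ v, v ∂μ) = 0 ∧ (∫ v, ‖v‖ ^ 2 ∂μ) = 1}

/-- 𝒮_N : normalized empirical measures in the Boltzmann sphere. -/
def empiricalSphere (d N : ℕ) : Set (Measure (Vd d)) :=
  {μ | μ ∈ boltzmannSphere d ∧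
    ∃ x : Fin N → Vd d, μ = (N : ℝ≥0∞)⁻¹ • ∑ i, Measure.dirac (x i)}

/-- The class ℱ of test functions. -/
def testF (d : ℕ) : Set (Vd d → ℝ) :=
  {f | (∀ v, |f v / (1 + ‖v‖ ^ 2)| ≤ 1) ∧
    ∀ v v', |f v / (1 + ‖v‖ ^ 2) - f v' / (1 + ‖v'‖ ^ 2)| ≤ ‖v - v'‖}

/-- The weighted Wasserstein distance W. -/
def Wdist (μ ν : Measure (Vd d)) : ℝ :=
  ⨆ f : testF d, ((∫ v, (f : Vd d → ℝ) v ∂μ) - ∫ v, (f : Vd d → ℝ) v ∂ν)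

/-- The p-th moment `∫ |v|^p dμ`, as a lower integral. -/
def momentL (p : ℝ) (μ : Measure (Vd d)) : ℝ≥0∞ :=
  ∫⁻ v, (‖v‖₊ : ℝ≥0∞) ^ p ∂μ

/-- Total variation measure |μ - ν| of the difference of two finite measures. -/
def tvMeasure {E : Type*} [MeasurableSpace E] (μ ν : Measure E) : Measure E :=
  (μ - ν) + (ν - μ)

/-- The post-collision update `μ^{v,v_*,σ}` of an empirical measure. -/
def collUpdate (N : ℕ) (μ : Measure (Vd d)) (v vs σ : Vd d) : Measure (Vd d) :=
  μ + (N : ℝ≥0∞)⁻¹ • (Measure.dirac (postV v vs σ) + Measure.dirac (postVs v vs σ))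
    - (N : ℝ≥0∞)⁻¹ • (Measure.dirac v + Measure.dirac vs)

/-- The generator 𝒢 of the Kac process. -/
def kacGen (B : Vd d → Measure (Vd d)) (N : ℕ) (F : Measure (Vd d) → ℝ)
    (μ : Measure (Vd d)) : ℝ :=
  N * ∫ v, (∫ vs, (∫ σ, (F (collUpdate N μ v vs σ) - F μ) ∂(B (v - vs))) ∂μ) ∂μ

/-- A Kac process with collision kernel `B` and particle number `N`:
a càdlàg adapted 𝒮_N-valued process solving the martingale problem for 𝒢. -/
structure IsKacProcess {Ω : Type*} [m : MeasurableSpace Ω]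
    (B : Vd d → Measure (Vd d)) (N : ℕ) (P : Measure Ω)
    (𝓕 : Filtration ℝ m) (μp : ℝ → Ω → Measure (Vd d)) : Prop where
  mem : ∀ t ω, μp t ω ∈ empiricalSphere d N
  adapted : ∀ f ∈ testF d, Adapted 𝓕 fun t ω => ∫ v, f v ∂(μp t ω)
  rightCont : ∀ ω, ∀ f ∈ testF d, ∀ t : ℝ,
    ContinuousWithinAt (fun s => ∫ v, f v ∂(μp s ω)) (Set.Ici t) t
  leftLim : ∀ ω, ∀ f ∈ testF d, ∀ t : ℝ, 0 < t →
    ∃ L : ℝ, Tendsto (fun s => ∫ v, f v ∂(μp s ω)) (nhdsWithin t (Set.Iio t)) (nhds L)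
  martingale : ∀ G : Measure (Vd d) → ℝ, Measurable G → (∃ M : ℝ, ∀ ν, |G ν| ≤ M) →
    Martingale (fun t ω => G (μp t ω) - ∫ s in Set.Ioc (0:ℝ) t, kacGen B N G (μp s ω)) 𝓕 P

/-- `⟨f, Q(μ,ν)⟩`, the Boltzmann collision integral. -/
def QInt (B : Vd d → Measure (Vd d)) (f : Vd d → ℝ) (μ ν : Measure (Vd d)) : ℝ :=
  ∫ v, (∫ vs, (∫ σ, (f (postV v vs σ) + f (postVs v vs σ) - f v - f vs) ∂(B (v - vs))) ∂ν) ∂μ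

/-- Measure solution of the spatially homogeneous Boltzmann equation, started at time τ. -/
def IsBoltzmannSolutionFrom (B : Vd d → Measure (Vd d)) (τ : ℝ)
    (μt : ℝ → Measure (Vd d)) : Prop :=
  (∀ t, τ ≤ t → μt t ∈ boltzmannSphere d) ∧
  ∀ f : Vd d → ℝ, Measurable f → (∃ M, ∀ v, |f v| ≤ M) → HasCompactSupport f →
    ∀ t, τ ≤ t →
      (∫ v, f v ∂(μt t)) = (∫ v, f v ∂(μt τ)) + ∫ s in Set.Ioc τ t, QInt B f (μt s) (μt s)

/-- Measure solution of the spatially homogeneous Boltzmann equation (start time 0). -/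
def IsBoltzmannSolution (B : Vd d → Measure (Vd d)) (μt : ℝ → Measure (Vd d)) : Prop :=
  IsBoltzmannSolutionFrom B 0 μt

/-- Local boundedness in 𝒮(p) from time τ on. -/
def LocBddMomentFrom (p τ : ℝ) (μt : ℝ → Measure (Vd d)) : Prop :=
  ∀ T, τ ≤ T → ∃ M : ℝ≥0∞, M ≠ ⊤ ∧ ∀ t ∈ Set.Icc τ T, momentL p (μt t) ≤ M

/-- Sample mean. -/
def sampleMean {Ω : Type*} {N : ℕ} (Vs : Fin N → Ω → Vd d) (ω : Ω) : Vd d :=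
  (N : ℝ)⁻¹ • ∑ i, Vs i ω

/-- Sample mean square. -/
def sampleQ {Ω : Type*} {N : ℕ} (Vs : Fin N → Ω → Vd d) (ω : Ω) : ℝ :=
  (N : ℝ)⁻¹ * ∑ i, ‖Vs i ω‖ ^ 2

/-- Sample variance. -/
def sampleS {Ω : Type*} {N : ℕ} (Vs : Fin N → Ω → Vd d) (ω : Ω) : ℝ :=
  sampleQ Vs ω - ‖sampleMean Vs ω‖ ^ 2

/-- The rescaled empirical distribution μ̃^N. -/
def rescaledEmpirical {Ω : Type*} {N : ℕ} (Vs : Fin N → Ω → Vd d)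
    (μdef : Measure (Vd d)) (ω : Ω) : Measure (Vd d) :=
  if 0 < sampleS Vs ω then
    (N : ℝ≥0∞)⁻¹ • ∑ i, Measure.dirac
      ((Real.sqrt (sampleS Vs ω))⁻¹ • (Vs i ω - sampleMean Vs ω))
  else μdef

/-- The N-sample empirical distribution. -/
def empMeasure {Ω : Type*} {N : ℕ} (Vs : Fin N → Ω → Vd d) (ω : Ω) : Measure (Vd d) :=
  (N : ℝ≥0∞)⁻¹ • ∑ i, Measure.dirac (Vs i ω)

end KacModel

open KacModel

namespace KacProof
open Real (norm_eq_abs exp one_le_exp norm_of_nonneg sqrt log_pos sqrt_nonneg volume_real_Ioc_of_le)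
open Set (mem_ofPred_eq Ici Ioc Icc)
open Finset (range sum_le_sum)
variable {d : ℕ}
theorem emp_N_ne {N : ℕ} {μ : Measure (Vd d)} (h : μ ∈ empiricalSphere d N) : N ≠ 0 := by
  rintro rfl
  obtain ⟨⟨hp, -, -⟩, x, hx⟩ := h
  have := hp.measure_univ
  rw [hx] at this
  simp at this
theorem emp_prob {N : ℕ} {μ : Measure (Vd d)} (h : μ ∈ empiricalSphere d N) :
    IsProbabilityMeasure μ := h.1.1
theorem emp_integrable' {N : ℕ} (hN : N ≠ 0) (x : Fin N → Vd d) {F : Type*}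
    [NormedAddCommGroup F] (f : Vd d → F) :
    Integrable f ((N : ℝ≥0∞)⁻¹ • ∑ i, Measure.dirac (x i)) := by
  apply Integrable.smul_measure
  · rw [integrable_finsetSum_measure]
    intro i _
    exact integrable_dirac (by simp)
  · simp [hN]
theorem emp_integrable {N : ℕ} {μ : Measure (Vd d)} (h : μ ∈ empiricalSphere d N) {F : Type*}
    [NormedAddCommGroup F] (f : Vd d → F) : Integrable f μ := by
  obtain ⟨x, hx⟩ := h.2
  rw [hx]
  exact emp_integrable' (emp_N_ne h) x f
theorem emp_rep {N : ℕ} {μ : Measure (Vd d)} (h : μ ∈ empiricalSphere d N) :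
    ∃ x : Fin N → Vd d, μ = (N : ℝ≥0∞)⁻¹ • ∑ i, Measure.dirac (x i) ∧
      (∀ f : Vd d → ℝ, ∫ v, f v ∂μ = (N : ℝ)⁻¹ * ∑ i, f (x i)) ∧
      (∑ i, ‖x i‖ ^ 2 = N) := by
  obtain ⟨x, hx⟩ := h.2
  have hN := emp_N_ne h
  have key : ∀ f : Vd d → ℝ, ∫ v, f v ∂μ = (N : ℝ)⁻¹ * ∑ i, f (x i) := by
    intro f
    rw [hx, integral_smul_measure, integral_finsetSum_measure]
    · simp
    · intro i _
      exact integrable_dirac (by simp)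
  refine ⟨x, hx, key, ?_⟩
  have h2 := h.1.2.2
  rw [key] at h2
  have : (N : ℝ) ≠ 0 := by exact_mod_cast hN
  field_simp at h2
  exact h2
theorem emp_ball {N : ℕ} {x : Fin N → Vd d} (hx : ∑ i, ‖x i‖ ^ 2 = (N : ℝ)) (i : Fin N) :
    ‖x i‖ ^ 2 ≤ N := by
  rw [← hx]
  exact Finset.single_le_sum (f := fun i => ‖x i‖ ^ 2) (fun i _ => by positivity)
    (Finset.mem_univ i)
theorem emp_ball2 {N : ℕ} {x : Fin N → Vd d} (hx : ∑ i, ‖x i‖ ^ 2 = (N : ℝ)) {i j : Fin N}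
    (hij : i ≠ j) : ‖x i‖ ^ 2 + ‖x j‖ ^ 2 ≤ N := by
  rw [← hx, ← Finset.sum_pair (f := fun i => ‖x i‖ ^ 2) hij]
  exact Finset.sum_le_sum_of_subset_of_nonneg (Finset.subset_univ _) (fun i _ _ => by positivity)
theorem post_energy (v vs σ : Vd d) (hσ : ‖σ‖ = 1) :
    ‖postV v vs σ‖ ^ 2 + ‖postVs v vs σ‖ ^ 2 = ‖v‖ ^ 2 + ‖vs‖ ^ 2 := by
  unfold postV postVs
  have h1 := parallelogram_law_with_norm ℝ ((2:ℝ)⁻¹ • (v + vs)) (((2:ℝ)⁻¹ * ‖v - vs‖) • σ)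
  have h2 := parallelogram_law_with_norm ℝ v vs
  rw [norm_smul, norm_smul, hσ] at h1
  simp only [norm_mul, norm_inv, Real.norm_ofNat, norm_norm, mul_one] at h1
  nlinarith
theorem postV_lip (v w vs σ : Vd d) (hσ : ‖σ‖ = 1) :
    ‖postV v vs σ - postV w vs σ‖ ≤ ‖v - w‖ := by
  have : postV v vs σ - postV w vs σ =
      (2:ℝ)⁻¹ • (v - w) + ((2:ℝ)⁻¹ * (‖v - vs‖ - ‖w - vs‖)) • σ := by
    unfold postV
    module
  rw [this]
  refine (norm_add_le _ _).trans ?_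
  rw [norm_smul, norm_smul, hσ]
  have h := abs_norm_sub_norm_le (v - vs) (w - vs)
  rw [sub_sub_sub_cancel_right] at h
  simp only [norm_mul, norm_inv, Real.norm_ofNat, norm_eq_abs]
  linarith
theorem postVs_lip (v w vs σ : Vd d) (hσ : ‖σ‖ = 1) :
    ‖postVs v vs σ - postVs w vs σ‖ ≤ ‖v - w‖ := by
  have : postVs v vs σ - postVs w vs σ =
      (2:ℝ)⁻¹ • (v - w) - ((2:ℝ)⁻¹ * (‖v - vs‖ - ‖w - vs‖)) • σ := by
    unfold postVs
    module
  rw [this]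
  refine (norm_sub_le _ _).trans ?_
  rw [norm_smul, norm_smul, hσ]
  have h := abs_norm_sub_norm_le (v - vs) (w - vs)
  rw [sub_sub_sub_cancel_right] at h
  simp only [norm_mul, norm_inv, Real.norm_ofNat, norm_eq_abs]
  linarith
theorem postV_cont : Continuous fun q : Vd d × Vd d × Vd d => postV q.1 q.2.1 q.2.2 := by
  unfold postV; fun_prop
theorem postVs_cont : Continuous fun q : Vd d × Vd d × Vd d => postVs q.1 q.2.1 q.2.2 := by
  unfold postVs; fun_prop
theorem postV_meas (v vs : Vd d) : Measurable fun σ => postV v vs σ := by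
  unfold postV; fun_prop
theorem postVs_meas (v vs : Vd d) : Measurable fun σ => postVs v vs σ := by
  unfold postVs; fun_prop
def dlt (f : Vd d → ℝ) (v vs σ : Vd d) : ℝ := f (postV v vs σ) + f (postVs v vs σ) - f v - f vs
theorem dlt_meas {f : Vd d → ℝ} (hf : Measurable f) :
    Measurable fun q : Vd d × Vd d × Vd d => dlt f q.1 q.2.1 q.2.2 := by
  unfold dlt
  exact (((hf.comp postV_cont.measurable).add (hf.comp postVs_cont.measurable)).sub
    (hf.comp measurable_fst)).sub (hf.comp (measurable_fst.comp measurable_snd))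
theorem dlt_meas' {f : Vd d → ℝ} (hf : Measurable f) (v vs : Vd d) :
    Measurable fun σ => dlt f v vs σ := by
  unfold dlt
  exact (((hf.comp (postV_meas v vs)).add (hf.comp (postVs_meas v vs))).sub
    measurable_const).sub measurable_const
def kf (B : Vd d → Measure (Vd d)) (f : Vd d → ℝ) (v vs : Vd d) : ℝ :=
  ∫ σ, dlt f v vs σ ∂(B (v - vs))
theorem QInt_eq (B : Vd d → Measure (Vd d)) (f : Vd d → ℝ) (μ ν : Measure (Vd d)) :
    QInt B f μ ν = ∫ v, (∫ vs, kf B f v vs ∂ν) ∂μ := rfl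
section kern
variable {B : Vd d → Measure (Vd d)} (hd : 2 ≤ d) (hB : IsCollisionKernel B)
include hd
theorem exists_unit : ∃ u : Vd d, ‖u‖ = 1 :=
  ⟨EuclideanSpace.single ⟨0, by omega⟩ 1, by simp⟩
include hB
theorem B_zero : B 0 = 0 := by
  obtain ⟨u, hu⟩ := exists_unit hd
  have := hB.scaling 0 le_rfl u hu
  simpa using this
theorem B_polar (v : Vd d) : ∃ u : Vd d, ‖u‖ = 1 ∧ v = ‖v‖ • u ∧ B v = ENNReal.ofReal ‖v‖ • B u := by
  by_cases hv : v = 0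
  · obtain ⟨u, hu⟩ := exists_unit hd
    exact ⟨u, hu, by simp [hv], by simp [hv, B_zero hd hB]⟩
  · have h0 : ‖v‖ ≠ 0 := by simpa using hv
    have h1 : ‖(‖v‖⁻¹ • v)‖ = 1 := by rw [norm_smul]; simp [h0]
    have h2 : v = ‖v‖ • (‖v‖⁻¹ • v) := by rw [smul_smul, mul_inv_cancel₀ h0, one_smul]
    refine ⟨‖v‖⁻¹ • v, h1, h2, ?_⟩
    conv_lhs => rw [h2]
    exact hB.scaling _ (norm_nonneg v) _ h1
theorem B_univ (v : Vd d) : B v Set.univ = ENNReal.ofReal ‖v‖ := by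
  obtain ⟨u, hu, -, h⟩ := B_polar hd hB v
  have := hB.prob u hu
  rw [h]; simp
theorem B_fin (v : Vd d) : IsFiniteMeasure (B v) := ⟨by rw [B_univ hd hB]; simp⟩
theorem B_real_univ (v : Vd d) : (B v).real Set.univ = ‖v‖ := by
  rw [measureReal_def, B_univ hd hB]; simp
theorem B_sphere (v : Vd d) : ∀ᵐ σ ∂(B v), ‖σ‖ = 1 := by
  obtain ⟨u, hu, -, h⟩ := B_polar hd hB v
  rw [h]
  apply Measure.ae_smul_measure
  rw [ae_iff]
  refine measure_mono_null ?_ (hB.support u hu)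
  intro σ hσ
  simp only [mem_ofPred_eq] at hσ
  simp [unitSphere, hσ]
theorem B_neg (v : Vd d) : B (-v) = (B v).map (fun σ => -σ) := by
  obtain ⟨u, hu, hv, h⟩ := B_polar hd hB v
  have h1 := hB.symm (LinearIsometryEquiv.neg ℝ) u hu
  have h2 := hB.scaling ‖v‖ (norm_nonneg v) (-u) (by simpa using hu)
  rw [smul_neg, ← hv] at h2
  rw [h2, h, Measure.map_smul]
  congr 1
theorem B_integrable (v : Vd d) {φ : Vd d → ℝ} (hφ : Measurable φ) {K : ℝ}
    (hK : ∀ σ, ‖σ‖ = 1 → |φ σ| ≤ K) : Integrable φ (B v) := by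
  have := B_fin hd hB v
  refine Integrable.of_bound hφ.aestronglyMeasurable K ?_
  filter_upwards [B_sphere hd hB v] with σ hσ using hK σ hσ
theorem B_int_le (v : Vd d) {φ : Vd d → ℝ} {K : ℝ}
    (hK : ∀ σ, ‖σ‖ = 1 → |φ σ| ≤ K) : |∫ σ, φ σ ∂(B v)| ≤ K * ‖v‖ := by
  have := B_fin hd hB v
  have h := norm_integral_le_of_norm_le_const (μ := B v) (f := φ) (C := K)
    (by filter_upwards [B_sphere hd hB v] with σ hσ using hK σ hσ)
  rwa [B_real_univ hd hB] at h
theorem B_tv {κ : ℝ} (hBL : IsLipschitzKernel B κ) (v w : Vd d) {φ : Vd d → ℝ} (hφ : Measurable φ)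
    {K : ℝ} (hK0 : 0 < K) (hK : ∀ σ, ‖σ‖ = 1 → |φ σ| ≤ K) :
    |(∫ σ, φ σ ∂(B v)) - ∫ σ, φ σ ∂(B w)| ≤ K * (κ * ‖v - w‖) := by
  classical
  have key : ∀ φ : Vd d → ℝ, Measurable φ → (∀ σ, ‖σ‖ = 1 → |φ σ| ≤ K) →
      (∫ σ, φ σ ∂(B v)) - ∫ σ, φ σ ∂(B w) ≤ K * (κ * ‖v - w‖) := by
    intro φ hφ hK
    have hm : MeasurableSet {σ : Vd d | ‖σ‖ = 1} := measurableSet_eq_fun (by fun_prop) (by fun_prop)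
    let ψ : Vd d → ℝ := fun σ => if ‖σ‖ = 1 then K⁻¹ * φ σ else 0
    have hψm : Measurable ψ := Measurable.ite hm (hφ.const_mul _) measurable_const
    have hψ1 : ∀ σ, |ψ σ| ≤ 1 := by
      intro σ
      by_cases h : ‖σ‖ = 1
      · simp only [ψ, h, if_true, abs_mul, abs_inv, abs_of_pos hK0]
        rw [inv_mul_le_iff₀ hK0, mul_one]
        exact hK σ h
      · simp [ψ, h]
    have hint : ∀ z, ∫ σ, ψ σ ∂(B z) = K⁻¹ * ∫ σ, φ σ ∂(B z) := by
      intro z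
      rw [← integral_const_mul]
      apply integral_congr_ae
      filter_upwards [B_sphere hd hB z] with σ hσ
      simp [ψ, hσ]
    have hbdd : BddAbove (Set.range fun f : {f : Vd d → ℝ // Measurable f ∧ ∀ x, |f x| ≤ 1} =>
        ((∫ x, f.1 x ∂(B v)) - ∫ x, f.1 x ∂(B w))) := by
      refine ⟨1 * ‖v‖ + 1 * ‖w‖, ?_⟩
      rintro _ ⟨f, rfl⟩
      have h1 := abs_le.1 (B_int_le hd hB v (φ := f.1) (fun σ _ => f.2.2 σ))
      have h2 := abs_le.1 (B_int_le hd hB w (φ := f.1) (fun σ _ => f.2.2 σ))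
      dsimp only
      linarith [h1.2, h2.1]
    have h1 := le_ciSup hbdd ⟨ψ, hψm, hψ1⟩
    have h2 := hBL.2 v w
    unfold tvDist at h2
    have h3 := h1.trans h2
    simp only [hint] at h3
    rw [← mul_sub, inv_mul_le_iff₀ hK0] at h3
    exact h3
  rw [abs_le]
  constructor
  · have := key (fun σ => - φ σ) hφ.neg (fun σ hσ => by simpa using hK σ hσ)
    simp only [integral_neg] at this
    linarith
  · exact key φ hφ hK
theorem kf_symm {f : Vd d → ℝ} (hf : Measurable f) (v vs : Vd d) : kf B f v vs = kf B f vs v := by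
  unfold kf
  have h : B (vs - v) = (B (v - vs)).map (fun σ => -σ) := by
    rw [← B_neg hd hB]; congr 1; abel
  rw [h, integral_map (by fun_prop) (dlt_meas' hf _ _).aestronglyMeasurable]
  congr 1
  ext σ
  unfold dlt
  have h1 : postV vs v (-σ) = postVs v vs σ := by
    unfold postV postVs; rw [norm_sub_rev vs v]; module
  have h2 : postVs vs v (-σ) = postV v vs σ := by
    unfold postV postVs; rw [norm_sub_rev vs v]; module
  rw [h1, h2]; ring
theorem kf_self (f : Vd d → ℝ) (v : Vd d) : kf B f v v = 0 := by
  unfold kf; simp [B_zero hd hB]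
end kern
def BL (K : ℝ) (g : Vd d → ℝ) : Prop :=
  (∀ v, |g v| ≤ K) ∧ ∀ v w, |g v - g w| ≤ K * ‖v - w‖
theorem BL_testF {K : ℝ} (hK : 0 < K) {g : Vd d → ℝ} (hg : BL K g) :
    (fun v => (2 * K)⁻¹ * g v) ∈ testF d := by
  have hb : ∀ v : Vd d, (1:ℝ) ≤ 1 + ‖v‖ ^ 2 := fun v => by nlinarith [sq_nonneg ‖v‖]
  have hp : ∀ v : Vd d, (0:ℝ) < 1 + ‖v‖ ^ 2 := fun v => by linarith [hb v]
  refine ⟨fun v => ?_, fun v w => ?_⟩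
  · rw [abs_div, abs_mul, abs_inv, abs_of_pos (hp v), abs_of_pos (by positivity : 0 < 2 * K),
      div_le_one (hp v), inv_mul_le_iff₀ (by positivity)]
    nlinarith [hg.1 v, hb v]
  · have hv := hp v
    have hw := hp w
    have e : (2 * K)⁻¹ * g v / (1 + ‖v‖ ^ 2) - (2 * K)⁻¹ * g w / (1 + ‖w‖ ^ 2) =
        (2 * K)⁻¹ * ((g v - g w) / (1 + ‖v‖ ^ 2)
          + g w * (((‖w‖ - ‖v‖) * (‖w‖ + ‖v‖)) / ((1 + ‖v‖ ^ 2) * (1 + ‖w‖ ^ 2)))) := by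
      field_simp
      ring
    have h1 : |(g v - g w) / (1 + ‖v‖ ^ 2)| ≤ K * ‖v - w‖ := by
      rw [abs_div, abs_of_pos hv, div_le_iff₀ hv]
      have := hg.2 v w
      have h0 : 0 ≤ K * ‖v - w‖ := by positivity
      nlinarith [hb v]
    have h2 : |((‖w‖ - ‖v‖) * (‖w‖ + ‖v‖)) / ((1 + ‖v‖ ^ 2) * (1 + ‖w‖ ^ 2))| ≤ ‖v - w‖ := by
      rw [abs_div, abs_of_pos (by positivity : 0 < (1 + ‖v‖ ^ 2) * (1 + ‖w‖ ^ 2)),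
        div_le_iff₀ (by positivity), abs_mul, abs_of_nonneg (by positivity : 0 ≤ ‖w‖ + ‖v‖)]
      have h3 := abs_norm_sub_norm_le w v
      rw [norm_sub_rev] at h3
      gcongr
      nlinarith [sq_nonneg (‖w‖ - 1), sq_nonneg (‖v‖ - 1), sq_nonneg (‖v‖ * ‖w‖)]
    rw [e, abs_mul, abs_inv, abs_of_pos (by positivity : 0 < 2 * K),
      inv_mul_le_iff₀ (by positivity)]
    refine (abs_add_le _ _).trans ?_
    rw [abs_mul (g w)]
    have h4 : |g w| * |((‖w‖ - ‖v‖) * (‖w‖ + ‖v‖)) / ((1 + ‖v‖ ^ 2) * (1 + ‖w‖ ^ 2))|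
        ≤ K * ‖v - w‖ := mul_le_mul (hg.1 w) h2 (abs_nonneg _) hK.le
    linarith
theorem meas_of_BL {α : Type*} [MeasurableSpace α] (Φ : α → Measure (Vd d))
    (hp : ∀ a, IsProbabilityMeasure (Φ a))
    (h : ∀ K > 0, ∀ g : Vd d → ℝ, BL K g → Measurable fun a => ∫ v, g v ∂(Φ a)) :
    Measurable Φ := by
  refine Measurable.measure_of_isPiSystem_of_isProbabilityMeasure
    (S := {s : Set (Vd d) | IsClosed s}) ?_ isPiSystem_isClosed ?_
  · rw [← borel_eq_generateFrom_isClosed]; exact BorelSpace.measurable_eq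
  · intro F hF
    have hδ : ∀ n : ℕ, (0:ℝ) < 1 / ((n:ℝ) + 1) := fun n => by positivity
    have hlim : ∀ a, Tendsto (fun n : ℕ => ENNReal.ofReal
        (∫ v, ((thickenedIndicator (hδ n) F v : ℝ≥0) : ℝ) ∂(Φ a))) atTop (nhds (Φ a F)) := by
      intro a
      have := ENNReal.tendsto_ofReal (tendsto_integral_thickenedIndicator_of_isClosed (Φ a) hF hδ
        tendsto_one_div_add_atTop_nhds_zero_nat)
      simpa using this
    refine measurable_of_tendsto_metrizable (fun n => ?_) (tendsto_pi_nhds.2 hlim)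
    refine ENNReal.measurable_ofReal.comp ?_
    refine h (max 1 ((n:ℝ) + 1)) (by positivity) _ ⟨fun v => ?_, fun v w => ?_⟩
    · rw [abs_of_nonneg (by positivity)]
      refine le_trans ?_ (le_max_left _ _)
      exact_mod_cast thickenedIndicator_le_one (hδ n) F v
    · have h1 := (lipschitzWith_thickenedIndicator (hδ n) F).dist_le_mul v w
      rw [NNReal.dist_eq, dist_eq_norm] at h1
      refine h1.trans ?_
      gcongr
      refine le_trans (le_of_eq ?_) (le_max_right _ _)
      rw [NNReal.coe_inv, Real.coe_toNNReal _ (hδ n).le]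
      simp
theorem joint_meas {Ω : Type*} [MeasurableSpace Ω] (X : ℝ → Ω → ℝ) (hm : ∀ t, Measurable (X t))
    (hr : ∀ ω t, ContinuousWithinAt (fun s => X s ω) (Ici t) t) :
    Measurable fun q : ℝ × Ω => X q.1 q.2 := by
  have hlim : ∀ q : ℝ × Ω, Tendsto
      (fun n : ℕ => X (((⌊q.1 * ((n:ℝ) + 1)⌋ : ℝ) + 1) / ((n:ℝ) + 1)) q.2) atTop
      (nhds (X q.1 q.2)) := by
    rintro ⟨s, ω⟩
    have h1 := hr ω s
    refine Tendsto.comp h1 (tendsto_nhdsWithin_iff.2 ⟨?_, ?_⟩)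
    · have h2 : Tendsto (fun n : ℕ => s + 1 / ((n:ℝ) + 1)) atTop (nhds (s + 0)) :=
        tendsto_const_nhds.add tendsto_one_div_add_atTop_nhds_zero_nat
      rw [add_zero] at h2
      refine tendsto_of_tendsto_of_tendsto_of_le_of_le tendsto_const_nhds h2 ?_ ?_
      · intro n
        have : (0:ℝ) < (n:ℝ) + 1 := by positivity
        dsimp only
        rw [le_div_iff₀ this]
        exact (Int.lt_floor_add_one _).le
      · intro n
        have : (0:ℝ) < (n:ℝ) + 1 := by positivity
        dsimp only
        rw [div_le_iff₀ this, add_mul, one_div, inv_mul_cancel₀ this.ne']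
        linarith [Int.floor_le (s * ((n:ℝ) + 1))]
    · refine Eventually.of_forall fun n => ?_
      have : (0:ℝ) < (n:ℝ) + 1 := by positivity
      simp only [Set.mem_Ici]
      rw [le_div_iff₀ this]
      exact (Int.lt_floor_add_one _).le
  refine measurable_of_tendsto_metrizable (fun n => ?_) (tendsto_pi_nhds.2 hlim)
  have h3 : Measurable fun q : ℤ × Ω => X (((q.1 : ℝ) + 1) / ((n:ℝ) + 1)) q.2 :=
    measurable_from_prod_countable_right fun k => hm (((k : ℝ) + 1) / ((n:ℝ) + 1))
  have h4 : Measurable fun q : ℝ × Ω => ((⌊q.1 * ((n:ℝ) + 1)⌋ : ℤ), q.2) :=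
    (Int.measurable_floor.comp (measurable_fst.mul_const _)).prodMk measurable_snd
  exact h3.comp h4
section proc
variable {Ω : Type*} [m : MeasurableSpace Ω] {B : Vd d → Measure (Vd d)} {N : ℕ} {P : Measure Ω}
  {𝓕 : Filtration ℝ m} {μp : ℝ → Ω → Measure (Vd d)}
theorem proc_rc (h : IsKacProcess B N P 𝓕 μp) {K : ℝ} (hK : 0 < K) {g : Vd d → ℝ} (hg : BL K g)
    (ω : Ω) (t : ℝ) : ContinuousWithinAt (fun s => ∫ v, g v ∂(μp s ω)) (Ici t) t := by
  have := (h.rightCont ω _ (BL_testF hK hg) t).const_smul (2 * K)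
  simp only [integral_const_mul] at this
  refine this.congr (fun s _ => ?_) ?_ <;>
    (simp only [Pi.smul_apply, smul_eq_mul]; field_simp)
theorem proc_adapt (h : IsKacProcess B N P 𝓕 μp) (t : ℝ) : Measurable[𝓕 t] (μp t) := by
  refine @meas_of_BL d Ω (𝓕 t) (μp t) (fun ω => emp_prob (h.mem t ω)) ?_
  intro K hK g hg
  have := h.adapted _ (BL_testF hK hg) t
  simp only [integral_const_mul] at this
  have h2 := Measurable.const_mul this (2 * K)
  convert h2 using 2
  field_simp
theorem proc_meas (h : IsKacProcess B N P 𝓕 μp) (t : ℝ) : Measurable (μp t) :=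
  (proc_adapt h t).mono (𝓕.le t) le_rfl
theorem proc_joint (h : IsKacProcess B N P 𝓕 μp) :
    Measurable fun q : ℝ × Ω => μp q.1 q.2 := by
  refine meas_of_BL _ (fun q => emp_prob (h.mem q.1 q.2)) ?_
  intro K hK g hg
  refine joint_meas (fun t ω => ∫ v, g v ∂(μp t ω)) (fun t => ?_)
    (fun ω t => proc_rc h hK hg ω t)
  have := (h.adapted _ (BL_testF hK hg) t).mono (𝓕.le t) le_rfl
  simp only [integral_const_mul] at this
  have h2 := Measurable.const_mul this (2 * K)
  convert h2 using 2
  field_simp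
end proc
section kern
variable {B : Vd d → Measure (Vd d)} (hd : 2 ≤ d) (hB : IsCollisionKernel B)
include hd hB
theorem inner_meas {φ : (Vd d × Vd d) × Vd d → ℝ} (hφ : Measurable φ) :
    Measurable fun q : Vd d × Vd d => ∫ σ, φ (q, σ) ∂(B (q.1 - q.2)) := by
  classical
  obtain ⟨u₀, hu₀⟩ := exists_unit hd
  let dir : Vd d → Vd d := fun v => if v = 0 then u₀ else ‖v‖⁻¹ • v
  have hdir : Measurable dir :=
    Measurable.ite (measurableSet_singleton 0) measurable_const (by fun_prop)
  have hdn : ∀ v, ‖dir v‖ = 1 := by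
    intro v
    by_cases hv : v = 0
    · simp [dir, hv, hu₀]
    · simp [dir, hv, norm_smul]
  have hBd : ∀ v, B v = ENNReal.ofReal ‖v‖ • B (dir v) := by
    intro v
    rw [← hB.scaling _ (norm_nonneg v) _ (hdn v)]
    by_cases hv : v = 0
    · simp [dir, hv]
    · simp [dir, hv, smul_smul]
  let κ : Kernel (Vd d × Vd d) (Vd d) :=
    ⟨fun q => B (dir (q.1 - q.2)), Measure.measurable_of_measurable_coe _ fun s hs =>
      (hB.measurable s hs).comp (hdir.comp (measurable_fst.sub measurable_snd))⟩
  have : IsMarkovKernel κ := ⟨fun q => hB.prob _ (hdn _)⟩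
  have h1 := StronglyMeasurable.integral_kernel_prod_right' (κ := κ) hφ.stronglyMeasurable
  have h2 : (fun q : Vd d × Vd d => ∫ σ, φ (q, σ) ∂(B (q.1 - q.2))) =
      fun q => ‖q.1 - q.2‖ * ∫ σ, φ (q, σ) ∂(κ q) := by
    ext q
    rw [hBd (q.1 - q.2), integral_smul_measure, ENNReal.toReal_ofReal (norm_nonneg _)]
    rfl
  rw [h2]
  exact (measurable_fst.sub measurable_snd).norm.mul h1.measurable
omit hd hB in
theorem double_meas {α : Type*} [MeasurableSpace α] {Φ : α → Measure (Vd d)}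
    (hΦ : Measurable Φ) (hp : ∀ a, IsProbabilityMeasure (Φ a)) {ψ : Vd d → Vd d → ℝ}
    (hψ : Measurable fun q : Vd d × Vd d => ψ q.1 q.2) :
    Measurable fun a => ∫ v, ∫ vs, ψ v vs ∂(Φ a) ∂(Φ a) := by
  let κ : Kernel α (Vd d) := ⟨Φ, hΦ⟩
  have : IsMarkovKernel κ := ⟨hp⟩
  have h1 := StronglyMeasurable.integral_kernel_prod_right' (κ := Kernel.prodMkRight (Vd d) κ)
    (f := fun q : (α × Vd d) × Vd d => ψ q.1.2 q.2)
    (hψ.comp (measurable_fst.snd.prodMk measurable_snd)).stronglyMeasurable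
  have h2 := StronglyMeasurable.integral_kernel_prod_right' (κ := κ) h1
  exact h2.measurable
omit hd hB in
theorem dlt_meas3 {f : Vd d → ℝ} (hf : Measurable f) :
    Measurable fun q : (Vd d × Vd d) × Vd d => dlt f q.1.1 q.1.2 q.2 := by
  have h1 : Measurable fun q : (Vd d × Vd d) × Vd d => postV q.1.1 q.1.2 q.2 := by
    unfold postV; fun_prop
  have h2 : Measurable fun q : (Vd d × Vd d) × Vd d => postVs q.1.1 q.1.2 q.2 := by
    unfold postVs; fun_prop
  unfold dlt
  exact (((hf.comp h1).add (hf.comp h2)).sub (hf.comp measurable_fst.fst)).sub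
    (hf.comp measurable_fst.snd)
theorem kf_meas {f : Vd d → ℝ} (hf : Measurable f) :
    Measurable fun q : Vd d × Vd d => kf B f q.1 q.2 :=
  inner_meas hd hB (φ := fun q => dlt f q.1.1 q.1.2 q.2) (dlt_meas3 hf)
def kq (B : Vd d → Measure (Vd d)) (f : Vd d → ℝ) (v vs : Vd d) : ℝ :=
  ∫ σ, (dlt f v vs σ) ^ 2 ∂(B (v - vs))
theorem kq_meas {f : Vd d → ℝ} (hf : Measurable f) :
    Measurable fun q : Vd d × Vd d => kq B f q.1 q.2 :=
  inner_meas hd hB (φ := fun q => (dlt f q.1.1 q.1.2 q.2) ^ 2) ((dlt_meas3 hf).pow_const 2)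
theorem QInt_meas {α : Type*} [MeasurableSpace α] {Φ : α → Measure (Vd d)}
    (hΦ : Measurable Φ) (hp : ∀ a, IsProbabilityMeasure (Φ a)) {f : Vd d → ℝ}
    (hf : Measurable f) : Measurable fun a => QInt B f (Φ a) (Φ a) :=
  double_meas hΦ hp (kf_meas hd hB hf)
omit hd hB in
theorem int_meas {α : Type*} [MeasurableSpace α] {Φ : α → Measure (Vd d)}
    (hΦ : Measurable Φ) {f : Vd d → ℝ} (hp : ∀ a, IsProbabilityMeasure (Φ a))
    (hf : Measurable f) : Measurable fun a => ∫ v, f v ∂(Φ a) := by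
  let κ : Kernel α (Vd d) := ⟨Φ, hΦ⟩
  have : IsMarkovKernel κ := ⟨hp⟩
  exact (StronglyMeasurable.integral_kernel_prod_right' (κ := κ) (f := fun q => f q.2)
    (hf.comp measurable_snd).stronglyMeasurable).measurable
end kern
theorem mart_pull {Ω : Type*} [m : MeasurableSpace Ω] {P : Measure Ω} [IsProbabilityMeasure P]
    {𝓕 : Filtration ℝ m} {Z : ℝ → Ω → ℝ} (hZ : Martingale Z 𝓕 P) {s t : ℝ} (hst : s ≤ t)
    {b : Ω → ℝ} (hb : Measurable[𝓕 s] b) {K : ℝ} (hK : ∀ ω, |b ω| ≤ K) :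
    ∫ ω, b ω * Z t ω ∂P = ∫ ω, b ω * Z s ω ∂P := by
  have hbs : StronglyMeasurable[𝓕 s] b := hb.stronglyMeasurable
  have hi : Integrable (b * Z t) P := by
    refine (hZ.integrable t).bdd_mul (c := K) (hb.mono (𝓕.le s) le_rfl).aestronglyMeasurable ?_
    exact Eventually.of_forall hK
  have h1 := condExp_mul_of_stronglyMeasurable_left hbs hi (hZ.integrable t)
  have h2 := hZ.condExp_ae_eq hst
  calc ∫ ω, b ω * Z t ω ∂P = ∫ ω, (P[b * Z t | 𝓕 s]) ω ∂P :=
        (integral_condExp (𝓕.le s)).symm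
    _ = ∫ ω, b ω * Z s ω ∂P := by
        apply integral_congr_ae
        filter_upwards [h1, h2] with ω h3 h4
        rw [h3, Pi.mul_apply, h4]
theorem sq_half {b : ℝ → ℝ} (hb : Measurable b) {K : ℝ} (hK : ∀ s, |b s| ≤ K) (T : ℝ) :
    2 * ∫ s in Ioc 0 T, b s * ∫ r in Ioc 0 s, b r = (∫ s in Ioc 0 T, b s) ^ 2 := by
  classical
  set ν := volume.restrict (Ioc (0:ℝ) T) with hν
  have hK0 : 0 ≤ K := (abs_nonneg _).trans (hK 0)
  have hbi : Integrable b ν :=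
    Integrable.of_bound hb.aestronglyMeasurable K (Eventually.of_forall hK)
  let F : ℝ → ℝ → ℝ := fun s r => if r ≤ s then b s * b r else 0
  have hFm : Measurable (Function.uncurry F) := by
    refine Measurable.ite (measurableSet_le measurable_snd measurable_fst) ?_ measurable_const
    exact (hb.comp measurable_fst).mul (hb.comp measurable_snd)
  have hFb : ∀ s r, |F s r| ≤ K * K := by
    intro s r
    by_cases h : r ≤ s
    · simp only [F, h, if_true, abs_mul]
      exact mul_le_mul (hK s) (hK r) (abs_nonneg _) hK0
    · simp only [F, h, if_false, abs_zero]; positivity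
  have hFi : Integrable (Function.uncurry F) (ν.prod ν) :=
    Integrable.of_bound hFm.aestronglyMeasurable (K * K) (Eventually.of_forall fun q => hFb _ _)
  have h1 : ∀ s ∈ Ioc 0 T, b s * ∫ r in Ioc 0 s, b r = ∫ r, F s r ∂ν := by
    intro s hs
    have e : ∫ r, F s r ∂ν = ∫ r in Ioc 0 T, (Set.Iic s).indicator (fun r => b s * b r) r := by
      rw [hν]
      apply integral_congr_ae
      refine Eventually.of_forall fun r => ?_
      by_cases h : r ≤ s <;> simp [F, h]
    rw [e, setIntegral_indicator measurableSet_Iic, ← integral_const_mul]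
    congr 2
    ext r
    simp only [Set.mem_inter_iff, Set.mem_Ioc, Set.mem_Iic]
    constructor
    · rintro ⟨h, h'⟩; exact ⟨⟨h, h'.trans hs.2⟩, h'⟩
    · rintro ⟨⟨h, _⟩, h'⟩; exact ⟨h, h'⟩
  have h2 : ∫ s in Ioc 0 T, b s * ∫ r in Ioc 0 s, b r = ∫ s, ∫ r, F s r ∂ν ∂ν :=
    setIntegral_congr_fun measurableSet_Ioc h1
  have h3 : ∫ s, ∫ r, F s r ∂ν ∂ν = ∫ s, ∫ r, F r s ∂ν ∂ν := integral_integral_swap hFi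
  rw [two_mul]
  nth_rewrite 2 [h2]
  rw [h2, h3]
  nth_rewrite 1 [← h3]
  have hi1 : Integrable (fun s => ∫ r, F s r ∂ν) ν := hFi.integral_prod_left
  have hi2 : Integrable (fun s => ∫ r, F r s ∂ν) ν := hFi.swap.integral_prod_left
  rw [← integral_add hi1 hi2, pow_two, ← integral_mul_const]
  apply integral_congr_ae
  refine Eventually.of_forall fun s => ?_
  dsimp only
  have hs1 : Integrable (F s) ν :=
    Integrable.of_bound (hFm.comp (measurable_const.prodMk measurable_id)).aestronglyMeasurable
      (K * K) (Eventually.of_forall fun r => hFb _ _)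
  have hs2 : Integrable (fun r => F r s) ν :=
    Integrable.of_bound (hFm.comp (measurable_id.prodMk measurable_const)).aestronglyMeasurable
      (K * K) (Eventually.of_forall fun r => hFb _ _)
  rw [← integral_add hs1 hs2, ← integral_const_mul]
  apply integral_congr_ae
  have hne : ∀ᵐ r ∂ν, r ≠ s := by
    rw [ae_iff]; simp [ν]
  filter_upwards [hne] with r hr
  rcases lt_or_gt_of_ne hr with h | h
  · simp [F, h.le, not_le.2 h]
  · simp [F, h.le, not_le.2 h, mul_comm]
theorem mart_L2 {Ω : Type*} [m : MeasurableSpace Ω] {P : Measure Ω} [IsProbabilityMeasure P]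
    {𝓕 : Filtration ℝ m} {X b a : ℝ → Ω → ℝ}
    (hX : Measurable fun q : ℝ × Ω => X q.1 q.2) (hb : Measurable fun q : ℝ × Ω => b q.1 q.2)
    (ha : Measurable fun q : ℝ × Ω => a q.1 q.2)
    (hXa : ∀ t, Measurable[𝓕 t] (X t)) (hba : ∀ t, Measurable[𝓕 t] (b t))
    {K : ℝ} (hXK : ∀ t ω, |X t ω| ≤ K) (hbK : ∀ t ω, |b t ω| ≤ K) (haK : ∀ t ω, |a t ω| ≤ K)
    (hZ : Martingale (fun t ω => X t ω - ∫ s in Ioc (0:ℝ) t, b s ω) 𝓕 P)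
    (hY : Martingale (fun t ω => X t ω ^ 2 - ∫ s in Ioc (0:ℝ) t, (2 * X s ω * b s ω + a s ω)) 𝓕 P)
    {T : ℝ} (hT : 0 ≤ T) :
    ∫ ω, (X T ω - X 0 ω - ∫ s in Ioc (0:ℝ) T, b s ω) ^ 2 ∂P
      = ∫ ω, (∫ s in Ioc (0:ℝ) T, a s ω) ∂P := by
  have hK0 : 0 ≤ K := by
    obtain ⟨ω⟩ : Nonempty Ω := by
      have : P ≠ 0 := IsProbabilityMeasure.ne_zero P
      exact nonempty_of_isProbabilityMeasure P
    exact (abs_nonneg _).trans (hXK 0 ω)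
  set ν := volume.restrict (Ioc (0:ℝ) T) with hν
  have bi : ∀ (φ : ℝ × Ω → ℝ) (C : ℝ), Measurable φ → (∀ q, |φ q| ≤ C) →
      Integrable φ (ν.prod P) := fun φ C h1 h2 =>
    Integrable.of_bound h1.aestronglyMeasurable C (Eventually.of_forall h2)
  have biP : ∀ (φ : Ω → ℝ) (C : ℝ), Measurable φ → (∀ q, |φ q| ≤ C) →
      Integrable φ P := fun φ C h1 h2 =>
    Integrable.of_bound h1.aestronglyMeasurable C (Eventually.of_forall h2)
  have biν : ∀ (φ : ℝ → ℝ) (C : ℝ), Measurable φ → (∀ q, |φ q| ≤ C) →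
      Integrable φ ν := fun φ C h1 h2 =>
    Integrable.of_bound h1.aestronglyMeasurable C (Eventually.of_forall h2)
  have hXt : ∀ t, Measurable (X t) := fun t => (hXa t).mono (𝓕.le t) le_rfl
  have hbt : ∀ t, Measurable (b t) := fun t => (hba t).mono (𝓕.le t) le_rfl
  have hbω : ∀ ω, Measurable fun s => b s ω := fun ω => hb.comp measurable_prodMk_right
  have hXω : ∀ ω, Measurable fun s => X s ω := fun ω => hX.comp measurable_prodMk_right
  have haω : ∀ ω, Measurable fun s => a s ω := fun ω => ha.comp measurable_prodMk_right
  let A : ℝ → Ω → ℝ := fun t ω => ∫ s in Ioc (0:ℝ) t, b s ω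
  have hAm : Measurable fun q : ℝ × Ω => A q.1 q.2 := by
    have e : (fun q : ℝ × Ω => A q.1 q.2) = fun q : ℝ × Ω =>
        ∫ s, (if 0 < s ∧ s ≤ q.1 then b s q.2 else 0) := by
      ext q
      simp only [A]
      rw [← integral_indicator measurableSet_Ioc]
      congr 1; ext s
      simp [Set.indicator, Set.mem_Ioc]
    rw [e]
    refine (StronglyMeasurable.integral_prod_right (f := fun (q : ℝ × Ω) (s : ℝ) =>
      (if 0 < s ∧ s ≤ q.1 then b s q.2 else 0)) ?_).measurable
    refine Measurable.stronglyMeasurable ?_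
    refine Measurable.ite ?_ (hb.comp (measurable_snd.prodMk measurable_fst.snd)) measurable_const
    exact (measurableSet_lt measurable_const measurable_snd).inter
      (measurableSet_le measurable_snd measurable_fst.fst)
  have hAK : ∀ t ≤ T, ∀ ω, |A t ω| ≤ K * T := by
    intro t ht ω
    have h1 : ‖∫ s in Ioc (0:ℝ) t, b s ω‖ ≤ K * volume.real (Ioc 0 t) :=
      norm_setIntegral_le_of_norm_le_const (by simp) (fun s _ => hbK s ω)
    rw [Real.volume_real_Ioc] at h1
    refine h1.trans ?_
    gcongr
    simp [ht, hT]
  have hAtm : ∀ t, Measurable (A t) := fun t => hAm.comp measurable_prodMk_left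
  let M : ℝ → Ω → ℝ := fun t ω => X t ω - X 0 ω - A t ω
  have hpull : ∀ s ∈ Ioc 0 T, ∫ ω, b s ω * M T ω ∂P = ∫ ω, b s ω * M s ω ∂P := by
    intro s hs
    have h1 := mart_pull hZ hs.2 (hba s) (hbK s)
    have hc : Integrable (fun ω => b s ω * X 0 ω) P := by
      refine biP _ (K * K) ((hbt s).mul (hXt 0)) fun ω => ?_
      rw [abs_mul]; exact mul_le_mul (hbK _ _) (hXK _ _) (abs_nonneg _) hK0
    have hI : ∀ t ≤ T, Integrable (fun ω => b s ω * (X t ω - A t ω)) P := by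
      intro t ht
      refine biP _ (K * (K + K * T)) ((hbt s).mul ((hXt t).sub (hAtm t))) fun ω => ?_
      rw [abs_mul]
      refine mul_le_mul (hbK _ _) ?_ (abs_nonneg _) hK0
      exact (abs_sub _ _).trans (add_le_add (hXK _ _) (hAK t ht ω))
    have e : ∀ t, (fun ω => b s ω * M t ω) =
        fun ω => b s ω * (X t ω - A t ω) - b s ω * X 0 ω := by
      intro t; ext ω; simp only [M]; ring
    rw [e, e, integral_sub (hI T le_rfl) hc, integral_sub (hI s hs.2) hc, h1]
  have hp0 : ∫ ω, X 0 ω * M T ω ∂P = 0 := by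
    have h1 := mart_pull hZ hT (hXa 0) (hXK 0)
    have hI : Integrable (fun ω => X 0 ω * (X T ω - A T ω)) P := by
      refine biP _ (K * (K + K * T)) ((hXt 0).mul ((hXt T).sub (hAtm T))) fun ω => ?_
      rw [abs_mul]
      refine mul_le_mul (hXK _ _) ?_ (abs_nonneg _) hK0
      exact (abs_sub _ _).trans (add_le_add (hXK _ _) (hAK T le_rfl ω))
    have hc : Integrable (fun ω => X 0 ω * X 0 ω) P := by
      refine biP _ (K * K) ((hXt 0).mul (hXt 0)) fun ω => ?_
      rw [abs_mul]; exact mul_le_mul (hXK _ _) (hXK _ _) (abs_nonneg _) hK0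
    have e : (fun ω => X 0 ω * M T ω) =
        fun ω => X 0 ω * (X T ω - A T ω) - X 0 ω * X 0 ω := by
      ext ω; simp only [M]; ring
    rw [e, integral_sub hI hc]
    rw [show (fun ω => X 0 ω * (X T ω - A T ω)) =
      fun ω => X 0 ω * (X T ω - ∫ s in Ioc (0:ℝ) T, b s ω) from rfl, h1]
    simp
  have hy0 : ∫ ω, (X T ω ^ 2 - ∫ s in Ioc (0:ℝ) T, (2 * X s ω * b s ω + a s ω)) ∂P
      = ∫ ω, X 0 ω ^ 2 ∂P := by
    have h1 := mart_pull hY hT (b := fun _ => 1) measurable_const (K := 1) (by simp)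
    simpa using h1
  have hti : ∀ (φ : ℝ × Ω → ℝ) (C : ℝ), Measurable φ → (∀ q, |φ q| ≤ C) →
      Integrable (fun ω => ∫ s, φ (s, ω) ∂ν) P := fun φ C h1 h2 =>
    (bi φ C h1 h2).swap.integral_prod_left
  have hMm : Measurable fun q : ℝ × Ω => M q.1 q.2 :=
    (hX.sub (hX.comp (measurable_const.prodMk measurable_snd))).sub hAm
  have hMT : Measurable (M T) := hMm.comp measurable_prodMk_left
  have hMK : ∀ t ≤ T, ∀ ω, |M t ω| ≤ K + K + K * T := fun t ht ω =>
    (abs_sub _ _).trans (add_le_add ((abs_sub _ _).trans (add_le_add (hXK _ _) (hXK _ _)))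
      (hAK t ht ω))
  have hKT : 0 ≤ K + K + K * T := by positivity
  have hMA : ∫ ω, M T ω * A T ω ∂P = ∫ ω, (∫ s, b s ω * M s ω ∂ν) ∂P := by
    have e1 : ∀ ω, M T ω * A T ω = ∫ s, b s ω * M T ω ∂ν := by
      intro ω
      rw [integral_mul_const, mul_comm]
    simp_rw [e1]
    have hi1 : Integrable (Function.uncurry fun ω s => b s ω * M T ω) (P.prod ν) := by
      refine (bi (fun q => b q.1 q.2 * M T q.2) (K * (K + K + K * T))
        (hb.mul (hMT.comp measurable_snd)) fun q => ?_).swap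
      rw [abs_mul]
      exact mul_le_mul (hbK _ _) (hMK T le_rfl _) (abs_nonneg _) hK0
    have hi2 : Integrable (Function.uncurry fun ω s => b s ω * M s ω) (P.prod ν) := by
      have : Integrable (fun q : ℝ × Ω => b q.1 q.2 * M q.1 q.2) (ν.prod P) := by
        refine Integrable.of_bound (hb.mul hMm).aestronglyMeasurable (K * (K + K + K * T)) ?_
        have : ∀ᵐ q ∂(ν.prod P), q.1 ≤ T := by
          have h0 : ∀ᵐ s ∂ν, s ≤ T := by
            filter_upwards [ae_restrict_mem measurableSet_Ioc] with s hs using hs.2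
          exact Measure.quasiMeasurePreserving_fst.ae h0
        filter_upwards [this] with q hq
        rw [norm_eq_abs, abs_mul]
        exact mul_le_mul (hbK _ _) (hMK _ hq _) (abs_nonneg _) hK0
      exact this.swap
    rw [integral_integral_swap hi1, integral_integral_swap hi2]
    exact setIntegral_congr_fun measurableSet_Ioc hpull
  have e2 : ∀ ω, ∫ s, b s ω * M s ω ∂ν
      = (∫ s, X s ω * b s ω ∂ν) - X 0 ω * A T ω - A T ω ^ 2 / 2 := by
    intro ω
    have hi1 : Integrable (fun s => X s ω * b s ω) ν := by
      refine biν _ (K * K) ((hXω ω).mul (hbω ω)) fun s => ?_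
      rw [abs_mul]; exact mul_le_mul (hXK _ _) (hbK _ _) (abs_nonneg _) hK0
    have hi2 : Integrable (fun s => X 0 ω * b s ω) ν := by
      refine biν _ (K * K) ((hbω ω).const_mul _) fun s => ?_
      rw [abs_mul]; exact mul_le_mul (hXK _ _) (hbK _ _) (abs_nonneg _) hK0
    have hi3 : Integrable (fun s => b s ω * A s ω) ν := by
      refine Integrable.of_bound ((hbω ω).mul
        (hAm.comp measurable_prodMk_right)).aestronglyMeasurable (K * (K * T)) ?_
      filter_upwards [ae_restrict_mem measurableSet_Ioc] with s hs
      rw [norm_eq_abs, abs_mul]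
      exact mul_le_mul (hbK _ _) (hAK s hs.2 ω) (abs_nonneg _) hK0
    have e3 : (fun s => b s ω * M s ω) =
        fun s => X s ω * b s ω - X 0 ω * b s ω - b s ω * A s ω := by
      ext s; simp only [M]; ring
    rw [e3, integral_sub (hi1.sub' hi2) hi3, integral_sub hi1 hi2, integral_const_mul]
    have h5 := sq_half (hbω ω) (fun s => hbK s ω) T
    have h6 : ∫ s, b s ω * A s ω ∂ν = A T ω ^ 2 / 2 := by
      simp only [A, ν]
      linarith
    rw [h6]
  have hXbi : Integrable (fun ω => ∫ s, X s ω * b s ω ∂ν) P :=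
    hti (fun q => X q.1 q.2 * b q.1 q.2) (K * K) (hX.mul hb) fun q => by
      rw [abs_mul]; exact mul_le_mul (hXK _ _) (hbK _ _) (abs_nonneg _) hK0
  have hai : Integrable (fun ω => ∫ s, a s ω ∂ν) P :=
    hti (fun q => a q.1 q.2) K ha fun q => haK _ _
  have e4 : ∀ ω, ∫ s, (2 * X s ω * b s ω + a s ω) ∂ν =
      2 * (∫ s, X s ω * b s ω ∂ν) + ∫ s, a s ω ∂ν := by
    intro ω
    have hi1 : Integrable (fun s => X s ω * b s ω) ν := by
      refine biν _ (K * K) ((hXω ω).mul (hbω ω)) fun s => ?_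
      rw [abs_mul]; exact mul_le_mul (hXK _ _) (hbK _ _) (abs_nonneg _) hK0
    have hi2 : Integrable (fun s => a s ω) ν := biν _ K (haω ω) fun s => haK _ _
    rw [← integral_const_mul, ← integral_add (hi1.const_mul 2) hi2]
    congr 1; ext s; ring
  have hX2 : ∀ t, Integrable (fun ω => X t ω ^ 2) P := fun t =>
    biP _ (K * K) ((hXt t).pow_const 2) fun ω => by
      rw [abs_pow, pow_two]; exact mul_le_mul (hXK _ _) (hXK _ _) (abs_nonneg _) hK0
  have hX0M : Integrable (fun ω => X 0 ω * M T ω) P :=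
    biP _ (K * (K + K + K * T)) ((hXt 0).mul hMT) fun ω => by
      rw [abs_mul]; exact mul_le_mul (hXK _ _) (hMK T le_rfl _) (abs_nonneg _) hK0
  have hMAi : Integrable (fun ω => M T ω * A T ω) P :=
    biP _ ((K + K + K * T) * (K * T)) (hMT.mul (hAtm T)) fun ω => by
      rw [abs_mul]; exact mul_le_mul (hMK T le_rfl _) (hAK T le_rfl _) (abs_nonneg _) hKT
  have hX0A : Integrable (fun ω => X 0 ω * A T ω) P :=
    biP _ (K * (K * T)) ((hXt 0).mul (hAtm T)) fun ω => by
      rw [abs_mul]; exact mul_le_mul (hXK _ _) (hAK T le_rfl _) (abs_nonneg _) hK0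
  have hA2 : Integrable (fun ω => A T ω ^ 2) P :=
    biP _ ((K * T) * (K * T)) ((hAtm T).pow_const 2) fun ω => by
      rw [abs_pow, pow_two]
      exact mul_le_mul (hAK T le_rfl _) (hAK T le_rfl _) (abs_nonneg _) (by positivity)
  simp_rw [e2] at hMA
  rw [integral_sub (hXbi.sub' hX0A) (hA2.div_const 2), integral_sub hXbi hX0A,
    integral_div] at hMA
  change ∫ ω, (X T ω ^ 2 - ∫ s, (2 * X s ω * b s ω + a s ω) ∂ν) ∂P = _ at hy0
  simp_rw [e4] at hy0
  rw [integral_sub (hX2 T) ((hXbi.const_mul 2).fun_add hai),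
    integral_add (hXbi.const_mul 2) hai, integral_const_mul] at hy0
  have e5 : (fun ω => (X T ω - X 0 ω - ∫ s in Ioc (0:ℝ) T, b s ω) ^ 2) =
      fun ω => X T ω ^ 2 - X 0 ω ^ 2 - 2 * (X 0 ω * M T ω) - 2 * (X 0 ω * A T ω)
        - 2 * (M T ω * A T ω) - A T ω ^ 2 := by
    ext ω; simp only [M, A]; ring
  rw [e5, integral_sub ((((hX2 T).sub' (hX2 0)).sub' (hX0M.const_mul 2)).sub' (hX0A.const_mul 2)
      |>.sub' (hMAi.const_mul 2)) hA2,
    integral_sub ((((hX2 T).sub' (hX2 0)).sub' (hX0M.const_mul 2)).sub' (hX0A.const_mul 2))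
      (hMAi.const_mul 2),
    integral_sub (((hX2 T).sub' (hX2 0)).sub' (hX0M.const_mul 2)) (hX0A.const_mul 2),
    integral_sub ((hX2 T).sub' (hX2 0)) (hX0M.const_mul 2), integral_sub (hX2 T) (hX2 0),
    integral_const_mul, integral_const_mul, integral_const_mul, hp0, hMA]
  linarith
theorem emp_double_le {N : ℕ} {μ : Measure (Vd d)} (h : μ ∈ empiricalSphere d N)
    {ψ φ : Vd d → Vd d → ℝ} (h1 : ∀ v vs, ‖v‖ ^ 2 + ‖vs‖ ^ 2 ≤ (N : ℝ) → ψ v vs ≤ φ v vs)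
    (h2 : ∀ v, ‖v‖ ^ 2 ≤ (N : ℝ) → ψ v v ≤ φ v v) :
    ∫ v, ∫ vs, ψ v vs ∂μ ∂μ ≤ ∫ v, ∫ vs, φ v vs ∂μ ∂μ := by
  obtain ⟨x, hx, hf, hs⟩ := emp_rep h
  simp only [hf]
  gcongr with i _ j _
  by_cases hij : i = j
  · subst hij; exact h2 _ (emp_ball hs i)
  · exact h1 _ _ (emp_ball2 hs hij)
theorem emp_double_congr {N : ℕ} {μ : Measure (Vd d)} (h : μ ∈ empiricalSphere d N)
    {ψ φ : Vd d → Vd d → ℝ} (h1 : ∀ v vs, ‖v‖ ^ 2 + ‖vs‖ ^ 2 ≤ (N : ℝ) → ψ v vs = φ v vs)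
    (h2 : ∀ v, ‖v‖ ^ 2 ≤ (N : ℝ) → ψ v v = φ v v) :
    ∫ v, ∫ vs, ψ v vs ∂μ ∂μ = ∫ v, ∫ vs, φ v vs ∂μ ∂μ :=
  le_antisymm (emp_double_le h (fun v vs hv => (h1 v vs hv).le) fun v hv => (h2 v hv).le)
    (emp_double_le h (fun v vs hv => (h1 v vs hv).ge) fun v hv => (h2 v hv).ge)
theorem emp_le {N : ℕ} {μ : Measure (Vd d)} (h : μ ∈ empiricalSphere d N)
    {ψ φ : Vd d → ℝ} (h1 : ∀ v, ‖v‖ ^ 2 ≤ (N : ℝ) → ψ v ≤ φ v) :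
    ∫ v, ψ v ∂μ ≤ ∫ v, φ v ∂μ := by
  obtain ⟨x, hx, hf, hs⟩ := emp_rep h
  simp only [hf]
  gcongr with i _
  exact h1 _ (emp_ball hs i)
theorem emp_congr {N : ℕ} {μ : Measure (Vd d)} (h : μ ∈ empiricalSphere d N)
    {ψ φ : Vd d → ℝ} (h1 : ∀ v, ‖v‖ ^ 2 ≤ (N : ℝ) → ψ v = φ v) :
    ∫ v, ψ v ∂μ = ∫ v, φ v ∂μ :=
  le_antisymm (emp_le h fun v hv => (h1 v hv).le) (emp_le h fun v hv => (h1 v hv).ge)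
theorem emp_abs_le {N : ℕ} {μ : Measure (Vd d)} (h : μ ∈ empiricalSphere d N)
    {ψ : Vd d → ℝ} {K : ℝ} (h1 : ∀ v, ‖v‖ ^ 2 ≤ (N : ℝ) → |ψ v| ≤ K) :
    |∫ v, ψ v ∂μ| ≤ K := by
  have := emp_prob h
  have e : ∫ _, K ∂μ = K := by simp
  have e' : ∫ _, -K ∂μ = -K := by simp
  rw [abs_le]
  constructor
  · rw [← e']; exact emp_le h fun v hv => (abs_le.1 (h1 v hv)).1
  · conv_rhs => rw [← e]
    exact emp_le h fun v hv => (abs_le.1 (h1 v hv)).2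
theorem post_ball {v vs σ : Vd d} {R : ℝ} (hv : ‖v‖ ^ 2 + ‖vs‖ ^ 2 ≤ R) (hσ : ‖σ‖ = 1) :
    ‖postV v vs σ‖ ^ 2 ≤ R ∧ ‖postVs v vs σ‖ ^ 2 ≤ R := by
  have := post_energy v vs σ hσ
  constructor <;> nlinarith [sq_nonneg ‖postV v vs σ‖, sq_nonneg ‖postVs v vs σ‖]
theorem dlt_ball {f : Vd d → ℝ} {K R : ℝ} (hf : ∀ v, ‖v‖ ^ 2 ≤ R → |f v| ≤ K)
    {v vs σ : Vd d} (hv : ‖v‖ ^ 2 + ‖vs‖ ^ 2 ≤ R) (hσ : ‖σ‖ = 1) :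
    |dlt f v vs σ| ≤ 4 * K := by
  obtain ⟨a, b⟩ := post_ball hv hσ
  have h1 := abs_le.1 (hf _ a)
  have h2 := abs_le.1 (hf _ b)
  have h3 := abs_le.1 (hf v (by nlinarith [sq_nonneg ‖vs‖]))
  have h4 := abs_le.1 (hf vs (by nlinarith [sq_nonneg ‖v‖]))
  simp only [dlt]
  rw [abs_le]
  constructor <;> linarith [h1.1, h1.2, h2.1, h2.2, h3.1, h3.2, h4.1, h4.2]
section
variable {B : Vd d → Measure (Vd d)} (hd : 2 ≤ d) (hB : IsCollisionKernel B)
include hd hB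
theorem kf_ball {f : Vd d → ℝ} {K R : ℝ} (hf : ∀ v, ‖v‖ ^ 2 ≤ R → |f v| ≤ K)
    {v vs : Vd d} (hv : ‖v‖ ^ 2 + ‖vs‖ ^ 2 ≤ R) : |kf B f v vs| ≤ 4 * K * ‖v - vs‖ :=
  B_int_le hd hB _ fun _ hσ => dlt_ball hf hv hσ
theorem kf_congr {f g : Vd d → ℝ} {R : ℝ} (hf : ∀ v, ‖v‖ ^ 2 ≤ R → f v = g v)
    {v vs : Vd d} (hv : ‖v‖ ^ 2 + ‖vs‖ ^ 2 ≤ R) : kf B f v vs = kf B g v vs := by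
  unfold kf
  apply integral_congr_ae
  filter_upwards [B_sphere hd hB (v - vs)] with σ hσ
  obtain ⟨a, b⟩ := post_ball hv hσ
  simp only [dlt]
  rw [hf _ a, hf _ b, hf v (by nlinarith [sq_nonneg ‖vs‖]), hf vs (by nlinarith [sq_nonneg ‖v‖])]
theorem QInt_congr {N : ℕ} {μ : Measure (Vd d)} (h : μ ∈ empiricalSphere d N) {f g : Vd d → ℝ}
    (hf : ∀ v, ‖v‖ ^ 2 ≤ (N : ℝ) → f v = g v) : QInt B f μ μ = QInt B g μ μ := by
  simp only [QInt_eq]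
  exact emp_double_congr h (fun v vs hv => kf_congr hd hB hf hv)
    fun v hv => by rw [kf_self hd hB, kf_self hd hB]
theorem QInt_abs {N : ℕ} {μ : Measure (Vd d)} (h : μ ∈ empiricalSphere d N) {f : Vd d → ℝ} {K : ℝ}
    (hf : ∀ v, ‖v‖ ^ 2 ≤ (N : ℝ) → |f v| ≤ K) : |QInt B f μ μ| ≤ 8 * K * N := by
  have := emp_prob h
  have hN : (1:ℝ) ≤ N := by exact_mod_cast Nat.one_le_iff_ne_zero.2 (emp_N_ne h)
  have hK : 0 ≤ K := (abs_nonneg _).trans (hf 0 (by simp))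
  have key : ∀ v vs : Vd d, ‖v‖ ^ 2 + ‖vs‖ ^ 2 ≤ (N:ℝ) → |kf B f v vs| ≤ 8 * K * N := by
    intro v vs hv
    refine (kf_ball hd hB hf hv).trans ?_
    have h1 : ‖v - vs‖ ≤ 2 * N := by
      have := norm_sub_le v vs
      have h1 : ‖v‖ ≤ N := by
        by_contra hc; push Not at hc; nlinarith [sq_nonneg ‖vs‖]
      have h2 : ‖vs‖ ≤ N := by
        by_contra hc; push Not at hc; nlinarith [sq_nonneg ‖v‖]
      linarith
    nlinarith
  have e : ∫ _, ∫ _, 8 * K * N ∂μ ∂μ = 8 * K * N := by simp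
  have e' : ∫ _, ∫ _, -(8 * K * N) ∂μ ∂μ = -(8 * K * N) := by simp
  rw [QInt_eq, abs_le]
  have h0 : 0 ≤ 8 * K * N := by positivity
  constructor
  · rw [← e']
    exact emp_double_le h (fun v vs hv => (abs_le.1 (key v vs hv)).1)
      fun v hv => by rw [kf_self hd hB]; linarith
  · conv_rhs => rw [← e]
    exact emp_double_le h (fun v vs hv => (abs_le.1 (key v vs hv)).2)
      fun v hv => by rw [kf_self hd hB]; linarith
end
theorem coll_lint {N : ℕ} (hN : N ≠ 0) {x : Fin N → Vd d} {i j : Fin N} (hij : i ≠ j) (σ : Vd d)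
    {φ : Vd d → ℝ≥0∞} (hφ : Measurable φ) :
    (∫⁻ w, φ w ∂(collUpdate N ((N : ℝ≥0∞)⁻¹ • ∑ i, Measure.dirac (x i)) (x i) (x j) σ))
      + (N : ℝ≥0∞)⁻¹ * (φ (x i) + φ (x j))
      = (∫⁻ w, φ w ∂((N : ℝ≥0∞)⁻¹ • ∑ i, Measure.dirac (x i)))
        + (N : ℝ≥0∞)⁻¹ * (φ (postV (x i) (x j) σ) + φ (postVs (x i) (x j) σ)) := by
  have hN' : (N : ℝ≥0∞)⁻¹ ≠ ⊤ := by simp [hN]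
  set μ : Measure (Vd d) := (N : ℝ≥0∞)⁻¹ • ∑ i, Measure.dirac (x i) with hμ
  set c : Measure (Vd d) := (N : ℝ≥0∞)⁻¹ • (Measure.dirac (x i) + Measure.dirac (x j)) with hc
  have hle : c ≤ μ := by
    rw [hc, hμ]
    have : Measure.dirac (x i) + Measure.dirac (x j) ≤ ∑ i, Measure.dirac (x i) := by
      classical
      rw [← Finset.sum_pair (f := fun i => Measure.dirac (x i)) hij]
      rw [← Finset.sum_sdiff (Finset.subset_univ {i, j})]
      exact Measure.le_add_left le_rfl
    intro s
    simp only [Measure.smul_apply, smul_eq_mul]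
    gcongr
  have : IsFiniteMeasure c := by
    refine ⟨?_⟩
    simp only [hc, Measure.smul_apply, smul_eq_mul]
    exact ENNReal.mul_lt_top hN'.lt_top (measure_lt_top _ _)
  have h1 : collUpdate N μ (x i) (x j) σ + c = μ + (N : ℝ≥0∞)⁻¹ •
      (Measure.dirac (postV (x i) (x j) σ) + Measure.dirac (postVs (x i) (x j) σ)) := by
    unfold collUpdate
    exact Measure.sub_add_cancel_of_le (hle.trans (Measure.le_add_right le_rfl))
  have h2 := congrArg (fun m : Measure (Vd d) => ∫⁻ w, φ w ∂m) h1
  simp only [lintegral_add_measure, hc, lintegral_smul_measure, smul_eq_mul,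
    lintegral_dirac' _ hφ] at h2
  exact h2
def GG (g : Vd d → ℝ) (K : ℝ) (ν : Measure (Vd d)) : ℝ :=
  min (4 * K) (∫⁻ v, ENNReal.ofReal (g v) ∂ν).toReal
theorem GG_meas {g : Vd d → ℝ} (hg : Measurable g) (K : ℝ) : Measurable (GG g K) := by
  unfold GG
  exact measurable_const.min (Measure.measurable_lintegral hg.ennreal_ofReal).ennreal_toReal
theorem GG_bd {g : Vd d → ℝ} {K : ℝ} (hK : 0 ≤ K) (ν : Measure (Vd d)) : |GG g K ν| ≤ 4 * K := by
  unfold GG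
  rw [abs_of_nonneg (le_min (by positivity) ENNReal.toReal_nonneg)]
  exact min_le_left _ _
theorem emp_lint {N : ℕ} {μ : Measure (Vd d)} (h : μ ∈ empiricalSphere d N) {g : Vd d → ℝ}
    (h0 : ∀ v, 0 ≤ g v) : ∫⁻ v, ENNReal.ofReal (g v) ∂μ = ENNReal.ofReal (∫ v, g v ∂μ) :=
  (ofReal_integral_eq_lintegral_ofReal (emp_integrable h g) (Eventually.of_forall h0)).symm
theorem GG_emp {N : ℕ} {μ : Measure (Vd d)} (h : μ ∈ empiricalSphere d N) {g : Vd d → ℝ} {K : ℝ}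
    (h0 : ∀ v, 0 ≤ g v) (hK : ∀ v, g v ≤ K) : GG g K μ = ∫ v, g v ∂μ := by
  have hK0 : 0 ≤ K := (h0 0).trans (hK 0)
  unfold GG
  rw [emp_lint h h0, ENNReal.toReal_ofReal (integral_nonneg h0), min_eq_right]
  have := emp_abs_le h (ψ := g) (K := K) fun v _ => by rw [abs_of_nonneg (h0 v)]; exact hK v
  linarith [le_abs_self (∫ v, g v ∂μ)]
theorem GG_coll {N : ℕ} {x : Fin N → Vd d}
    (h : (N : ℝ≥0∞)⁻¹ • ∑ i, Measure.dirac (x i) ∈ empiricalSphere d N)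
    {i j : Fin N} (hij : i ≠ j) (σ : Vd d) {g : Vd d → ℝ} (hg : Measurable g) {K : ℝ}
    (h0 : ∀ v, 0 ≤ g v) (hK : ∀ v, g v ≤ K) :
    GG g K (collUpdate N ((N : ℝ≥0∞)⁻¹ • ∑ i, Measure.dirac (x i)) (x i) (x j) σ)
      = (∫ v, g v ∂((N : ℝ≥0∞)⁻¹ • ∑ i, Measure.dirac (x i)))
        + (N : ℝ)⁻¹ * dlt g (x i) (x j) σ := by
  have hN := emp_N_ne h
  have h1 := coll_lint hN hij σ hg.ennreal_ofReal (x := x)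
  set μ : Measure (Vd d) := (N : ℝ≥0∞)⁻¹ • ∑ i, Measure.dirac (x i) with hμ
  rw [emp_lint h h0] at h1
  have hNr : (N : ℝ≥0∞)⁻¹ = ENNReal.ofReal ((N : ℝ)⁻¹) := by
    rw [ENNReal.ofReal_inv_of_pos (by positivity)]; simp
  have hI0 : 0 ≤ ∫ v, g v ∂μ := integral_nonneg h0
  rw [hNr, ← ENNReal.ofReal_add (h0 _) (h0 _), ← ENNReal.ofReal_add (h0 _) (h0 _),
    ← ENNReal.ofReal_mul (by positivity), ← ENNReal.ofReal_mul (by positivity),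
    ← ENNReal.ofReal_add hI0 (mul_nonneg (by positivity) (add_nonneg (h0 _) (h0 _)))] at h1
  have hfin : ∫⁻ w, ENNReal.ofReal (g w) ∂(collUpdate N μ (x i) (x j) σ) ≠ ⊤ := by
    intro hc; rw [hc] at h1; simp at h1
  have h2 := congrArg ENNReal.toReal h1
  rw [ENNReal.toReal_add hfin ENNReal.ofReal_ne_top,
    ENNReal.toReal_ofReal (mul_nonneg (by positivity) (add_nonneg (h0 _) (h0 _))),
    ENNReal.toReal_ofReal (add_nonneg hI0 (mul_nonneg (by positivity) (add_nonneg (h0 _) (h0 _))))] at h2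
  have hI : ∫ v, g v ∂μ ≤ K := by
    have := emp_abs_le h (ψ := g) (K := K) fun v _ => by rw [abs_of_nonneg (h0 v)]; exact hK v
    linarith [le_abs_self (∫ v, g v ∂μ)]
  have hN1 : (N:ℝ)⁻¹ ≤ 1 := inv_le_one_of_one_le₀ (by exact_mod_cast Nat.one_le_iff_ne_zero.2 hN)
  have hNp : 0 ≤ (N:ℝ)⁻¹ := by positivity
  have hK0 : 0 ≤ K := (h0 0).trans (hK 0)
  have e : (∫⁻ w, ENNReal.ofReal (g w) ∂(collUpdate N μ (x i) (x j) σ)).toReal =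
      (∫ v, g v ∂μ) + (N : ℝ)⁻¹ * dlt g (x i) (x j) σ := by
    simp only [dlt]; linarith
  unfold GG
  rw [e, min_eq_right]
  rw [← e]
  have := h0 (x i); have := h0 (x j)
  have := hK (postV (x i) (x j) σ); have := hK (postVs (x i) (x j) σ)
  have h5 : (N:ℝ)⁻¹ * (g (postV (x i) (x j) σ) + g (postVs (x i) (x j) σ)) ≤ 1 * (K + K) := by
    apply mul_le_mul hN1 (by linarith) (add_nonneg (h0 _) (h0 _)) (by norm_num)
  have h6 : 0 ≤ (N:ℝ)⁻¹ * (g (x i) + g (x j)) := mul_nonneg hNp (by linarith)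
  linarith
section
variable {B : Vd d → Measure (Vd d)} (hd : 2 ≤ d) (hB : IsCollisionKernel B)
include hd hB
theorem gen_GG {N : ℕ} {μ : Measure (Vd d)} (h : μ ∈ empiricalSphere d N) {g : Vd d → ℝ}
    (hg : Measurable g) {K : ℝ} (h0 : ∀ v, 0 ≤ g v) (hK : ∀ v, g v ≤ K) :
    kacGen B N (GG g K) μ = QInt B g μ μ := by
  obtain ⟨x, hx, hf, hs⟩ := emp_rep h
  have hN : (N:ℝ) ≠ 0 := by exact_mod_cast emp_N_ne h
  have key : ∀ i j, ∫ σ, (GG g K (collUpdate N μ (x i) (x j) σ) - GG g K μ) ∂(B (x i - x j))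
      = (N:ℝ)⁻¹ * kf B g (x i) (x j) := by
    intro i j
    by_cases hij : i = j
    · subst hij; rw [kf_self hd hB, sub_self, B_zero hd hB]; simp
    · unfold kf
      rw [← integral_const_mul]
      congr 1; ext σ
      rw [GG_emp h h0 hK]
      subst hx
      rw [GG_coll h hij σ hg h0 hK]; ring
  unfold kacGen
  rw [QInt_eq]
  simp only [hf, key, Finset.mul_sum]
  refine Finset.sum_congr rfl fun i _ => Finset.sum_congr rfl fun j _ => ?_
  field_simp
theorem gen_GG2 {N : ℕ} {μ : Measure (Vd d)} (h : μ ∈ empiricalSphere d N) {g : Vd d → ℝ}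
    (hg : Measurable g) {K : ℝ} (h0 : ∀ v, 0 ≤ g v) (hK : ∀ v, g v ≤ K) :
    kacGen B N (fun ν => GG g K ν ^ 2) μ = 2 * (∫ v, g v ∂μ) * QInt B g μ μ
      + (N:ℝ)⁻¹ * ∫ v, ∫ vs, kq B g v vs ∂μ ∂μ := by
  obtain ⟨x, hx, hf, hs⟩ := emp_rep h
  have hN : (N:ℝ) ≠ 0 := by exact_mod_cast emp_N_ne h
  have hgK : ∀ v, |g v| ≤ K := fun v => by rw [abs_of_nonneg (h0 v)]; exact hK v
  obtain ⟨X, hX⟩ : ∃ X, X = ∫ v, g v ∂μ := ⟨_, rfl⟩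
  rw [← hX]
  have key : ∀ i j, ∫ σ, (GG g K (collUpdate N μ (x i) (x j) σ) ^ 2 - GG g K μ ^ 2) ∂(B (x i - x j))
      = 2 * X * (N:ℝ)⁻¹ * kf B g (x i) (x j) + (N:ℝ)⁻¹ ^ 2 * kq B g (x i) (x j) := by
    intro i j
    by_cases hij : i = j
    · subst hij; unfold kf kq; rw [sub_self, B_zero hd hB]; simp
    · unfold kf kq
      have hb : ∀ σ : Vd d, ‖σ‖ = 1 → |dlt g (x i) (x j) σ| ≤ 4 * K := fun σ hσ =>
        dlt_ball (R := N) (fun v _ => hgK v) (emp_ball2 hs hij) hσ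
      have i1 : Integrable (fun σ => dlt g (x i) (x j) σ) (B (x i - x j)) :=
        B_integrable hd hB _ (dlt_meas' hg _ _) hb
      have i2 : Integrable (fun σ => dlt g (x i) (x j) σ ^ 2) (B (x i - x j)) :=
        B_integrable hd hB _ ((dlt_meas' hg _ _).pow_const 2) (K := (4 * K) ^ 2) fun σ hσ => by
          rw [abs_pow]; exact pow_le_pow_left₀ (abs_nonneg _) (hb σ hσ) 2
      rw [← integral_const_mul, ← integral_const_mul,
        ← integral_add (i1.const_mul _) (i2.const_mul _)]
      congr 1; ext σ
      rw [GG_emp h h0 hK]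
      subst hx
      rw [GG_coll h hij σ hg h0 hK, ← hX]; ring
  unfold kacGen
  rw [QInt_eq]
  clear hX
  simp only [hf]
  simp only [key, Finset.mul_sum, ← Finset.sum_add_distrib]
  refine Finset.sum_congr rfl fun i _ => Finset.sum_congr rfl fun j _ => ?_
  field_simp
end
theorem max_grid {Ω : Type*} [m : MeasurableSpace Ω] {P : Measure Ω} [IsProbabilityMeasure P]
    {𝓕 : Filtration ℝ m} {ι : Type*} (s : Finset ι) (c : ι → ℝ) (hc : ∀ i, 0 ≤ c i)
    (Z : ι → ℝ → Ω → ℝ) (hZ : ∀ i ∈ s, Martingale (Z i) 𝓕 P) {T : ℝ} (hT : 0 ≤ T) {a : ℝ} (ha : 0 < a)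
    (n : ℕ) :
    ENNReal.ofReal a * P {ω | ∃ k : ℕ, k ≤ 2 ^ n ∧ a ≤ ∑ i ∈ s, c i * |Z i (k * T / 2 ^ n) ω - Z i 0 ω|}
      ≤ ENNReal.ofReal (∫ ω, ∑ i ∈ s, c i * |Z i T ω - Z i 0 ω| ∂P) := by
  classical
  let τ : ℕ → ℝ := fun k => k * T / 2 ^ n
  have hτ : Monotone τ := by
    intro k l hkl
    have : (k : ℝ) ≤ l := by exact_mod_cast hkl
    simp only [τ]; gcongr
  have hτ0 : ∀ k, 0 ≤ τ k := fun k => by simp only [τ]; positivity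
  have hτT : τ (2 ^ n) = T := by simp only [τ]; push_cast; field_simp
  let 𝓖 : Filtration ℕ m :=
    { seq := fun k => 𝓕 (τ k)
      mono' := fun k l hkl => 𝓕.mono (hτ hkl)
      le' := fun k => 𝓕.le _ }
  let M : ι → ℕ → Ω → ℝ := fun i k ω => Z i (τ k) ω - Z i 0 ω
  have hM : ∀ i ∈ s, Martingale (M i) 𝓖 P := by
    intro i hi
    have h1 : Martingale (fun k => Z i (τ k)) 𝓖 P :=
      ⟨fun k => (hZ i hi).1 (τ k), fun k l hkl => (hZ i hi).2 _ _ (hτ hkl)⟩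
    have h2 : Martingale (fun _ : ℕ => Z i 0) 𝓖 P := by
      refine martingale_const_fun 𝓖 P ?_ ((hZ i hi).integrable 0)
      exact ((hZ i hi).1 0).mono (𝓕.mono (hτ0 _))
    exact h1.sub h2
  have habs : ∀ i ∈ s, Submartingale (fun k ω => c i * |M i k ω|) 𝓖 P := by
    intro i hi
    have h1 : Submartingale (M i ⊔ -(M i)) 𝓖 P :=
      (hM i hi).submartingale.sup (hM i hi).neg.submartingale
    have h2 := h1.smul_nonneg (hc i)
    exact h2
  have hsub : Submartingale (fun k ω => ∑ i ∈ s, c i * |M i k ω|) 𝓖 P := by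
    clear hM
    induction s using Finset.induction_on with
    | empty => simpa using (martingale_const 𝓖 P (0:ℝ)).submartingale
    | insert i s hi ih =>
      simp only [Finset.sum_insert hi]
      exact (habs i (Finset.mem_insert_self _ _)).add
        (ih (fun j hj => hZ j (Finset.mem_insert_of_mem hj))
          fun j hj => habs j (Finset.mem_insert_of_mem hj))
  have hnn : 0 ≤ (fun k ω => ∑ i ∈ s, c i * |M i k ω|) := fun k ω =>
    Finset.sum_nonneg fun i _ => mul_nonneg (hc i) (abs_nonneg _)
  have h3 := maximal_ineq hsub hnn (ε := a.toNNReal) (2 ^ n)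
  rw [Real.coe_toNNReal a ha.le] at h3
  refine le_trans ?_ (h3.trans ?_)
  · refine mul_le_mul' le_rfl (measure_mono ?_)
    rintro ω ⟨k, hk, hk2⟩
    refine le_trans hk2 ?_
    exact Finset.le_sup' (fun k => ∑ i ∈ s, c i * |M i k ω|) (Finset.mem_range.2 (by omega))
  · apply ENNReal.ofReal_le_ofReal
    have e : ∀ ω, ∑ i ∈ s, c i * |M i (2 ^ n) ω| = ∑ i ∈ s, c i * |Z i T ω - Z i 0 ω| := by
      intro ω; simp only [M, hτT]
    simp only [e]
    refine setIntegral_le_integral ?_ (Eventually.of_forall fun ω => ?_)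
    · have := hsub.integrable (2 ^ n); simp only [e] at this; exact this
    · exact Finset.sum_nonneg fun i _ => mul_nonneg (hc i) (abs_nonneg _)
theorem max_dyadic {Ω : Type*} [m : MeasurableSpace Ω] {P : Measure Ω} [IsProbabilityMeasure P]
    {𝓕 : Filtration ℝ m} {ι : Type*} (s : Finset ι) (c : ι → ℝ) (hc : ∀ i, 0 ≤ c i)
    (Z : ι → ℝ → Ω → ℝ) (hZ : ∀ i ∈ s, Martingale (Z i) 𝓕 P) {T : ℝ} (hT : 0 ≤ T) {a : ℝ} (ha : 0 < a) :
    P {ω | ∃ n k : ℕ, k ≤ 2 ^ n ∧ a ≤ ∑ i ∈ s, c i * |Z i (k * T / 2 ^ n) ω - Z i 0 ω|}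
      ≤ ENNReal.ofReal ((∫ ω, ∑ i ∈ s, c i * |Z i T ω - Z i 0 ω| ∂P) / a) := by
  let A : ℕ → Set Ω := fun n =>
    {ω | ∃ k : ℕ, k ≤ 2 ^ n ∧ a ≤ ∑ i ∈ s, c i * |Z i (k * T / 2 ^ n) ω - Z i 0 ω|}
  have hA : Monotone A := by
    refine monotone_nat_of_le_succ fun n ω => ?_
    rintro ⟨k, hk, h⟩
    refine ⟨2 * k, by rw [pow_succ]; omega, ?_⟩
    have e : ((2 * k : ℕ) : ℝ) * T / 2 ^ (n + 1) = k * T / 2 ^ n := by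
      push_cast; rw [pow_succ]; field_simp
    rw [e]; exact h
  have e : {ω | ∃ n k : ℕ, k ≤ 2 ^ n ∧ a ≤ ∑ i ∈ s, c i * |Z i (k * T / 2 ^ n) ω - Z i 0 ω|}
      = ⋃ n, A n := by
    ext ω; simp [A]
  rw [e, hA.measure_iUnion]
  refine iSup_le fun n => ?_
  have h := max_grid s c hc Z hZ hT ha n
  rw [ENNReal.ofReal_div_of_pos ha, ENNReal.le_div_iff_mul_le (by simp [ha]) (by simp), mul_comm]
  exact h
section
variable {B : Vd d → Measure (Vd d)} (hd : 2 ≤ d) (hB : IsCollisionKernel B)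
variable {Ω : Type*} [m : MeasurableSpace Ω] {N : ℕ} {P : Measure Ω}
  {𝓕 : Filtration ℝ m} {μp : ℝ → Ω → Measure (Vd d)}
include hd hB
theorem kac_mart (h : IsKacProcess B N P 𝓕 μp) {g : Vd d → ℝ} (hg : Measurable g) {K : ℝ}
    (h0 : ∀ v, 0 ≤ g v) (hK : ∀ v, g v ≤ K) :
    Martingale (fun t ω => (∫ v, g v ∂(μp t ω)) -
      ∫ s in Ioc (0:ℝ) t, QInt B g (μp s ω) (μp s ω)) 𝓕 P := by
  have hK0 : 0 ≤ K := (h0 0).trans (hK 0)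
  have h1 := h.martingale (GG g K) (GG_meas hg K) ⟨4 * K, fun ν => GG_bd hK0 ν⟩
  simp only [GG_emp (h.mem _ _) h0 hK, gen_GG hd hB (h.mem _ _) hg h0 hK] at h1
  exact h1
theorem kac_var [IsProbabilityMeasure P] (h : IsKacProcess B N P 𝓕 μp) {g : Vd d → ℝ}
    (hg : Measurable g) {K : ℝ}
    (h0 : ∀ v, 0 ≤ g v) (hK : ∀ v, g v ≤ K) {T : ℝ} (hT : 0 ≤ T) :
    ∫ ω, ((∫ v, g v ∂(μp T ω)) - (∫ v, g v ∂(μp 0 ω)) -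
      ∫ s in Ioc (0:ℝ) T, QInt B g (μp s ω) (μp s ω)) ^ 2 ∂P
    = ∫ ω, (∫ s in Ioc (0:ℝ) T, (N:ℝ)⁻¹ * ∫ v, ∫ vs, kq B g v vs ∂(μp s ω) ∂(μp s ω)) ∂P := by
  have hK0 : 0 ≤ K := (h0 0).trans (hK 0)
  have h1 := h.martingale (fun ν => GG g K ν ^ 2) ((GG_meas hg K).pow_const 2)
    ⟨(4 * K) ^ 2, fun ν => by
      rw [abs_pow]; exact pow_le_pow_left₀ (abs_nonneg _) (GG_bd hK0 ν) 2⟩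
  simp only [GG_emp (h.mem _ _) h0 hK, gen_GG2 hd hB (h.mem _ _) hg h0 hK] at h1
  have hp : ∀ q : ℝ × Ω, IsProbabilityMeasure (μp q.1 q.2) := fun q => emp_prob (h.mem _ _)
  have hgK : ∀ v, |g v| ≤ K := fun v => by rw [abs_of_nonneg (h0 v)]; exact hK v
  obtain ⟨ω₀⟩ : Nonempty Ω := nonempty_of_isProbabilityMeasure P
  have hN1 : (1:ℝ) ≤ N := by exact_mod_cast Nat.one_le_iff_ne_zero.2 (emp_N_ne (h.mem 0 ω₀))
  have hkq : ∀ v vs : Vd d, ‖v‖ ^ 2 + ‖vs‖ ^ 2 ≤ (N:ℝ) → |kq B g v vs| ≤ 32 * K ^ 2 * N := by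
    intro v vs hv
    have h3 : |kq B g v vs| ≤ (4 * K) ^ 2 * ‖v - vs‖ := B_int_le hd hB _ fun σ hσ => by
      rw [abs_pow]
      exact pow_le_pow_left₀ (abs_nonneg _) (dlt_ball (R := N) (fun v _ => hgK v) hv hσ) 2
    refine h3.trans ?_
    have h1 : ‖v - vs‖ ≤ 2 * N := by
      have := norm_sub_le v vs
      have h1 : ‖v‖ ≤ N := by
        by_contra hc; push Not at hc; nlinarith [sq_nonneg ‖vs‖]
      have h2 : ‖vs‖ ≤ N := by
        by_contra hc; push Not at hc; nlinarith [sq_nonneg ‖v‖]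
      linarith
    nlinarith [sq_nonneg K]
  have hkq0 : ∀ v : Vd d, kq B g v v = 0 := fun v => by
    unfold kq; rw [sub_self, B_zero hd hB]; simp
  have hb : ∀ t ω, |(N:ℝ)⁻¹ * ∫ v, ∫ vs, kq B g v vs ∂(μp t ω) ∂(μp t ω)| ≤ 32 * K ^ 2 * N := by
    intro t ω
    have := hp (t, ω)
    dsimp only at this
    have hC : 0 ≤ 32 * K ^ 2 * N := by positivity
    have e : ∫ _, ∫ _, 32 * K ^ 2 * N ∂(μp t ω) ∂(μp t ω) = 32 * K ^ 2 * N := by simp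
    have e' : ∫ _, ∫ _, -(32 * K ^ 2 * N) ∂(μp t ω) ∂(μp t ω) = -(32 * K ^ 2 * N) := by simp
    have h5 : |∫ v, ∫ vs, kq B g v vs ∂(μp t ω) ∂(μp t ω)| ≤ 32 * K ^ 2 * N := by
      rw [abs_le]
      constructor
      · rw [← e']
        exact emp_double_le (h.mem t ω) (fun v vs hv => (abs_le.1 (hkq v vs hv)).1)
          fun v hv => by rw [hkq0]; linarith
      · conv_rhs => rw [← e]
        exact emp_double_le (h.mem t ω) (fun v vs hv => (abs_le.1 (hkq v vs hv)).2)
          fun v hv => by rw [hkq0]; linarith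
    rw [abs_mul]
    have hi : |(N:ℝ)⁻¹| ≤ 1 := by
      rw [abs_of_nonneg (by positivity)]; exact inv_le_one_of_one_le₀ hN1
    calc _ ≤ 1 * (32 * K ^ 2 * N) := mul_le_mul hi h5 (abs_nonneg _) (by norm_num)
      _ = _ := one_mul _
  refine mart_L2 (𝓕 := 𝓕) (X := fun t ω => ∫ v, g v ∂(μp t ω))
    (b := fun t ω => QInt B g (μp t ω) (μp t ω))
    (a := fun t ω => (N:ℝ)⁻¹ * ∫ v, ∫ vs, kq B g v vs ∂(μp t ω) ∂(μp t ω))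
    (K := max K (max (8 * K * N) (32 * K ^ 2 * N)))
    (int_meas (proc_joint h) hp hg) (QInt_meas hd hB (proc_joint h) hp hg)
    ((double_meas (proc_joint h) hp (kq_meas hd hB hg)).const_mul _) ?_ ?_ ?_ ?_ ?_
    (kac_mart hd hB h hg h0 hK) h1 hT
  · intro t
    exact @int_meas d Ω (𝓕 t) (μp t) (proc_adapt h t) g (fun ω => hp (t, ω)) hg
  · intro t
    exact @QInt_meas d B hd hB Ω (𝓕 t) (μp t) (proc_adapt h t) (fun ω => hp (t, ω)) g hg
  · intro t ω
    exact (emp_abs_le (h.mem t ω) fun v _ => hgK v).trans (le_max_left _ _)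
  · intro t ω
    exact (QInt_abs hd hB (h.mem t ω) fun v _ => hgK v).trans
      ((le_max_left _ _).trans (le_max_right _ _))
  · intro t ω
    exact (hb t ω).trans ((le_max_right _ _).trans (le_max_right _ _))
end
theorem rpow_add_le {p x y : ℝ} (hp : 1 ≤ p) (hx : 0 ≤ x) (hy : 0 ≤ y) :
    (x + y) ^ p ≤ x ^ p + p * y * (x + y) ^ (p - 1) := by
  rcases eq_or_lt_of_le (add_nonneg hx hy) with h0 | h0
  · have hx0 : x = 0 := by linarith
    have hy0 : y = 0 := by linarith
    subst hx0 hy0; simp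
  · have h1 := one_add_mul_self_le_rpow_one_add (s := -(y / (x + y))) (by
      rw [neg_le_neg_iff, div_le_one h0]; linarith) hp
    have e : 1 + -(y / (x + y)) = x / (x + y) := by field_simp; ring
    rw [e, Real.div_rpow hx h0.le, le_div_iff₀ (by positivity)] at h1
    have e2 : (x + y) ^ p = (x + y) * (x + y) ^ (p - 1) := by
      rw [← Real.rpow_one_add' h0.le (by linarith)]; congr 1; ring
    have e3 : (1 + p * -(y / (x + y))) * (x + y) ^ p = (x + y) ^ p - p * y * (x + y) ^ (p - 1) := by
      rw [e2]; field_simp; ring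
    rw [e3] at h1
    linarith
theorem gain_pt {p a b x y : ℝ} (hp : 1 ≤ p) (hb : 0 ≤ b) (hab : b ≤ a) (hx : 0 ≤ x) (hx1 : x ≤ 1)
    (hy : 0 ≤ y) (h : y ≤ a * x + 2 * b) :
    y ^ p ≤ a ^ p * x ^ p + 2 * p * 3 ^ (p - 1) * (a ^ (p - 1) * b) := by
  have ha : 0 ≤ a := hb.trans hab
  have h1 : y ^ p ≤ (a * x + 2 * b) ^ p := Real.rpow_le_rpow hy h (by linarith)
  have h2 := rpow_add_le hp (mul_nonneg ha hx) (by linarith : 0 ≤ 2 * b)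
  have h3 : (a * x + 2 * b) ^ (p - 1) ≤ (3 * a) ^ (p - 1) := by
    apply Real.rpow_le_rpow (by positivity) _ (by linarith)
    nlinarith
  rw [Real.mul_rpow (by norm_num) ha] at h3
  rw [Real.mul_rpow ha hx] at h2
  have h4 : p * (2 * b) * (a * x + 2 * b) ^ (p - 1) ≤ p * (2 * b) * (3 ^ (p - 1) * a ^ (p - 1)) := by
    gcongr
  nlinarith
theorem post_repr {v vs u σ : Vd d} (hu : v - vs = ‖v - vs‖ • u) :
    postV v vs σ = vs + (‖v - vs‖ / 2) • (u + σ) ∧ postVs v vs σ = vs + (‖v - vs‖ / 2) • (u - σ) := by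
  have e : v = vs + ‖v - vs‖ • u := by rw [← hu]; abel
  set r := ‖v - vs‖
  constructor
  · unfold postV
    change (2:ℝ)⁻¹ • (v + vs) + ((2:ℝ)⁻¹ * r) • σ = _
    rw [e]; module
  · unfold postVs
    change (2:ℝ)⁻¹ • (v + vs) - ((2:ℝ)⁻¹ * r) • σ = _
    rw [e]; module
section
variable {B : Vd d → Measure (Vd d)} (hd : 2 ≤ d) (hB : IsCollisionKernel B)
include hd hB
theorem povzner_const {p : ℝ} (hp : 2 < p) : ∃ c : ℝ, 0 < c ∧ c ≤ 1 ∧ ∀ u : Vd d, ‖u‖ = 1 →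
    ∫ σ, ((‖u + σ‖ / 2) ^ p + (‖u - σ‖ / 2) ^ p) ∂(B u) = 1 - c := by
  obtain ⟨u₀, hu₀⟩ := exists_unit hd
  let φ : Vd d → Vd d → ℝ := fun u σ => (‖u + σ‖ / 2) ^ p + (‖u - σ‖ / 2) ^ p
  have hφm : ∀ u, Measurable (φ u) := fun u => by
    simp only [φ]; fun_prop
  have hsymm : ∀ u : Vd d, ‖u‖ = 1 → ∫ σ, φ u σ ∂(B u) = ∫ σ, φ u₀ σ ∂(B u₀) := by
    intro u hu
    let R : Vd d ≃ₗᵢ[ℝ] Vd d := (ℝ ∙ (u₀ - u))ᗮ.reflection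
    have hR : R u₀ = u := Submodule.reflection_sub (by rw [hu, hu₀])
    have h1 := hB.symm R u₀ hu₀
    rw [hR] at h1
    rw [h1, integral_map R.continuous.measurable.aemeasurable (hφm u).aestronglyMeasurable]
    congr 1; ext σ
    simp only [φ]
    rw [← hR, ← map_add, ← map_sub, R.norm_map, R.norm_map]
  have hprob := hB.prob u₀ hu₀
  have hpar : ∀ σ : Vd d, ‖σ‖ = 1 → (‖u₀ + σ‖ / 2) ^ 2 + (‖u₀ - σ‖ / 2) ^ 2 = 1 := by
    intro σ hσ
    have := parallelogram_law_with_norm ℝ u₀ σ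
    rw [hσ, hu₀] at this
    nlinarith
  have hb : ∀ x : ℝ, 0 ≤ x → x ≤ 1 → x ^ p ≤ x ^ 2 := by
    intro x hx hx1
    rcases eq_or_lt_of_le hx with h | h
    · subst h; rw [Real.zero_rpow (by linarith)]; norm_num
    · rw [← Real.rpow_natCast]
      exact Real.rpow_le_rpow_of_exponent_ge h hx1 (by push_cast; linarith)
  have hb' : ∀ x : ℝ, 0 < x → x < 1 → x ^ p < x ^ 2 := by
    intro x hx hx1
    rw [← Real.rpow_natCast]
    exact Real.rpow_lt_rpow_of_exponent_gt hx hx1 (by push_cast; linarith)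
  have hle1 : ∀ σ : Vd d, ‖σ‖ = 1 → ‖u₀ + σ‖ / 2 ≤ 1 ∧ ‖u₀ - σ‖ / 2 ≤ 1 := by
    intro σ hσ
    have h1 := norm_add_le u₀ σ
    have h2 := norm_sub_le u₀ σ
    rw [hσ, hu₀] at h1 h2
    constructor <;> linarith
  have hφ1 : ∀ σ : Vd d, ‖σ‖ = 1 → |φ u₀ σ| ≤ 1 := by
    intro σ hσ
    have h0 : 0 ≤ φ u₀ σ := by simp only [φ]; positivity
    rw [abs_of_nonneg h0]
    simp only [φ]
    have h1 := hb _ (by positivity) (hle1 σ hσ).1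
    have h2 := hb _ (by positivity) (hle1 σ hσ).2
    linarith [hpar σ hσ]
  have hint : Integrable (φ u₀) (B u₀) := B_integrable hd hB u₀ (hφm u₀) hφ1
  have h0 : 0 ≤ ∫ σ, φ u₀ σ ∂(B u₀) := integral_nonneg fun σ => by simp only [φ]; positivity
  refine ⟨1 - ∫ σ, φ u₀ σ ∂(B u₀), ?_, by linarith, fun u hu => ?_⟩
  · have hae : ∀ᵐ σ ∂(B u₀), 0 < 1 - φ u₀ σ := by
      have hs := hB.support u₀ hu₀
      have : ∀ᵐ σ ∂(B u₀), σ ∈ unitSphere d \ {u₀, -u₀} := by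
        rw [ae_iff]; exact hs
      filter_upwards [this] with σ hσ
      obtain ⟨hσ1, hσ2⟩ := hσ
      have hσ1' : ‖σ‖ = 1 := hσ1
      simp only [Set.mem_insert_iff, Set.mem_singleton_iff, not_or] at hσ2
      have p1 : 0 < ‖u₀ + σ‖ / 2 := by
        have : u₀ + σ ≠ 0 := fun h => hσ2.2 (eq_neg_of_add_eq_zero_right h)
        positivity
      have p2 : 0 < ‖u₀ - σ‖ / 2 := by
        have : u₀ - σ ≠ 0 := fun h => hσ2.1 (sub_eq_zero.1 h).symm
        positivity
      have h := hpar σ hσ1'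
      have q1 : ‖u₀ + σ‖ / 2 < 1 := by nlinarith
      have q2 : ‖u₀ - σ‖ / 2 < 1 := by nlinarith
      have := hb' _ p1 q1
      have := hb' _ p2 q2
      simp only [φ]; linarith
    have hi : Integrable (fun σ => 1 - φ u₀ σ) (B u₀) := (integrable_const 1).sub' hint
    have e : ∫ σ, (1 - φ u₀ σ) ∂(B u₀) = 1 - ∫ σ, φ u₀ σ ∂(B u₀) := by
      rw [integral_sub (integrable_const 1) hint]; simp
    rw [← e]
    have hnn : 0 ≤ᵐ[B u₀] fun σ => 1 - φ u₀ σ := hae.mono fun σ h => h.le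
    refine lt_of_le_of_ne (integral_nonneg_of_ae hnn) fun hc => ?_
    have := (integral_eq_zero_iff_of_nonneg_ae hnn hi).1 hc.symm
    have hF : ∀ᵐ σ ∂(B u₀), False := by
      filter_upwards [this, hae] with σ h1 h2
      rw [h1] at h2; simp at h2
    have : B u₀ = 0 := by
      rw [← ae_eq_bot]; exact eventually_false_iff_eq_bot.1 hF
    exact IsProbabilityMeasure.ne_zero _ this
  · rw [hsymm u hu]; ring
theorem povzner_half {p c : ℝ} (hp : 2 < p) (hc : 0 < c) (hc1 : c ≤ 1)
    (hcB : ∀ u : Vd d, ‖u‖ = 1 → ∫ σ, ((‖u + σ‖ / 2) ^ p + (‖u - σ‖ / 2) ^ p) ∂(B u) = 1 - c)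
    {v vs : Vd d} (h : ‖vs‖ ≤ ‖v‖) :
    kf B (fun w => ‖w‖ ^ p) v vs ≤ -(c / 2) * (‖v‖ ^ (p + 1) + ‖vs‖ ^ (p + 1))
      + (1 + 8 * p * 3 ^ (p - 1)) * (‖v‖ ^ p * ‖vs‖ + ‖v‖ * ‖vs‖ ^ p) := by
  obtain ⟨u, hu, hvu, hBu⟩ := B_polar hd hB (v - vs)
  set a := ‖v‖ with ha
  set b := ‖vs‖ with hb
  have ha0 : 0 ≤ a := norm_nonneg _
  have hb0 : 0 ≤ b := norm_nonneg _
  set D := 2 * p * (3:ℝ) ^ (p - 1) with hD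
  have hD0 : 0 ≤ D := by positivity
  have hr : ‖v - vs‖ ≤ a + b := norm_sub_le _ _
  have hr2 : a - b ≤ ‖v - vs‖ := norm_sub_norm_le _ _
  have hprob := hB.prob u hu
  have hpt : ∀ σ : Vd d, ‖σ‖ = 1 → dlt (fun w => ‖w‖ ^ p) v vs σ ≤
      a ^ p * ((‖u + σ‖ / 2) ^ p + (‖u - σ‖ / 2) ^ p) + (2 * D * (a ^ (p - 1) * b) - a ^ p) := by
    intro σ hσ
    obtain ⟨e1, e2⟩ := post_repr (σ := σ) hvu
    have n1 := norm_add_le u σ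
    have n2 := norm_sub_le u σ
    rw [hσ, hu] at n1 n2
    have key : ∀ z : Vd d, ‖z‖ ≤ 2 → ‖vs + (‖v - vs‖ / 2) • z‖ ≤ a * (‖z‖ / 2) + 2 * b := by
      intro z hz
      refine (norm_add_le _ _).trans ?_
      rw [norm_smul, norm_eq_abs, abs_of_nonneg (by positivity)]
      have : ‖v - vs‖ / 2 * ‖z‖ ≤ (a + b) / 2 * ‖z‖ := by gcongr
      nlinarith
    have h1 := gain_pt (p := p) (by linarith) hb0 h (by positivity) (by linarith)
      (norm_nonneg _) (key (u + σ) (by linarith))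
    have h2 := gain_pt (p := p) (by linarith) hb0 h (by positivity) (by linarith)
      (norm_nonneg _) (key (u - σ) (by linarith))
    rw [← e1] at h1
    rw [← e2] at h2
    have h3 : 0 ≤ b ^ p := by positivity
    simp only [dlt]
    rw [← ha, ← hb]
    linarith
  have hmeas : Measurable fun w : Vd d => ‖w‖ ^ p := by fun_prop
  have hlb : ∀ σ : Vd d, ‖σ‖ = 1 → |dlt (fun w => ‖w‖ ^ p) v vs σ| ≤ 4 * (a ^ 2 + b ^ 2) ^ (p / 2) := by
    intro σ hσ
    refine dlt_ball (R := a ^ 2 + b ^ 2) (fun w hw => ?_) le_rfl hσ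
    rw [abs_of_nonneg (by positivity)]
    calc ‖w‖ ^ p = (‖w‖ ^ 2) ^ (p / 2) := by
          rw [← Real.rpow_natCast, ← Real.rpow_mul (norm_nonneg _)]; congr 1; push_cast; ring
      _ ≤ _ := Real.rpow_le_rpow (by positivity) hw (by linarith)
  have hi1 := B_integrable hd hB u (dlt_meas' hmeas v vs) hlb
  have hφi : Integrable (fun σ => (‖u + σ‖ / 2) ^ p + (‖u - σ‖ / 2) ^ p) (B u) := by
    refine B_integrable hd hB u (by fun_prop) (K := 2) fun σ hσ => ?_
    rw [abs_of_nonneg (by positivity)]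
    have n1 := norm_add_le u σ
    have n2 := norm_sub_le u σ
    rw [hσ, hu] at n1 n2
    have := Real.rpow_le_one (x := ‖u + σ‖ / 2) (z := p) (by positivity) (by linarith) (by linarith)
    have := Real.rpow_le_one (x := ‖u - σ‖ / 2) (z := p) (by positivity) (by linarith) (by linarith)
    linarith
  have hI : ∫ σ, dlt (fun w => ‖w‖ ^ p) v vs σ ∂(B u) ≤ -c * a ^ p + 2 * D * (a ^ (p - 1) * b) := by
    have hs : ∀ᵐ σ ∂(B u), ‖σ‖ = 1 := B_sphere hd hB u
    calc _ ≤ ∫ σ, (a ^ p * ((‖u + σ‖ / 2) ^ p + (‖u - σ‖ / 2) ^ p)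
            + (2 * D * (a ^ (p - 1) * b) - a ^ p)) ∂(B u) := by
          refine integral_mono_ae hi1 ((hφi.const_mul _).fun_add (integrable_const _)) ?_
          filter_upwards [hs] with σ hσ using hpt σ hσ
      _ = _ := by
          rw [integral_add (hφi.const_mul _) (integrable_const _), integral_const_mul, hcB u hu]
          simp; ring
  have e : kf B (fun w => ‖w‖ ^ p) v vs = ‖v - vs‖ * ∫ σ, dlt (fun w => ‖w‖ ^ p) v vs σ ∂(B u) := by
    unfold kf
    rw [hBu, integral_smul_measure, ENNReal.toReal_ofReal (norm_nonneg _), smul_eq_mul]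
  rw [e]
  have hap : a ^ (p + 1) = a ^ p * a := by
    rw [Real.rpow_add_one' ha0 (by linarith)]
  have hap' : a ^ p = a ^ (p - 1) * a := by
    rw [← Real.rpow_add_one' ha0 (by linarith)]; congr 1; ring
  have hbp : b ^ (p + 1) ≤ a ^ p * b := by
    rw [Real.rpow_add_one' hb0 (by linarith)]
    gcongr
  have hbp' : b ^ (p + 1) ≤ a ^ (p + 1) := Real.rpow_le_rpow hb0 h (by linarith)
  set A := a ^ (p - 1) with hA
  have hA0 : 0 ≤ A := by positivity
  have hbp0 : 0 ≤ a * b ^ p := by positivity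
  have h1 : ‖v - vs‖ * ∫ σ, dlt (fun w => ‖w‖ ^ p) v vs σ ∂(B u)
      ≤ ‖v - vs‖ * (-c * a ^ p + 2 * D * (A * b)) := by gcongr
  have h2 : ‖v - vs‖ * (-c * a ^ p) ≤ (a - b) * (-c * a ^ p) := by
    apply mul_le_mul_of_nonpos_right hr2
    have : 0 ≤ c * a ^ p := by positivity
    linarith
  have h3 : ‖v - vs‖ * (2 * D * (A * b)) ≤ 2 * a * (2 * D * (A * b)) := by
    gcongr; linarith
  have h4 : 0 ≤ a ^ p * b := by positivity
  have h5 : c * (a ^ p * b) ≤ a ^ p * b := by nlinarith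
  have h6 : 0 ≤ D * (a * b ^ p) := by positivity
  have e3 : 2 * a * (2 * D * (A * b)) = 4 * D * (a ^ p * b) := by rw [hap']; ring
  have e4 : (1 + 8 * p * 3 ^ (p - 1)) = 1 + 4 * D := by rw [hD]; ring
  rw [e3] at h3
  rw [e4]
  nlinarith
theorem povzner {p c : ℝ} (hp : 2 < p) (hc : 0 < c) (hc1 : c ≤ 1)
    (hcB : ∀ u : Vd d, ‖u‖ = 1 → ∫ σ, ((‖u + σ‖ / 2) ^ p + (‖u - σ‖ / 2) ^ p) ∂(B u) = 1 - c)
    (v vs : Vd d) :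
    kf B (fun w => ‖w‖ ^ p) v vs ≤ -(c / 2) * (‖v‖ ^ (p + 1) + ‖vs‖ ^ (p + 1))
      + (1 + 8 * p * 3 ^ (p - 1)) * (‖v‖ ^ p * ‖vs‖ + ‖v‖ * ‖vs‖ ^ p) := by
  rcases le_total ‖vs‖ ‖v‖ with h | h
  · exact povzner_half hd hB hp hc hc1 hcB h
  · have hmeas : Measurable fun w : Vd d => ‖w‖ ^ p := by fun_prop
    rw [kf_symm hd hB hmeas]
    refine (povzner_half hd hB hp hc hc1 hcB h).trans (le_of_eq ?_)
    ring
end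
theorem emp_dbl {N : ℕ} {μ : Measure (Vd d)} (h : μ ∈ empiricalSphere d N) (a b : ℝ)
    (f1 f2 g1 g2 : Vd d → ℝ) :
    ∫ v, ∫ vs, (a * (f1 v * f2 vs) + b * (g1 v * g2 vs)) ∂μ ∂μ
      = a * ((∫ v, f1 v ∂μ) * ∫ v, f2 v ∂μ) + b * ((∫ v, g1 v ∂μ) * ∫ v, g2 v ∂μ) := by
  have I := fun f : Vd d → ℝ => emp_integrable h f
  have e : ∀ v, ∫ vs, (a * (f1 v * f2 vs) + b * (g1 v * g2 vs)) ∂μ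
      = a * (f1 v * ∫ v, f2 v ∂μ) + b * (g1 v * ∫ v, g2 v ∂μ) := by
    intro v
    rw [integral_add (I _) (I _), integral_const_mul, integral_const_mul, integral_const_mul,
      integral_const_mul]
  simp_rw [e]
  rw [integral_add (I _) (I _), integral_const_mul, integral_const_mul, integral_mul_const,
      integral_mul_const]
theorem emp_m2 {N : ℕ} {μ : Measure (Vd d)} (h : μ ∈ empiricalSphere d N) :
    ∫ v, ‖v‖ ^ 2 ∂μ = 1 := h.1.2.2
theorem emp_m1 {N : ℕ} {μ : Measure (Vd d)} (h : μ ∈ empiricalSphere d N) :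
    ∫ v, ‖v‖ ∂μ ≤ 1 := by
  have := emp_prob h
  have h1 : ∫ v, ‖v‖ ∂μ ≤ ∫ v, (2⁻¹ * ‖v‖ ^ 2 + 2⁻¹) ∂μ :=
    emp_le h fun v _ => by nlinarith [sq_nonneg (‖v‖ - 1)]
  rw [integral_add (emp_integrable h _) (emp_integrable h _), integral_const_mul, emp_m2 h] at h1
  simp at h1
  linarith
theorem norm_rpow_ball {p R : ℝ} (hp : 0 ≤ p) {v : Vd d} (hv : ‖v‖ ^ 2 ≤ R) :
    ‖v‖ ^ p ≤ R ^ (p / 2) := by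
  calc ‖v‖ ^ p = (‖v‖ ^ 2) ^ (p / 2) := by
          rw [← Real.rpow_natCast, ← Real.rpow_mul (norm_nonneg _)]; congr 1; push_cast; ring
    _ ≤ _ := Real.rpow_le_rpow (by positivity) hv (by linarith)
theorem gronwall_int {h : ℝ → ℝ} {T C lam H : ℝ} (hT : 0 ≤ T) (hC : 0 < C) (hlam : 0 ≤ lam)
    (hm : Measurable h) (hH : ∀ t, |h t| ≤ H)
    (hi : ∀ t ∈ Icc 0 T, h t ≤ lam + C * ∫ s in Ioc 0 t, h s) :
    ∀ t ∈ Icc 0 T, h t ≤ 2 * lam * exp (2 * C * t) := by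
  have hH0 : 0 ≤ H := (abs_nonneg _).trans (hH 0)
  have key : ∀ n : ℕ, ∀ t ∈ Icc 0 T, h t ≤ (2 * lam + H / 2 ^ n) * exp (2 * C * t) := by
    intro n
    induction n with
    | zero =>
      intro t ht
      have h1 : 1 ≤ exp (2 * C * t) := one_le_exp (by have := ht.1; positivity)
      have h2 := (le_abs_self _).trans (hH t)
      simp only [pow_zero, div_one]
      nlinarith
    | succ n ih =>
      intro t ht
      set D := 2 * lam + H / 2 ^ n with hD
      have hD0 : 0 ≤ D := by positivity
      have h1 : ∫ s in Ioc 0 t, h s ≤ ∫ s in Ioc 0 t, D * exp (2 * C * s) := by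
        refine setIntegral_mono_on ?_ ?_ measurableSet_Ioc fun s hs => ih s ⟨hs.1.le, hs.2.trans ht.2⟩
        · exact Integrable.of_bound hm.aestronglyMeasurable H (Eventually.of_forall hH)
        · exact (Continuous.integrableOn_Icc (by fun_prop)).mono_set Set.Ioc_subset_Icc_self
      have h2 : ∫ s in Ioc 0 t, D * exp (2 * C * s) = D * ((exp (2 * C * t) - 1) / (2 * C)) := by
        rw [integral_const_mul, ← intervalIntegral.integral_of_le ht.1]
        congr 1
        rw [intervalIntegral.integral_comp_mul_left (fun x => exp x) (by positivity)]
        simp; field_simp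
      rw [h2] at h1
      have h3 := hi t ht
      have h4 : C * ∫ s in Ioc 0 t, h s ≤ D / 2 * (exp (2 * C * t) - 1) := by
        calc _ ≤ C * (D * ((exp (2 * C * t) - 1) / (2 * C))) := by gcongr
          _ = _ := by field_simp
      have h5 : 1 ≤ exp (2 * C * t) := one_le_exp (by have := ht.1; positivity)
      have e : 2 * lam + H / 2 ^ (n + 1) = lam + D / 2 := by rw [hD, pow_succ]; field_simp; ring
      rw [e]
      nlinarith
  intro t ht
  have hl : Tendsto (fun n : ℕ => (2 * lam + H / 2 ^ n) * exp (2 * C * t)) atTop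
      (nhds ((2 * lam + 0) * exp (2 * C * t))) := by
    refine Tendsto.mul_const _ (tendsto_const_nhds.add ?_)
    have := (tendsto_pow_atTop_nhds_zero_of_lt_one (r := (2:ℝ)⁻¹) (by norm_num) (by norm_num)).const_mul H
    simpa [div_eq_mul_inv] using this
  rw [add_zero] at hl
  exact ge_of_tendsto' hl fun n => key n t ht
section
variable {B : Vd d → Measure (Vd d)} (hd : 2 ≤ d) (hB : IsCollisionKernel B)
include hd hB
theorem QInt_moment {p c : ℝ} (hp : 2 < p) (hc : 0 < c) (hc1 : c ≤ 1)
    (hcB : ∀ u : Vd d, ‖u‖ = 1 → ∫ σ, ((‖u + σ‖ / 2) ^ p + (‖u - σ‖ / 2) ^ p) ∂(B u) = 1 - c)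
    {N : ℕ} {μ : Measure (Vd d)} (h : μ ∈ empiricalSphere d N) :
    QInt B (fun w => ‖w‖ ^ p) μ μ ≤ -c * (∫ v, ‖v‖ ^ (p + 1) ∂μ)
      + 2 * (1 + 8 * p * 3 ^ (p - 1)) * ∫ v, ‖v‖ ^ p ∂μ := by
  have := emp_prob h
  set C := (1 + 8 * p * (3:ℝ) ^ (p - 1)) with hC
  have hC1 : 1 ≤ C := by
    rw [hC]; have : 0 ≤ 8 * p * (3:ℝ) ^ (p - 1) := by positivity
    linarith
  have h1 : QInt B (fun w => ‖w‖ ^ p) μ μ ≤ ∫ v, ∫ vs,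
      ((-(c / 2) * (‖v‖ ^ (p + 1) * 1) + -(c/2) * (1 * ‖vs‖ ^ (p + 1)))
      + (C * (‖v‖ ^ p * ‖vs‖) + C * (‖v‖ * ‖vs‖ ^ p))) ∂μ ∂μ := by
    rw [QInt_eq]
    refine emp_double_le h (fun v vs _ => ?_) fun v _ => ?_
    · refine (povzner hd hB hp hc hc1 hcB v vs).trans (le_of_eq ?_); ring
    · rw [kf_self hd hB]
      have e1 : ‖v‖ ^ (p + 1) = ‖v‖ ^ p * ‖v‖ := Real.rpow_add_one' (norm_nonneg _) (by linarith)
      rw [e1]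
      have : 0 ≤ ‖v‖ ^ p * ‖v‖ := by positivity
      nlinarith
  have e : ∀ (F G : Vd d → Vd d → ℝ), ∫ v, ∫ vs, (F v vs + G v vs) ∂μ ∂μ =
      (∫ v, ∫ vs, F v vs ∂μ ∂μ) + ∫ v, ∫ vs, G v vs ∂μ ∂μ := by
    intro F G
    have : ∀ v, ∫ vs, (F v vs + G v vs) ∂μ = (∫ vs, F v vs ∂μ) + ∫ vs, G v vs ∂μ := fun v =>
      integral_add (emp_integrable h _) (emp_integrable h _)
    simp_rw [this]
    exact integral_add (emp_integrable h _) (emp_integrable h _)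
  rw [e, emp_dbl h (-(c/2)) (-(c/2)) (fun v => ‖v‖ ^ (p + 1)) (fun _ => 1) (fun _ => 1)
    (fun v => ‖v‖ ^ (p + 1)), emp_dbl h C C (fun v => ‖v‖ ^ p) (fun v => ‖v‖) (fun v => ‖v‖)
    (fun v => ‖v‖ ^ p)] at h1
  simp only [integral_const, probReal_univ, smul_eq_mul, mul_one, one_mul] at h1
  have h2 := emp_m1 h
  have h3 : 0 ≤ ∫ v, ‖v‖ ^ p ∂μ := integral_nonneg fun v => by positivity
  have h4 : (∫ v, ‖v‖ ^ p ∂μ) * (∫ v, ‖v‖ ∂μ) ≤ ∫ v, ‖v‖ ^ p ∂μ := by nlinarith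
  nlinarith
end
theorem momentL_real {N : ℕ} {μ : Measure (Vd d)} (h : μ ∈ empiricalSphere d N) {p lam : ℝ}
    (hp : 0 ≤ p) (hl : 0 ≤ lam) (hm : momentL p μ ≤ ENNReal.ofReal lam) : ∫ v, ‖v‖ ^ p ∂μ ≤ lam := by
  have e : momentL p μ = ∫⁻ v, ENNReal.ofReal (‖v‖ ^ p) ∂μ := by
    unfold momentL
    congr 1; ext v
    rw [← ENNReal.ofReal_rpow_of_nonneg (norm_nonneg _) hp, ofReal_norm]
    rfl
  rw [e, emp_lint h (fun v => by positivity)] at hm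
  exact (ENNReal.ofReal_le_ofReal_iff hl).1 hm
section
variable {B : Vd d → Measure (Vd d)} (hd : 2 ≤ d) (hB : IsCollisionKernel B)
include hd hB
theorem moments {p : ℝ} (hp : 2 < p) {lam T : ℝ} (hlam : 0 ≤ lam) (hT : 0 ≤ T) :
    ∃ C : ℝ, 0 ≤ C ∧ ∀ (Ω : Type) (m : MeasurableSpace Ω) (P : Measure Ω),
      IsProbabilityMeasure P → ∀ (𝓕 : Filtration ℝ m) (N : ℕ) (μp : ℝ → Ω → Measure (Vd d)),
      IsKacProcess B N P 𝓕 μp → (∀ ω, momentL p (μp 0 ω) ≤ ENNReal.ofReal lam) →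
      (∀ t ∈ Icc 0 T, ∫ ω, (∫ v, ‖v‖ ^ p ∂(μp t ω)) ∂P ≤ C) ∧
      ∫ ω, (∫ s in Ioc 0 T, ∫ v, ‖v‖ ^ (p + 1) ∂(μp s ω)) ∂P ≤ C := by
  obtain ⟨c, hc, hc1, hcB⟩ := povzner_const hd hB hp
  set D := 2 * (1 + 8 * p * (3:ℝ) ^ (p - 1)) with hD
  have hD0 : 0 < D := by rw [hD]; have : 0 ≤ 8 * p * (3:ℝ) ^ (p - 1) := by positivity
                         linarith
  set C1 := 2 * lam * exp (2 * D * T) with hC1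
  have hC10 : 0 ≤ C1 := by positivity
  refine ⟨max C1 ((lam + D * (C1 * T)) / c), le_max_of_le_left hC10, ?_⟩
  intro Ω m P hP 𝓕 N μp h h0
  let g : Vd d → ℝ := fun v => min (‖v‖ ^ p) ((N:ℝ) ^ (p / 2))
  have hgm : Measurable g := by simp only [g]; fun_prop
  have hg0 : ∀ v, 0 ≤ g v := fun v => le_min (by positivity) (by positivity)
  have hgK : ∀ v, g v ≤ (N:ℝ) ^ (p / 2) := fun v => min_le_right _ _
  have hgp : ∀ v : Vd d, ‖v‖ ^ 2 ≤ (N:ℝ) → g v = ‖v‖ ^ p := fun v hv =>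
    min_eq_left (norm_rpow_ball (by linarith) hv)
  have hmart := kac_mart hd hB h hgm hg0 hgK
  simp only [fun t ω => emp_congr (h.mem t ω) hgp, fun t ω => QInt_congr hd hB (h.mem t ω) hgp] at hmart
  have hpr : ∀ q : ℝ × Ω, IsProbabilityMeasure (μp q.1 q.2) := fun q => emp_prob (h.mem _ _)
  have hmm : ∀ q : ℝ, Measurable fun v : Vd d => ‖v‖ ^ q := fun q => by fun_prop
  have hmb : ∀ q : ℝ, 0 ≤ q → ∀ t ω, |∫ v, ‖v‖ ^ q ∂(μp t ω)| ≤ (N:ℝ) ^ (q / 2) := fun q hq t ω =>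
    emp_abs_le (h.mem t ω) fun v hv => by
      rw [abs_of_nonneg (by positivity)]; exact norm_rpow_ball hq hv
  have hmj : ∀ q : ℝ, Measurable fun x : ℝ × Ω => ∫ v, ‖v‖ ^ q ∂(μp x.1 x.2) := fun q =>
    int_meas (proc_joint h) hpr (hmm q)
  have hQj : Measurable fun x : ℝ × Ω => QInt B (fun w => ‖w‖ ^ p) (μp x.1 x.2) (μp x.1 x.2) :=
    QInt_meas hd hB (proc_joint h) hpr (hmm p)
  have hQb : ∀ t ω, |QInt B (fun w => ‖w‖ ^ p) (μp t ω) (μp t ω)| ≤ 8 * (N:ℝ) ^ (p / 2) * N :=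
    fun t ω => QInt_abs hd hB (h.mem t ω) fun v hv => by
      rw [abs_of_nonneg (by positivity)]; exact norm_rpow_ball (by linarith) hv
  have bi : ∀ (t : ℝ) (φ : ℝ × Ω → ℝ) (C : ℝ), Measurable φ → (∀ q, |φ q| ≤ C) →
      Integrable φ ((volume.restrict (Ioc 0 t)).prod P) := fun t φ C h1 h2 =>
    Integrable.of_bound h1.aestronglyMeasurable C (Eventually.of_forall h2)
  have bs : ∀ (t : ℝ) (ω : Ω) (φ : ℝ × Ω → ℝ) (C : ℝ), Measurable φ → (∀ q, |φ q| ≤ C) →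
      Integrable (fun s => φ (s, ω)) (volume.restrict (Ioc 0 t)) := fun t ω φ C h1 h2 =>
    Integrable.of_bound (h1.comp measurable_prodMk_right).aestronglyMeasurable C
      (Eventually.of_forall fun s => h2 _)
  let H : ℝ → ℝ := fun t => ∫ ω, (∫ v, ‖v‖ ^ p ∂(μp t ω)) ∂P
  let J : ℝ → ℝ := fun t => ∫ ω, (∫ s in Ioc 0 t, ∫ v, ‖v‖ ^ (p + 1) ∂(μp s ω)) ∂P
  have hHm : Measurable H :=
    ((hmj p).stronglyMeasurable.integral_prod_right (f := fun t ω => ∫ v, ‖v‖ ^ p ∂(μp t ω))).measurable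
  have hHb : ∀ t, |H t| ≤ (N:ℝ) ^ (p / 2) := by
    intro t
    have := norm_integral_le_of_norm_le_const (μ := P) (f := fun ω => ∫ v, ‖v‖ ^ p ∂(μp t ω))
      (Eventually.of_forall fun ω => hmb p (by linarith) t ω)
    simpa using this
  have hJ0 : ∀ t, 0 ≤ J t := fun t => integral_nonneg fun ω => integral_nonneg fun s =>
    integral_nonneg fun v => by positivity
  have main : ∀ t ∈ Icc 0 T, H t + c * J t ≤ lam + D * ∫ s in Ioc 0 t, H s := by
    intro t ht
    have h1 := mart_pull hmart ht.1 (b := fun _ => 1) measurable_const (K := 1) (by simp)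
    simp only [one_mul, Set.Ioc_self, Measure.restrict_empty, integral_zero_measure, sub_zero] at h1
    have i1 : Integrable (fun ω => ∫ v, ‖v‖ ^ p ∂(μp t ω)) P :=
      Integrable.of_bound ((hmj p).comp measurable_prodMk_left).aestronglyMeasurable _
        (Eventually.of_forall fun ω => hmb p (by linarith) t ω)
    have iQ := bi t _ _ hQj fun q => hQb _ _
    have im := bi t _ _ (hmj p) fun q => hmb p (by linarith) _ _
    have im1 := bi t _ _ (hmj (p + 1)) fun q => hmb (p + 1) (by linarith) _ _
    have i2 : Integrable (fun ω => ∫ s in Ioc 0 t, QInt B (fun w => ‖w‖ ^ p) (μp s ω) (μp s ω)) P :=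
      iQ.swap.integral_prod_left
    rw [integral_sub i1 i2] at h1
    have h2 : ∫ ω, (∫ v, ‖v‖ ^ p ∂(μp 0 ω)) ∂P ≤ lam := by
      calc _ ≤ ∫ ω, lam ∂P := by
            refine integral_mono (Integrable.of_bound
              ((hmj p).comp measurable_prodMk_left).aestronglyMeasurable _
              (Eventually.of_forall fun ω => hmb p (by linarith) 0 ω)) (integrable_const _) fun ω => ?_
            exact momentL_real (h.mem 0 ω) (by linarith) hlam (h0 ω)
        _ = lam := by simp
    have h3 : ∫ ω, (∫ s in Ioc 0 t, QInt B (fun w => ‖w‖ ^ p) (μp s ω) (μp s ω)) ∂P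
        ≤ ∫ ω, (-c * (∫ s in Ioc 0 t, ∫ v, ‖v‖ ^ (p + 1) ∂(μp s ω))
          + D * ∫ s in Ioc 0 t, ∫ v, ‖v‖ ^ p ∂(μp s ω)) ∂P := by
      refine integral_mono i2 ((im1.swap.integral_prod_left.const_mul _).fun_add
        (im.swap.integral_prod_left.const_mul _)) fun ω => ?_
      dsimp only
      rw [← integral_const_mul, ← integral_const_mul, ← integral_add]
      · refine integral_mono (bs t ω _ _ hQj fun q => hQb _ _) ?_ fun s => ?_
        · exact ((bs t ω _ _ (hmj (p + 1)) fun q => hmb (p + 1) (by linarith) _ _).const_mul _).fun_add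
            ((bs t ω _ _ (hmj p) fun q => hmb p (by linarith) _ _).const_mul _)
        · exact QInt_moment hd hB hp hc hc1 hcB (h.mem s ω)
      · exact (bs t ω _ _ (hmj (p + 1)) fun q => hmb (p + 1) (by linarith) _ _).const_mul _
      · exact (bs t ω _ _ (hmj p) fun q => hmb p (by linarith) _ _).const_mul _
    have h4 : ∫ ω, (∫ s in Ioc 0 t, ∫ v, ‖v‖ ^ p ∂(μp s ω)) ∂P = ∫ s in Ioc 0 t, H s :=
      integral_integral_swap im.swap
    have j1 : Integrable (fun ω => ∫ s in Ioc 0 t, ∫ v, ‖v‖ ^ (p + 1) ∂(μp s ω)) P :=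
      im1.swap.integral_prod_left
    have j2 : Integrable (fun ω => ∫ s in Ioc 0 t, ∫ v, ‖v‖ ^ p ∂(μp s ω)) P :=
      im.swap.integral_prod_left
    rw [integral_add (j1.const_mul _) (j2.const_mul _), integral_const_mul, integral_const_mul, h4] at h3
    change H t + c * J t ≤ _
    change H t - _ = _ at h1
    change _ ≤ -c * J t + _ at h3
    linarith
  have hg := gronwall_int hT hD0 hlam hHm hHb fun t ht => by
    have := main t ht
    have := mul_nonneg hc.le (hJ0 t)
    linarith
  have hH1 : ∀ t ∈ Icc 0 T, H t ≤ C1 := fun t ht => (hg t ht).trans (by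
    rw [hC1]; have := ht.2; gcongr)
  refine ⟨fun t ht => (hH1 t ht).trans (le_max_left _ _), ?_⟩
  change J T ≤ _
  refine le_max_of_le_right ?_
  rw [le_div_iff₀ hc]
  have h5 := main T ⟨hT, le_rfl⟩
  have h6 : 0 ≤ H T := integral_nonneg fun ω => integral_nonneg fun v => by positivity
  have h7 : ∫ s in Ioc 0 T, H s ≤ ∫ s in Ioc 0 T, C1 :=
    setIntegral_mono_on (Integrable.of_bound hHm.aestronglyMeasurable _ (Eventually.of_forall hHb))
      (integrable_const _) measurableSet_Ioc fun s hs => hH1 s ⟨hs.1.le, hs.2⟩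
  have h8 : ∫ s in Ioc 0 T, C1 = C1 * T := by simp [hT]; ring
  rw [h8] at h7
  nlinarith
end
def CA (n : ℕ) (f : Vd d → ℝ) : Prop :=
  (∀ v, |f v| ≤ 1 + ‖v‖ ^ n) ∧ ∀ v w, |f v - f w| ≤ ‖v - w‖ * (1 + ‖v‖ ^ n + ‖w‖ ^ n)
def Mt (B : Vd d → Measure (Vd d)) (μ : ℝ → Measure (Vd d)) (f : Vd d → ℝ) (t : ℝ) : ℝ :=
  ∫ v, f v ∂(μ t) - ∫ v, f v ∂(μ 0) - ∫ s in Ioc 0 t, QInt B f (μ s) (μ s)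
theorem proj_exists {R : ℝ} (hR : 0 < R) : ∃ π : Vd d → Vd d, (∀ v, ‖π v‖ ≤ R) ∧ (∀ v, ‖π v‖ ≤ ‖v‖) ∧
    (∀ v w, ‖π v - π w‖ ≤ ‖v - w‖) ∧ (∀ v, ‖v‖ ≤ R → π v = v) := by
  classical
  have hin : ∀ v : Vd d, ‖v‖ ≤ R → ∀ w : Vd d, ¬ ‖w‖ ≤ R → ‖v - (R / ‖w‖) • w‖ ≤ ‖v - w‖ := by
    intro v hv w hw
    push Not at hw
    have hw0 : 0 < ‖w‖ := by linarith
    refine le_of_sq_le_sq ?_ (norm_nonneg _)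
    rw [@norm_sub_sq_real, @norm_sub_sq_real, norm_smul, inner_smul_right, norm_of_nonneg (by positivity),
      div_mul_cancel₀ _ hw0.ne']
    have h1 := real_inner_le_norm v w
    have h2 : inner ℝ v w / ‖w‖ ≤ ‖v‖ := by rw [div_le_iff₀ hw0]; exact h1
    have h3 : inner ℝ v w = ‖w‖ * (inner ℝ v w / ‖w‖) := by field_simp
    have h4 : R / ‖w‖ * inner ℝ v w = R * (inner ℝ v w / ‖w‖) := by ring
    rw [h4]
    set q := inner ℝ v w / ‖w‖
    rw [h3]
    nlinarith [mul_nonneg (sub_nonneg.2 hw.le) (by linarith : 0 ≤ ‖w‖ + R - 2 * q)]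
  refine ⟨fun v => if ‖v‖ ≤ R then v else (R / ‖v‖) • v, fun v => ?_, fun v => ?_, fun v w => ?_, fun v hv => by simp [hv]⟩
  · dsimp only
    split_ifs with h
    · exact h
    · push Not at h
      have hv : 0 < ‖v‖ := by linarith
      rw [norm_smul, norm_of_nonneg (by positivity), div_mul_cancel₀ _ hv.ne']
  · dsimp only
    split_ifs with h
    · exact le_rfl
    · push Not at h
      have hv : 0 < ‖v‖ := by linarith
      rw [norm_smul, norm_of_nonneg (by positivity), div_mul_cancel₀ _ hv.ne']
      exact h.le
  · dsimp only
    split_ifs with h1 h2 h2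
    · exact le_rfl
    · exact hin v h1 w h2
    · rw [norm_sub_rev, norm_sub_rev v]; exact hin w h2 v h1
    · push Not at h1 h2
      have hv : 0 < ‖v‖ := by linarith
      have hw : 0 < ‖w‖ := by linarith
      refine le_of_sq_le_sq ?_ (norm_nonneg _)
      rw [@norm_sub_sq_real, @norm_sub_sq_real, norm_smul, norm_smul, inner_smul_right, inner_smul_left,
        norm_of_nonneg (by positivity), norm_of_nonneg (by positivity),
        div_mul_cancel₀ _ hw.ne', div_mul_cancel₀ _ hv.ne']
      have h3 := real_inner_le_norm v w
      have h5 : inner ℝ v w / (‖v‖ * ‖w‖) ≤ 1 := by rw [div_le_one (by positivity)]; exact h3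
      have h6 : inner ℝ v w = (‖v‖ * ‖w‖) * (inner ℝ v w / (‖v‖ * ‖w‖)) := by field_simp
      have h4 : R / ‖w‖ * ((starRingEnd ℝ) (R / ‖v‖) * inner ℝ v w)
        = R * R * (inner ℝ v w / (‖v‖ * ‖w‖)) := by simp; field_simp
      rw [h4]
      set q := inner ℝ v w / (‖v‖ * ‖w‖)
      rw [h6]
      have h7 : R * R ≤ ‖v‖ * ‖w‖ := by gcongr
      nlinarith [sq_nonneg (‖v‖ - ‖w‖), mul_nonneg (sub_nonneg.2 h5) (sub_nonneg.2 h7)]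
theorem CA_meas {n : ℕ} {f : Vd d → ℝ} (hf : CA n f) : Measurable f := by
  refine Continuous.measurable ?_
  rw [continuous_iff_continuousAt]
  intro v
  rw [ContinuousAt, tendsto_iff_norm_sub_tendsto_zero]
  have h0 : Tendsto (fun w : Vd d => ‖w - v‖ * (1 + ‖w‖ ^ n + ‖v‖ ^ n)) (nhds v) (nhds 0) := by
    have : Continuous fun w : Vd d => ‖w - v‖ * (1 + ‖w‖ ^ n + ‖v‖ ^ n) := by fun_prop
    have h := this.tendsto v
    simpa using h
  exact squeeze_zero (fun _ => norm_nonneg _) (fun w => hf.2 w v) h0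
theorem CA_proj {n : ℕ} {g : Vd d → ℝ} {R c : ℝ} {π : Vd d → Vd d} 
    (h1 : ∀ v, ‖π v‖ ≤ R) (h2 : ∀ v, ‖π v‖ ≤ ‖v‖) (h3 : ∀ v w, ‖π v - π w‖ ≤ ‖v - w‖) (hc : 0 < c)
    (g1 : ∀ v, ‖v‖ ≤ R → |g v| ≤ c * (1 + ‖v‖ ^ n))
    (g2 : ∀ v w, ‖v‖ ≤ R → ‖w‖ ≤ R → |g v - g w| ≤ c * (‖v - w‖ * (1 + ‖v‖ ^ n + ‖w‖ ^ n))) :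
    CA n fun v => c⁻¹ * g (π v) := by
  refine ⟨fun v => ?_, fun v w => ?_⟩
  · rw [abs_mul, abs_of_pos (inv_pos.2 hc), inv_mul_le_iff₀ hc]
    refine (g1 _ (h1 v)).trans ?_
    gcongr
    exact h2 v
  · rw [← mul_sub, abs_mul, abs_of_pos (inv_pos.2 hc), inv_mul_le_iff₀ hc]
    refine (g2 _ _ (h1 v) (h1 w)).trans ?_
    gcongr
    · exact h3 v w
    · exact h2 v
    · exact h2 w
theorem CA_BL {n : ℕ} {f : Vd d → ℝ} (hf : CA n f) {R : ℝ} (hR : 0 < R) :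
    ∃ K > 0, ∃ g : Vd d → ℝ, BL K g ∧ ∀ v, ‖v‖ ≤ R → g v = f v := by
  obtain ⟨π, p1, p2, p3, p4⟩ := proj_exists (d := d) hR
  refine ⟨1 + R ^ n + R ^ n, by positivity, fun v => f (π v), ⟨fun v => ?_, fun v w => ?_⟩,
    fun v hv => by simp [p4 v hv]⟩
  · have : ‖π v‖ ^ n ≤ R ^ n := by gcongr; exact p1 v
    have := hf.1 (π v)
    have : 0 ≤ R ^ n := by positivity
    linarith
  · refine (hf.2 _ _).trans ?_
    rw [mul_comm]
    gcongr
    · exact p1 v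
    · exact p1 w
    · exact p3 v w
section lin
variable {B : Vd d → Measure (Vd d)} (hd : 2 ≤ d) (hB : IsCollisionKernel B)
include hd hB
theorem kf_sum {ι : Type*} (s : Finset ι) (c : ι → ℝ) (f : ι → Vd d → ℝ) (hf : ∀ i ∈ s, Measurable (f i))
    (hK : ∀ i ∈ s, ∃ K, ∀ v, |f i v| ≤ K) (v vs : Vd d) :
    kf B (fun v => ∑ i ∈ s, c i * f i v) v vs = ∑ i ∈ s, c i * kf B (f i) v vs := by
  unfold kf
  simp only [← integral_const_mul]
  rw [← integral_finsetSum]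
  · congr 1; ext σ
    simp only [dlt, mul_sub, mul_add, Finset.sum_sub_distrib, Finset.sum_add_distrib]
  · intro i hi
    obtain ⟨K, hK⟩ := hK i hi
    refine (B_integrable hd hB _ (dlt_meas' (hf i hi) _ _) (K := 4 * K) fun σ _ => ?_).const_mul _
    unfold dlt
    have h1 := abs_le.1 (hK (postV v vs σ))
    have h2 := abs_le.1 (hK (postVs v vs σ))
    have h3 := abs_le.1 (hK v)
    have h4 := abs_le.1 (hK vs)
    rw [abs_le]; constructor <;> linarith
theorem QInt_sum {N : ℕ} {μ : Measure (Vd d)} (h : μ ∈ empiricalSphere d N)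
    {ι : Type*} (s : Finset ι) (c : ι → ℝ) (f : ι → Vd d → ℝ) (hf : ∀ i ∈ s, Measurable (f i))
    (hK : ∀ i ∈ s, ∃ K, ∀ v, |f i v| ≤ K) :
    QInt B (fun v => ∑ i ∈ s, c i * f i v) μ μ = ∑ i ∈ s, c i * QInt B (f i) μ μ := by
  simp only [QInt_eq, kf_sum hd hB s c f hf hK]
  simp only [← integral_const_mul]
  rw [← integral_finsetSum _ fun i _ => emp_integrable h _]
  congr 1; ext v
  rw [integral_finsetSum _ fun i _ => emp_integrable h _]
section path
variable {N : ℕ} {μ : ℝ → Measure (Vd d)} (hμ : Measurable μ) (he : ∀ s, μ s ∈ empiricalSphere d N)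
include hμ he
theorem path_int {f : Vd d → ℝ} (hf : Measurable f) {K : ℝ} (hK : ∀ v, ‖v‖ ^ 2 ≤ (N:ℝ) → |f v| ≤ K) (a t : ℝ) :
    IntegrableOn (fun s => QInt B f (μ s) (μ s)) (Ioc a t) := by
  refine Integrable.of_bound (QInt_meas hd hB hμ (fun s => emp_prob (he s)) hf).aestronglyMeasurable
    (8 * K * N) (Eventually.of_forall fun s => QInt_abs hd hB (he s) hK)
theorem Mt_sum {ι : Type*} (s : Finset ι) (c : ι → ℝ) (f : ι → Vd d → ℝ) (hf : ∀ i ∈ s, Measurable (f i))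
    (hK : ∀ i ∈ s, ∃ K, ∀ v, |f i v| ≤ K) (t : ℝ) :
    Mt B μ (fun v => ∑ i ∈ s, c i * f i v) t = ∑ i ∈ s, c i * Mt B μ (f i) t := by
  unfold Mt
  simp only [QInt_sum hd hB (he _) s c f hf hK, mul_sub, Finset.sum_sub_distrib]
  rw [integral_finsetSum _ fun i _ => emp_integrable (he t) _,
    integral_finsetSum _ fun i _ => emp_integrable (he 0) _, integral_finsetSum]
  · simp only [integral_const_mul]
  · intro i hi
    obtain ⟨K, hK⟩ := hK i hi
    exact (path_int hd hB hμ he (hf i hi) (fun v _ => hK v) 0 t).const_mul _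
theorem Mt_sub {f g : Vd d → ℝ} (hf : Measurable f) (hg : Measurable g) {K : ℝ} (hfK : ∀ v, |f v| ≤ K)
    (hgK : ∀ v, |g v| ≤ K) (t : ℝ) : Mt B μ (fun v => f v - g v) t = Mt B μ f t - Mt B μ g t := by
  have := Mt_sum hd hB hμ he Finset.univ ![1, -1] ![f, g] (by
    intro i _; fin_cases i <;> simpa) (by intro i _; fin_cases i <;> exact ⟨K, by simpa⟩) t
  simp [Fin.sum_univ_two, ← sub_eq_add_neg] at this
  exact this
omit hμ in
theorem Mt_congr {f g : Vd d → ℝ} (hfg : ∀ v, ‖v‖ ^ 2 ≤ (N:ℝ) → f v = g v) (t : ℝ) :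
    Mt B μ f t = Mt B μ g t := by
  unfold Mt
  simp only [QInt_congr hd hB (he _) hfg, emp_congr (he _) hfg]
omit hμ in
theorem Mt_bd {f : Vd d → ℝ} {K : ℝ} (hK : ∀ v, ‖v‖ ^ 2 ≤ (N:ℝ) → |f v| ≤ K) {t : ℝ} (ht : 0 ≤ t) :
    |Mt B μ f t| ≤ 2 * K + 8 * K * N * t := by
  unfold Mt
  have h1 := emp_abs_le (he t) hK
  have h2 := emp_abs_le (he 0) hK
  have h3 : |∫ s in Ioc 0 t, QInt B f (μ s) (μ s)| ≤ 8 * K * N * t := by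
    have := norm_setIntegral_le_of_norm_le_const (μ := volume) (s := Ioc 0 t)
      (f := fun s => QInt B f (μ s) (μ s)) (C := 8 * K * N) (by simp)
      (fun s _ => QInt_abs hd hB (he s) hK)
    simpa [ht] using this
  rw [abs_le] at *
  constructor <;> linarith [h1.1, h1.2, h2.1, h2.2, h3.1, h3.2]
theorem Mt_rc {n : ℕ} {f : Vd d → ℝ} (hf : CA n f)
    (hrc : ∀ K > 0, ∀ g : Vd d → ℝ, BL K g → ∀ t,
      ContinuousWithinAt (fun s => ∫ v, g v ∂(μ s)) (Ici t) t) {t : ℝ} (ht : 0 ≤ t) :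
    ContinuousWithinAt (fun s => Mt B μ f s) (Ici t) t := by
  have hN : (0:ℝ) < N := by have := emp_N_ne (he 0); positivity
  obtain ⟨K, hK, g, hg, hfg⟩ := CA_BL hf (R := N) hN
  have hfg' : ∀ v : Vd d, ‖v‖ ^ 2 ≤ (N:ℝ) → f v = g v := fun v hv => (hfg v (by
    have h1 : (1:ℝ) ≤ N := by exact_mod_cast Nat.one_le_iff_ne_zero.2 (emp_N_ne (he 0))
    nlinarith [norm_nonneg v])).symm
  have hfK : ∀ v : Vd d, ‖v‖ ^ 2 ≤ (N:ℝ) → |f v| ≤ K := fun v hv => by rw [hfg' v hv]; exact hg.1 v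
  have hI : ∀ a b, IntervalIntegrable (fun s => QInt B f (μ s) (μ s)) volume a b := fun a b =>
    ⟨path_int hd hB hμ he (CA_meas hf) hfK _ _, path_int hd hB hμ he (CA_meas hf) hfK _ _⟩
  have h1 := hrc K hK g hg t
  have h2 : ContinuousWithinAt (fun s => ∫ r in (0:ℝ)..s, QInt B f (μ r) (μ r)) (Ici t) t :=
    (intervalIntegral.continuous_primitive hI 0).continuousWithinAt
  refine ((h1.sub (continuousWithinAt_const (b := ∫ v, g v ∂(μ 0)))).sub h2).congr (fun s hs => ?_) ?_
  · unfold Mt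
    rw [emp_congr (he s) hfg', emp_congr (he 0) hfg', ← intervalIntegral.integral_of_le (ht.trans hs)]; rfl
  · unfold Mt
    rw [emp_congr (he t) hfg', emp_congr (he 0) hfg', ← intervalIntegral.integral_of_le ht]; rfl
end path
end lin
def kk (v : Vd d) : ℕ := Nat.size ⌊‖v‖⌋₊
theorem kk_le {v : Vd d} {k : ℕ} : kk v ≤ k ↔ ‖v‖ < 2 ^ k := by
  unfold kk
  rw [Nat.size_le, Nat.floor_lt (norm_nonneg _)]
  push_cast; rfl
theorem kk_meas : Measurable (kk (d := d)) :=
  (measurable_from_nat (f := Nat.size)).comp (Nat.measurable_floor.comp measurable_norm)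
theorem kk_bd (v : Vd d) : ‖v‖ < 2 ^ kk v := kk_le.1 le_rfl
def key (j : ℕ) (v : Vd d) : ℕ × (Fin d → ℤ) := (kk v, fun i => ⌊2 ^ j * v i / 2 ^ kk v⌋)
def cell (j : ℕ) (q : ℕ × (Fin d → ℤ)) (v : Vd d) : ℝ := by
  classical exact if key j v = q then 1 else 0
theorem key_meas (j : ℕ) : Measurable (key (d := d) j) := by
  unfold key
  refine kk_meas.prodMk (measurable_pi_lambda _ fun i => Int.measurable_floor.comp ?_)
  have h1 : Measurable fun v : Vd d => (2:ℝ) ^ kk v := (measurable_from_nat (f := fun k : ℕ => (2:ℝ) ^ k)).comp kk_meas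
  have h2 : Measurable fun v : Vd d => v i := by fun_prop
  exact (h2.const_mul _).div h1
theorem cell_meas (j : ℕ) (q : ℕ × (Fin d → ℤ)) : Measurable (cell j q) := by
  classical
  unfold cell
  exact Measurable.ite ((key_meas j) (measurableSet_singleton q)) measurable_const measurable_const
theorem cell_01 (j : ℕ) (q : ℕ × (Fin d → ℤ)) (v : Vd d) : 0 ≤ cell j q v ∧ cell j q v ≤ 1 := by
  unfold cell; split_ifs <;> simp
def pnt (j : ℕ) (q : ℕ × (Fin d → ℤ)) : Vd d := WithLp.toLp 2 fun i => 2 ^ q.1 / 2 ^ j * (q.2 i : ℝ)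
def par (q : ℕ × (Fin d → ℤ)) : ℕ × (Fin d → ℤ) := (q.1, fun i => q.2 i / 2)
theorem par_key (j : ℕ) (v : Vd d) : par (key (j + 1) v) = key j v := by
  unfold par key
  ext i
  · rfl
  · dsimp only
    have : 2 ^ j * v i / 2 ^ kk v = (2 ^ (j + 1) * v i / 2 ^ kk v) / (2:ℕ) := by push_cast; ring
    rw [this, Int.floor_div_natCast]; rfl
theorem pnt_dist (j : ℕ) (v : Vd d) : ‖v - pnt j (key j v)‖ ≤ d * (2 ^ kk v / 2 ^ j) := by
  have h : ∀ i, |(v - pnt j (key j v)) i| ≤ 2 ^ kk v / 2 ^ j := by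
    intro i
    have e : (v - pnt j (key j v)) i = 2 ^ kk v / 2 ^ j * Int.fract (2 ^ j * v i / 2 ^ kk v) := by
      have : (v - pnt j (key j v)) i = v i - 2 ^ kk v / 2 ^ j * (⌊2 ^ j * v i / 2 ^ kk v⌋ : ℝ) := rfl
      rw [this, Int.fract, mul_sub]
      congr 1
      field_simp
    rw [e, abs_mul, abs_of_pos (by positivity), Int.abs_fract]
    exact mul_le_of_le_one_right (by positivity) (Int.fract_lt_one _).le
  rw [EuclideanSpace.norm_eq]
  refine Real.sqrt_le_iff.2 ⟨by positivity, ?_⟩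
  calc ∑ i, ‖(v - pnt j (key j v)) i‖ ^ 2 ≤ ∑ i : Fin d, (2 ^ kk v / 2 ^ j : ℝ) ^ 2 := by
        gcongr with i; exact h i
    _ = d * (2 ^ kk v / 2 ^ j : ℝ) ^ 2 := by simp
    _ ≤ (d * (2 ^ kk v / 2 ^ j)) ^ 2 := by
        rw [mul_pow]
        gcongr
        have : d ≤ d ^ 2 := Nat.le_self_pow (by norm_num) d
        exact_mod_cast this
theorem pnt_norm (j : ℕ) (v : Vd d) : ‖pnt j (key j v)‖ ≤ (d + 1) * 2 ^ kk v := by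
  have h1 := pnt_dist j v
  have h2 : (2:ℝ) ^ kk v / 2 ^ j ≤ 2 ^ kk v := div_le_self (by positivity) (one_le_pow₀ (by norm_num))
  have h3 := kk_bd v
  have h4 : ‖pnt j (key j v)‖ ≤ ‖v‖ + ‖v - pnt j (key j v)‖ := by
    have := norm_sub_le v (v - pnt j (key j v)); rwa [sub_sub_cancel] at this
  have : (d:ℝ) * (2 ^ kk v / 2 ^ j) ≤ d * 2 ^ kk v := by gcongr
  linarith
def kset (d j K : ℕ) : Finset (ℕ × (Fin d → ℤ)) :=
  range (K + 1) ×ˢ Fintype.piFinset fun _ => Finset.Ico (-2 ^ j) (2 ^ j)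
theorem key_mem {j K : ℕ} {v : Vd d} (h : kk v ≤ K) : key j v ∈ kset d j K := by
  unfold kset key
  simp only [Finset.mem_product, Finset.mem_range, Fintype.mem_piFinset, Finset.mem_Ico]
  refine ⟨by omega, fun i => ?_⟩
  have h1 : |v i| < 2 ^ kk v := (PiLp.norm_apply_le v i).trans_lt (kk_bd v)
  rw [abs_lt] at h1
  have hk : (0:ℝ) < 2 ^ kk v := by positivity
  have hj : (0:ℝ) < 2 ^ j := by positivity
  constructor
  · rw [Int.le_floor]
    push_cast
    rw [le_div_iff₀ hk]
    nlinarith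
  · rw [Int.floor_lt]
    push_cast
    rw [div_lt_iff₀ hk]
    nlinarith
def DD (d : ℕ) : ℝ := 3 * (d + 1) * (1 + 2 * (d + 1) ^ 3)
def cf (f : Vd d → ℝ) : ℕ → (ℕ × (Fin d → ℤ)) → ℝ
  | 0, q => f (pnt 0 q)
  | j + 1, q => f (pnt (j + 1) q) - f (pnt j (par q))
theorem cf_tele (f : Vd d → ℝ) (J : ℕ) (v : Vd d) :
    ∑ j ∈ range (J + 1), cf f j (key j v) = f (pnt J (key J v)) := by
  induction J with
  | zero => simp [cf]
  | succ J ih => rw [Finset.sum_range_succ, ih]; simp only [cf, par_key]; ring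
theorem aux_pow (k : ℕ) : (2:ℝ) ^ (4 * k) = 2 ^ k * (2 ^ k) ^ 3 := by ring
theorem CA_pt {f : Vd d → ℝ} (hf : CA 3 f) {v w : Vd d} {k : ℕ} {a r : ℝ} (ha : 0 ≤ a) (hr : 0 < r)
    (hv : ‖v‖ ≤ (d + 1) * 2 ^ k) (hw : ‖w‖ ≤ (d + 1) * 2 ^ k) (h : ‖v - w‖ ≤ a * (d * (2 ^ k / r))) :
    |f v - f w| ≤ a * d * (1 + 2 * (d + 1) ^ 3) * (2 ^ (4 * k) / r) := by
  refine (hf.2 v w).trans ?_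
  have h2 : (1:ℝ) ≤ 2 ^ k := one_le_pow₀ (by norm_num)
  have h3 : (1:ℝ) ≤ (2 ^ k) ^ 3 := one_le_pow₀ h2
  calc ‖v - w‖ * (1 + ‖v‖ ^ 3 + ‖w‖ ^ 3)
      ≤ (a * (d * (2 ^ k / r))) * ((2 ^ k) ^ 3 + ((d + 1) * 2 ^ k) ^ 3 + ((d + 1) * 2 ^ k) ^ 3) := by
        gcongr
    _ = a * d * (1 + 2 * (d + 1) ^ 3) * (2 ^ (4 * k) / r) := by rw [aux_pow]; field_simp; ring
theorem cf_bd {f : Vd d → ℝ} (hf : CA 3 f) (j : ℕ) (v : Vd d) :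
    |cf f j (key j v)| ≤ DD d * (2 ^ (4 * kk v) / 2 ^ j) := by
  have h2 : (1:ℝ) ≤ 2 ^ kk v := one_le_pow₀ (by norm_num)
  have h3 : (1:ℝ) ≤ (2 ^ kk v) ^ 3 := one_le_pow₀ h2
  unfold DD
  cases j with
  | zero =>
    simp only [cf]
    refine (hf.1 _).trans ?_
    calc (1:ℝ) + ‖pnt 0 (key 0 v)‖ ^ 3 ≤ (2 ^ kk v : ℝ) ^ 3 + (((d:ℝ) + 1) * 2 ^ kk v) ^ 3 := by
          gcongr; exact pnt_norm 0 v
      _ = 1 * 1 * (1 + 1 * ((d:ℝ) + 1) ^ 3) * (1 * (2 ^ kk v) ^ 3) := by ring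
      _ ≤ 3 * ((d:ℝ) + 1) * (1 + 2 * (d + 1) ^ 3) * (2 ^ kk v * (2 ^ kk v) ^ 3) := by
          gcongr <;> linarith
      _ = _ := by rw [aux_pow]; simp
  | succ j =>
    simp only [cf, par_key]
    have h4 := pnt_dist (j + 1) v
    have h5 := pnt_dist j v
    have h6 : (2:ℝ) ^ kk v / 2 ^ j = 2 * (2 ^ kk v / 2 ^ (j + 1)) := by field_simp; ring
    have h7 : ‖pnt (j + 1) (key (j + 1) v) - pnt j (key j v)‖ ≤ 3 * (d * (2 ^ kk v / 2 ^ (j + 1))) := by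
      rw [h6] at h5
      have := norm_sub_le (v - pnt j (key j v)) (v - pnt (j + 1) (key (j + 1) v))
      rw [sub_sub_sub_cancel_left] at this
      linarith
    refine (CA_pt hf (by norm_num) (by positivity) (pnt_norm _ v) (pnt_norm _ v) h7).trans ?_
    gcongr; linarith
theorem cf_end {f : Vd d → ℝ} (hf : CA 3 f) (J : ℕ) (v : Vd d) :
    |f v - f (pnt J (key J v))| ≤ DD d * (2 ^ (4 * kk v) / 2 ^ J) := by
  have h4 := pnt_dist J v
  have h2 : (0:ℝ) < 2 ^ kk v := by positivity
  refine (CA_pt (a := 3) (r := 2 ^ J) hf (by norm_num) (by positivity) ?_ (pnt_norm _ v) (h4.trans ?_)).trans ?_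
  · have := kk_bd v; nlinarith
  · have : 0 ≤ (d:ℝ) * (2 ^ kk v / 2 ^ J) := by positivity
    linarith
  · unfold DD; gcongr; linarith
theorem kk_ball {N : ℕ} (hN : N ≠ 0) {v : Vd d} (hv : ‖v‖ ^ 2 ≤ (N:ℝ)) : kk v ≤ N := by
  rw [kk_le]
  have h1 : (1:ℝ) ≤ N := by exact_mod_cast Nat.one_le_iff_ne_zero.2 hN
  have h2 : ‖v‖ ≤ N := by nlinarith [norm_nonneg v]
  refine h2.trans_lt ?_
  exact_mod_cast Nat.lt_two_pow_self
section lin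
variable {B : Vd d → Measure (Vd d)} (hd : 2 ≤ d) (hB : IsCollisionKernel B)
include hd hB
variable {N : ℕ} {μ : ℝ → Measure (Vd d)} (hμ : Measurable μ) (he : ∀ s, μ s ∈ empiricalSphere d N)
include hμ he
theorem chain_det {f : Vd d → ℝ} (hf : CA 3 f) (J : ℕ) {t : ℝ} (ht : 0 ≤ t) :
    |Mt B μ f t| ≤ ∑ i ∈ (range (J + 1)).sigma (fun j => kset d j N),
        DD d * (2 ^ (4 * i.2.1) / 2 ^ i.1) * |Mt B μ (cell i.1 i.2) t|
      + DD d * (2 ^ (4 * N) / 2 ^ J) * (2 + 8 * N * t) := by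
  classical
  have hN := emp_N_ne (he 0)
  have hDD : 0 < DD d := by unfold DD; positivity
  set s := (range (J + 1)).sigma (fun j => kset d j N) with hs
  set F : Vd d → ℝ := fun v => ∑ i ∈ s, cf f i.1 i.2 * cell i.1 i.2 v with hF
  have hFv : ∀ v : Vd d, ‖v‖ ^ 2 ≤ (N:ℝ) → F v = f (pnt J (key J v)) := by
    intro v hv
    rw [← cf_tele f J v, hF, hs]
    dsimp only
    rw [Finset.sum_sigma]
    refine Finset.sum_congr rfl fun j _ => ?_
    have := key_mem (j := j) (kk_ball hN hv)
    simp [cell, this]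
  set g : Vd d → ℝ := fun v => if ‖v‖ ^ 2 ≤ (N:ℝ) then f v else 0 with hg
  have hgm : Measurable g := Measurable.ite
    (measurableSet_le (measurable_norm.pow_const 2) measurable_const) (CA_meas hf) measurable_const
  have hfg : ∀ v : Vd d, ‖v‖ ^ 2 ≤ (N:ℝ) → f v = g v := fun v hv => by simp [hg, hv]
  have hgb : ∀ v, |g v| ≤ 1 + (N:ℝ) ^ 3 := by
    intro v
    by_cases hv : ‖v‖ ^ 2 ≤ (N:ℝ)
    · rw [← hfg v hv]
      refine (hf.1 v).trans ?_
      have h1 : (1:ℝ) ≤ N := by exact_mod_cast Nat.one_le_iff_ne_zero.2 hN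
      gcongr
      nlinarith [norm_nonneg v]
    · simp [hg, hv]; positivity
  have hFm : Measurable F := Finset.measurable_fun_sum _ fun i _ => (cell_meas _ _).const_mul _
  have hFb : ∀ v, |F v| ≤ ∑ i ∈ s, |cf f i.1 i.2| := by
    intro v
    refine (Finset.abs_sum_le_sum_abs _ _).trans (sum_le_sum fun i _ => ?_)
    rw [abs_mul]
    refine mul_le_of_le_one_right (abs_nonneg _) ?_
    have := cell_01 i.1 i.2 v
    rw [abs_of_nonneg this.1]; exact this.2
  have e1 : Mt B μ F t = ∑ i ∈ s, cf f i.1 i.2 * Mt B μ (cell i.1 i.2) t :=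
    Mt_sum hd hB hμ he s _ _ (fun i _ => cell_meas _ _) (fun i _ => ⟨1, fun v => by
      have := cell_01 i.1 i.2 v
      rw [abs_of_nonneg this.1]; exact this.2⟩) t
  have e2 : Mt B μ f t = Mt B μ g t := Mt_congr hd hB he hfg t
  have e3 := Mt_sub hd hB hμ he hgm hFm (fun v => (hgb v).trans (le_max_left _ _))
    (fun v => (hFb v).trans (le_max_right _ _)) t
  have e4 : |Mt B μ (fun v => g v - F v) t| ≤ 2 * (DD d * (2 ^ (4 * N) / 2 ^ J))
      + 8 * (DD d * (2 ^ (4 * N) / 2 ^ J)) * N * t := by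
    refine Mt_bd hd hB he (fun v hv => ?_) ht
    rw [← hfg v hv, hFv v hv]
    refine (cf_end hf J v).trans ?_
    gcongr
    · norm_num
    · exact kk_ball hN hv
  have e5 : |Mt B μ F t| ≤ ∑ i ∈ s, DD d * (2 ^ (4 * i.2.1) / 2 ^ i.1) * |Mt B μ (cell i.1 i.2) t| := by
    rw [e1]
    refine (Finset.abs_sum_le_sum_abs _ _).trans (sum_le_sum fun i _ => ?_)
    rw [abs_mul]
    by_cases hi : ∃ v : Vd d, key i.1 v = i.2
    · obtain ⟨v, hv⟩ := hi
      gcongr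
      rw [← hv]
      exact cf_bd hf i.1 v
    · have : cell i.1 i.2 = fun _ : Vd d => (0:ℝ) := by
        ext v; unfold cell; rw [if_neg]; intro h; exact hi ⟨v, h⟩
      have h0 : Mt B μ (cell i.1 i.2) t = 0 := by
        rw [this]; simp [Mt, QInt]
      rw [h0]; simp
  rw [e2]
  have e6 : Mt B μ g t = Mt B μ F t + Mt B μ (fun v => g v - F v) t := by rw [e3]; ring
  rw [e6]
  refine (abs_add_le _ _).trans ?_
  linarith
end lin
def slt (f : Vd d → ℝ) (v vs σ : Vd d) : ℝ := f (postV v vs σ) + f (postVs v vs σ) + f v + f vs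
def ka (B : Vd d → Measure (Vd d)) (f : Vd d → ℝ) (v vs : Vd d) : ℝ := ∫ σ, slt f v vs σ ∂(B (v - vs))
theorem slt_meas' {f : Vd d → ℝ} (hf : Measurable f) (v vs : Vd d) :
    Measurable fun σ => slt f v vs σ := by
  unfold slt
  exact (((hf.comp (postV_meas v vs)).add (hf.comp (postVs_meas v vs))).add
    measurable_const).add measurable_const
theorem slt_meas3 {f : Vd d → ℝ} (hf : Measurable f) :
    Measurable fun q : (Vd d × Vd d) × Vd d => slt f q.1.1 q.1.2 q.2 := by
  have h1 : Measurable fun q : (Vd d × Vd d) × Vd d => postV q.1.1 q.1.2 q.2 := by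
    unfold postV; fun_prop
  have h2 : Measurable fun q : (Vd d × Vd d) × Vd d => postVs q.1.1 q.1.2 q.2 := by
    unfold postVs; fun_prop
  unfold slt
  exact (((hf.comp h1).add (hf.comp h2)).add (hf.comp (measurable_fst.comp measurable_fst))).add
    (hf.comp (measurable_snd.comp measurable_fst))
section EI
variable {Ω : Type*} [m : MeasurableSpace Ω] {B : Vd d → Measure (Vd d)} {N : ℕ} {P : Measure Ω}
  {𝓕 : Filtration ℝ m} {μp : ℝ → Ω → Measure (Vd d)}
def EI (P : Measure Ω) (T : ℝ) (μp : ℝ → Ω → Measure (Vd d)) (ψ : Vd d → Vd d → ℝ) : ℝ :=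
  ∫ ω, (∫ s in Ioc 0 T, ∫ v, ∫ vs, ψ v vs ∂(μp s ω) ∂(μp s ω)) ∂P
def Good (N : ℕ) (ψ : Vd d → Vd d → ℝ) : Prop :=
  (Measurable fun q : Vd d × Vd d => ψ q.1 q.2) ∧
    ∃ K, ∀ v vs, ‖v‖ ^ 2 ≤ (N:ℝ) → ‖vs‖ ^ 2 ≤ (N:ℝ) → |ψ v vs| ≤ K
theorem EI_int [IsProbabilityMeasure P] (h : IsKacProcess B N P 𝓕 μp) {ψ : Vd d → Vd d → ℝ}
    (hψ : Good N ψ) (T : ℝ) :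
    (∀ ω, IntegrableOn (fun s => ∫ v, ∫ vs, ψ v vs ∂(μp s ω) ∂(μp s ω)) (Ioc 0 T)) ∧
    Integrable (fun ω => ∫ s in Ioc 0 T, ∫ v, ∫ vs, ψ v vs ∂(μp s ω) ∂(μp s ω)) P := by
  obtain ⟨hm, K, hK⟩ := hψ
  have hb : ∀ s ω, |∫ v, ∫ vs, ψ v vs ∂(μp s ω) ∂(μp s ω)| ≤ K := fun s ω =>
    emp_abs_le (h.mem s ω) fun v hv => emp_abs_le (h.mem s ω) fun vs hvs => hK v vs hv hvs
  have hj : Measurable fun q : ℝ × Ω => ∫ v, ∫ vs, ψ v vs ∂(μp q.1 q.2) ∂(μp q.1 q.2) :=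
    double_meas (proc_joint h) (fun q => emp_prob (h.mem _ _)) hm
  refine ⟨fun ω => Integrable.of_bound (hj.comp measurable_prodMk_right).aestronglyMeasurable K
    (Eventually.of_forall fun s => hb s ω), ?_⟩
  have : Integrable (fun q : ℝ × Ω => ∫ v, ∫ vs, ψ v vs ∂(μp q.1 q.2) ∂(μp q.1 q.2))
    ((volume.restrict (Ioc 0 T)).prod P) :=
    Integrable.of_bound hj.aestronglyMeasurable K (Eventually.of_forall fun q => hb _ _)
  exact this.swap.integral_prod_left
theorem EI_mono [IsProbabilityMeasure P] (h : IsKacProcess B N P 𝓕 μp) {ψ φ : Vd d → Vd d → ℝ}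
    (hψ : Good N ψ) (hφ : Good N φ)
    (hle : ∀ v vs, ‖v‖ ^ 2 ≤ (N:ℝ) → ‖vs‖ ^ 2 ≤ (N:ℝ) → ψ v vs ≤ φ v vs) (T : ℝ) :
    EI P T μp ψ ≤ EI P T μp φ := by
  refine integral_mono (EI_int h hψ T).2 (EI_int h hφ T).2 fun ω => ?_
  refine integral_mono ((EI_int h hψ T).1 ω) ((EI_int h hφ T).1 ω) fun s => ?_
  exact emp_le (h.mem s ω) fun v hv => emp_le (h.mem s ω) fun vs hvs => hle v vs hv hvs
theorem EI_const_mul (c : ℝ) (ψ : Vd d → Vd d → ℝ) (T : ℝ) :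
    EI P T μp (fun v vs => c * ψ v vs) = c * EI P T μp ψ := by
  simp only [EI, integral_const_mul]
theorem EI_sum [IsProbabilityMeasure P] (h : IsKacProcess B N P 𝓕 μp) {ι : Type*} (s : Finset ι)
    (ψ : ι → Vd d → Vd d → ℝ) (hψ : ∀ i ∈ s, Good N (ψ i)) (T : ℝ) :
    EI P T μp (fun v vs => ∑ i ∈ s, ψ i v vs) = ∑ i ∈ s, EI P T μp (ψ i) := by
  unfold EI
  rw [← integral_finsetSum _ fun i hi => (EI_int h (hψ i hi) T).2]
  congr 1; ext ω
  rw [← integral_finsetSum _ fun i hi => (EI_int h (hψ i hi) T).1 ω]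
  congr 1; ext t
  rw [← integral_finsetSum _ fun i hi => emp_integrable (h.mem _ _) _]
  congr 1; ext v
  rw [← integral_finsetSum _ fun i hi => emp_integrable (h.mem _ _) _]
end EI
section kern
variable {B : Vd d → Measure (Vd d)} (hd : 2 ≤ d) (hB : IsCollisionKernel B)
include hd hB
theorem ka_meas {f : Vd d → ℝ} (hf : Measurable f) :
    Measurable fun q : Vd d × Vd d => ka B f q.1 q.2 :=
  inner_meas hd hB (φ := fun q => slt f q.1.1 q.1.2 q.2) (slt_meas3 hf)
theorem norm_sub_ball {N : ℕ} {v vs : Vd d} (hv : ‖v‖ ^ 2 ≤ (N:ℝ)) (hvs : ‖vs‖ ^ 2 ≤ (N:ℝ)) :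
    ‖v - vs‖ ≤ 2 + 2 * N := by
  have := norm_sub_le v vs
  nlinarith [sq_nonneg (‖v‖ - 1), sq_nonneg (‖vs‖ - 1)]
theorem slt_01 {f : Vd d → ℝ} (h0 : ∀ v, 0 ≤ f v) (h1 : ∀ v, f v ≤ 1) (v vs σ : Vd d) :
    |slt f v vs σ| ≤ 4 := by
  unfold slt
  rw [abs_le]
  constructor <;> linarith [h0 v, h0 vs, h0 (postV v vs σ), h0 (postVs v vs σ), h1 v, h1 vs,
    h1 (postV v vs σ), h1 (postVs v vs σ)]
theorem ka_good {f : Vd d → ℝ} (hf : Measurable f) (h0 : ∀ v, 0 ≤ f v) (h1 : ∀ v, f v ≤ 1) (N : ℕ) :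
    Good N (ka B f) := by
  refine ⟨ka_meas hd hB hf, 4 * (2 + 2 * N), fun v vs hv hvs => ?_⟩
  refine (B_int_le hd hB (v - vs) fun σ _ => slt_01 hd hB h0 h1 v vs σ).trans ?_
  have := norm_sub_ball hd hB hv hvs
  linarith
theorem kq_good {f : Vd d → ℝ} (hf : Measurable f) (h0 : ∀ v, 0 ≤ f v) (h1 : ∀ v, f v ≤ 1) (N : ℕ) :
    Good N (kq B f) := by
  refine ⟨kq_meas hd hB hf, 16 * (2 + 2 * N), fun v vs hv hvs => ?_⟩
  refine (B_int_le hd hB (v - vs) (K := 16) fun σ _ => ?_).trans ?_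
  · have : |dlt f v vs σ| ≤ 4 := by
      unfold dlt
      rw [abs_le]
      constructor <;> linarith [h0 v, h0 vs, h0 (postV v vs σ), h0 (postVs v vs σ), h1 v, h1 vs,
        h1 (postV v vs σ), h1 (postVs v vs σ)]
    rw [abs_of_nonneg (by positivity), ← sq_abs]
    nlinarith [abs_nonneg (dlt f v vs σ)]
  · have := norm_sub_ball hd hB hv hvs
    linarith
theorem ka_int {f : Vd d → ℝ} (hf : Measurable f) (h0 : ∀ v, 0 ≤ f v) (h1 : ∀ v, f v ≤ 1) (v vs : Vd d) :
    Integrable (fun σ => slt f v vs σ) (B (v - vs)) :=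
  B_integrable hd hB _ (slt_meas' hf v vs) fun σ _ => slt_01 hd hB h0 h1 v vs σ
theorem kf_le_ka {f : Vd d → ℝ} (hf : Measurable f) (h0 : ∀ v, 0 ≤ f v) (h1 : ∀ v, f v ≤ 1) (v vs : Vd d) :
    |kf B f v vs| ≤ ka B f v vs := by
  refine norm_integral_le_of_norm_le (f := fun σ => dlt f v vs σ) (ka_int hd hB hf h0 h1 v vs) (Eventually.of_forall fun σ => ?_)
  rw [norm_eq_abs]
  unfold dlt slt
  rw [abs_le]
  constructor <;> linarith [h0 v, h0 vs, h0 (postV v vs σ), h0 (postVs v vs σ)]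
theorem kq_le_ka {f : Vd d → ℝ} (hf : Measurable f) (h0 : ∀ v, 0 ≤ f v) (h1 : ∀ v, f v ≤ 1) (v vs : Vd d) :
    kq B f v vs ≤ 4 * ka B f v vs := by
  unfold ka
  rw [← integral_const_mul]
  refine (le_abs_self _).trans (norm_integral_le_of_norm_le (f := fun σ => dlt f v vs σ ^ 2) ((ka_int hd hB hf h0 h1 v vs).const_mul 4)
    (Eventually.of_forall fun σ => ?_))
  rw [norm_eq_abs, abs_of_nonneg (by positivity)]
  unfold dlt slt
  generalize hx : f (postV v vs σ) = x
  generalize hy : f (postVs v vs σ) = y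
  have x0 := h0 (postV v vs σ); have x1 := h1 (postV v vs σ)
  have y0 := h0 (postVs v vs σ); have y1 := h1 (postVs v vs σ)
  rw [hx] at x0 x1; rw [hy] at y0 y1
  have := h0 v; have := h1 v; have := h0 vs; have := h1 vs
  have a1 : x ^ 2 ≤ x := by nlinarith
  have a2 : y ^ 2 ≤ y := by nlinarith
  have a3 : f v ^ 2 ≤ f v := by nlinarith
  have a4 : f vs ^ 2 ≤ f vs := by nlinarith
  nlinarith [sq_nonneg (x - y), sq_nonneg (x + f v), sq_nonneg (x + f vs), sq_nonneg (y + f v),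
    sq_nonneg (y + f vs), sq_nonneg (f v - f vs)]
theorem ka_sum_le {ι : Type*} (s : Finset ι) (f : ι → Vd d → ℝ) (g : Vd d → ℝ)
    (hf : ∀ i ∈ s, Measurable (f i)) (h0 : ∀ i v, 0 ≤ f i v) (h1 : ∀ i v, f i v ≤ 1)
    (hg : Measurable g) (g0 : ∀ v, 0 ≤ g v) (g1 : ∀ v, g v ≤ 1)
    (hle : ∀ v, ∑ i ∈ s, f i v ≤ g v) (v vs : Vd d) :
    ∑ i ∈ s, ka B (f i) v vs ≤ ka B g v vs := by
  unfold ka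
  rw [← integral_finsetSum _ fun i hi => ka_int hd hB (hf i hi) (h0 i) (h1 i) v vs]
  refine integral_mono (integrable_finsetSum _ fun i hi => ka_int hd hB (hf i hi) (h0 i) (h1 i) v vs)
    (ka_int hd hB hg g0 g1 v vs) fun σ => ?_
  simp only [slt, Finset.sum_add_distrib]
  linarith [hle v, hle vs, hle (postV v vs σ), hle (postVs v vs σ)]
theorem ka_moment {f : Vd d → ℝ} {p c : ℝ} (hp : 1 ≤ p) (hc : 0 ≤ c) (h0 : ∀ v, 0 ≤ f v)
    (hfc : ∀ v, f v ≤ c * (1 + ‖v‖ ^ p)) (v vs : Vd d) :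
    ka B f v vs ≤ 8 * c * 2 ^ (p + 1) * (1 + ‖v‖ ^ (p + 1) + ‖vs‖ ^ (p + 1)) := by
  set s := ‖v‖ + ‖vs‖ with hs
  have hs0 : 0 ≤ s := by positivity
  have hw : ∀ w : Vd d, ‖w‖ ≤ s → f w ≤ c * (1 + s ^ p) := fun w hw => (hfc w).trans (by gcongr)
  have hb : ∀ σ : Vd d, ‖σ‖ = 1 → |slt f v vs σ| ≤ 4 * (c * (1 + s ^ p)) := by
    intro σ hσ
    have he := post_energy v vs σ hσ
    have n1 : ‖postV v vs σ‖ ≤ s := by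
      refine le_of_sq_le_sq ?_ hs0
      nlinarith [sq_nonneg ‖postVs v vs σ‖, mul_nonneg (norm_nonneg v) (norm_nonneg vs)]
    have n2 : ‖postVs v vs σ‖ ≤ s := by
      refine le_of_sq_le_sq ?_ hs0
      nlinarith [sq_nonneg ‖postV v vs σ‖, mul_nonneg (norm_nonneg v) (norm_nonneg vs)]
    have := hw _ n1; have := hw _ n2
    have := hw v (by linarith [norm_nonneg vs]); have := hw vs (by linarith [norm_nonneg v])
    unfold slt
    rw [abs_le]
    constructor <;> linarith [h0 v, h0 vs, h0 (postV v vs σ), h0 (postVs v vs σ)]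
  have h1 := (le_abs_self _).trans (B_int_le hd hB (v - vs) hb)
  have h2 : ‖v - vs‖ ≤ s := norm_sub_le v vs
  have h3 : s * (1 + s ^ p) ≤ 2 * (1 + s ^ (p + 1)) := by
    have e : s * s ^ p = s ^ (p + 1) := by
      rw [Real.rpow_add_one' hs0 (by linarith)]; ring
    have : s ≤ 1 + s ^ (p + 1) := by
      rcases le_total s 1 with h | h
      · have : 0 ≤ s ^ (p + 1) := by positivity
        linarith
      · have := Real.self_le_rpow_of_one_le h (by linarith : 1 ≤ p + 1)
        linarith
    rw [mul_add, e]
    linarith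
  have h4 : s ^ (p + 1) ≤ 2 ^ (p + 1) * (‖v‖ ^ (p + 1) + ‖vs‖ ^ (p + 1)) := by
    have a1 : 0 ≤ ‖v‖ ^ (p + 1) := by positivity
    have a2 : 0 ≤ ‖vs‖ ^ (p + 1) := by positivity
    rcases le_total ‖v‖ ‖vs‖ with h | h
    · calc s ^ (p + 1) ≤ (2 * ‖vs‖) ^ (p + 1) := by gcongr; linarith
        _ = 2 ^ (p + 1) * ‖vs‖ ^ (p + 1) := Real.mul_rpow (by norm_num) (norm_nonneg _)
        _ ≤ _ := by gcongr; linarith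
    · calc s ^ (p + 1) ≤ (2 * ‖v‖) ^ (p + 1) := by gcongr; linarith
        _ = 2 ^ (p + 1) * ‖v‖ ^ (p + 1) := Real.mul_rpow (by norm_num) (norm_nonneg _)
        _ ≤ _ := by gcongr; linarith
  have h5 : (1:ℝ) ≤ 2 ^ (p + 1) := Real.one_le_rpow (by norm_num) (by linarith)
  calc ka B f v vs ≤ 4 * (c * (1 + s ^ p)) * ‖v - vs‖ := h1
    _ ≤ 4 * (c * (1 + s ^ p)) * s := by gcongr
    _ = 4 * c * (s * (1 + s ^ p)) := by ring
    _ ≤ 4 * c * (2 * (1 + s ^ (p + 1))) := by gcongr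
    _ ≤ 4 * c * (2 * (2 ^ (p + 1) + 2 ^ (p + 1) * (‖v‖ ^ (p + 1) + ‖vs‖ ^ (p + 1)))) := by gcongr
    _ = _ := by ring
end kern
theorem sq_mean_le {Ω : Type*} [MeasurableSpace Ω] {P : Measure Ω} [IsProbabilityMeasure P] {X : Ω → ℝ}
    (hX : AEStronglyMeasurable X P) {K : ℝ} (hK : ∀ ω, |X ω| ≤ K) :
    (∫ ω, |X ω| ∂P) ^ 2 ≤ ∫ ω, X ω ^ 2 ∂P := by
  have i1 : Integrable (fun ω => |X ω|) P :=
    (Integrable.of_bound hX K (Eventually.of_forall hK)).abs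
  have i2 : Integrable (fun ω => X ω ^ 2) P :=
    Integrable.of_bound (hX.pow 2) (K ^ 2) (Eventually.of_forall fun ω => by
      rw [norm_eq_abs, abs_pow]; gcongr; exact hK ω)
  set c := ∫ ω, |X ω| ∂P with hc
  have h : 0 ≤ ∫ ω, (X ω ^ 2 - 2 * c * |X ω| + c ^ 2) ∂P := integral_nonneg fun ω => by
    have : X ω ^ 2 - 2 * c * |X ω| + c ^ 2 = (|X ω| - c) ^ 2 := by rw [← sq_abs (X ω)]; ring
    dsimp only
    rw [this]; positivity
  rw [integral_add (i2.sub' (i1.const_mul _)) (integrable_const _), integral_sub i2 (i1.const_mul _),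
    integral_const_mul, ← hc] at h
  simp at h
  nlinarith
section
variable {B : Vd d → Measure (Vd d)} (hd : 2 ≤ d) (hB : IsCollisionKernel B)
variable {Ω : Type*} [m : MeasurableSpace Ω] {N : ℕ} {P : Measure Ω} [IsProbabilityMeasure P]
  {𝓕 : Filtration ℝ m} {μp : ℝ → Ω → Measure (Vd d)}
include hd hB
theorem kf_good {f : Vd d → ℝ} (hf : Measurable f) (h0 : ∀ v, 0 ≤ f v) (h1 : ∀ v, f v ≤ 1) (N : ℕ) :
    Good N (kf B f) := by
  obtain ⟨-, K, hK⟩ := ka_good hd hB hf h0 h1 N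
  exact ⟨kf_meas hd hB hf, K, fun v vs hv hvs => (kf_le_ka hd hB hf h0 h1 v vs).trans
    ((le_abs_self _).trans (hK v vs hv hvs))⟩
omit hd hB in
theorem int01 (h : IsKacProcess B N P 𝓕 μp) {f : Vd d → ℝ} (hf : Measurable f) (h0 : ∀ v, 0 ≤ f v)
    (h1 : ∀ v, f v ≤ 1) (t : ℝ) : Integrable (fun ω => ∫ v, f v ∂(μp t ω)) P := by
  refine Integrable.of_bound (int_meas (proc_meas h t) (fun ω => emp_prob (h.mem t ω)) hf).aestronglyMeasurable 1
    (Eventually.of_forall fun ω => emp_abs_le (h.mem t ω) fun v _ => ?_)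
  rw [abs_of_nonneg (h0 v)]; exact h1 v
theorem Mt_integrable (h : IsKacProcess B N P 𝓕 μp) {f : Vd d → ℝ} (hf : Measurable f) (h0 : ∀ v, 0 ≤ f v)
    (h1 : ∀ v, f v ≤ 1) (T : ℝ) : Integrable (fun ω => Mt B (fun t => μp t ω) f T) P :=
  ((int01 h hf h0 h1 T).sub' (int01 h hf h0 h1 0)).sub' (EI_int h (kf_good hd hB hf h0 h1 N) T).2
variable {ι : Type*} (s : Finset ι) (f : ι → Vd d → ℝ) (g : Vd d → ℝ)
    (hf : ∀ i, Measurable (f i)) (h0 : ∀ i v, 0 ≤ f i v) (h1 : ∀ i v, f i v ≤ 1)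
    (hg : Measurable g) (g0 : ∀ v, 0 ≤ g v) (g1 : ∀ v, g v ≤ 1)
    (hle : ∀ v, ∑ i ∈ s, f i v ≤ g v)
include hf h0 h1 hg g0 g1 hle
theorem EI_ka_sum (h : IsKacProcess B N P 𝓕 μp) (T : ℝ) :
    ∑ i ∈ s, EI P T μp (ka B (f i)) ≤ EI P T μp (ka B g) := by
  rw [← EI_sum h s _ (fun i _ => ka_good hd hB (hf i) (h0 i) (h1 i) N)]
  refine EI_mono h ?_ (ka_good hd hB hg g0 g1 N) (fun v vs _ _ =>
    ka_sum_le hd hB s f g (fun i _ => hf i) h0 h1 hg g0 g1 hle v vs) T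
  refine ⟨Finset.measurable_fun_sum _ fun i _ => ka_meas hd hB (hf i), ?_⟩
  choose hm K hK using fun i => ka_good hd hB (hf i) (h0 i) (h1 i) N
  exact ⟨∑ i ∈ s, K i, fun v vs hv hvs => (Finset.abs_sum_le_sum_abs _ _).trans
    (sum_le_sum fun i _ => hK i v vs hv hvs)⟩
theorem sum_b (h : IsKacProcess B N P 𝓕 μp) (T : ℝ) :
    ∑ i ∈ s, ∫ ω, |Mt B (fun t => μp t ω) (f i) T| ∂P ≤
      (∫ ω, ∫ v, g v ∂(μp T ω) ∂P) + (∫ ω, ∫ v, g v ∂(μp 0 ω) ∂P) + EI P T μp (ka B g) := by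
  have hi : ∀ i, ∫ ω, |Mt B (fun t => μp t ω) (f i) T| ∂P ≤
      (∫ ω, ∫ v, f i v ∂(μp T ω) ∂P) + (∫ ω, ∫ v, f i v ∂(μp 0 ω) ∂P) + EI P T μp (ka B (f i)) := by
    intro i
    have j1 := int01 h (hf i) (h0 i) (h1 i) T
    have j2 := int01 h (hf i) (h0 i) (h1 i) 0
    have j3 := EI_int h (ka_good hd hB (hf i) (h0 i) (h1 i) N) T
    have j4 := EI_int h (kf_good hd hB (hf i) (h0 i) (h1 i) N) T
    unfold EI
    rw [← integral_add j1 j2, ← integral_add (j1.fun_add j2) j3.2]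
    refine integral_mono (Mt_integrable hd hB h (hf i) (h0 i) (h1 i) T).abs ((j1.fun_add j2).fun_add j3.2) fun ω => ?_
    dsimp only
    unfold Mt
    have a1 : 0 ≤ ∫ v, f i v ∂(μp T ω) := integral_nonneg (h0 i)
    have a2 : 0 ≤ ∫ v, f i v ∂(μp 0 ω) := integral_nonneg (h0 i)
    have a3 : |∫ s in Ioc 0 T, QInt B (f i) (μp s ω) (μp s ω)| ≤
        ∫ s in Ioc 0 T, ∫ v, ∫ vs, ka B (f i) v vs ∂(μp s ω) ∂(μp s ω) := by
      refine norm_integral_le_of_norm_le (f := fun s => QInt B (f i) (μp s ω) (μp s ω)) (j3.1 ω) (Eventually.of_forall fun s => ?_)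
      refine (norm_integral_le_integral_norm _).trans (emp_le (h.mem s ω) fun v _ => ?_)
      refine (norm_integral_le_integral_norm _).trans (emp_le (h.mem s ω) fun vs _ => ?_)
      exact kf_le_ka hd hB (hf i) (h0 i) (h1 i) v vs
    rw [abs_le] at *
    constructor <;> linarith [a3.1, a3.2]
  have hs : ∀ t, ∑ i ∈ s, ∫ ω, ∫ v, f i v ∂(μp t ω) ∂P ≤ ∫ ω, ∫ v, g v ∂(μp t ω) ∂P := by
    intro t
    rw [← integral_finsetSum _ fun i _ => int01 h (hf i) (h0 i) (h1 i) t]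
    refine integral_mono (integrable_finsetSum _ fun i _ => int01 h (hf i) (h0 i) (h1 i) t) (int01 h hg g0 g1 t) fun ω => ?_
    dsimp only
    rw [← integral_finsetSum _ fun i _ => emp_integrable (h.mem t ω) _]
    exact emp_le (h.mem t ω) fun v _ => hle v
  refine (sum_le_sum fun i _ => hi i).trans ?_
  rw [Finset.sum_add_distrib, Finset.sum_add_distrib]
  have := EI_ka_sum hd hB s f g hf h0 h1 hg g0 g1 hle h T
  linarith [hs T, hs 0]
theorem sum_a (h : IsKacProcess B N P 𝓕 μp) {T : ℝ} (hT : 0 ≤ T) :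
    (∑ i ∈ s, ∫ ω, |Mt B (fun t => μp t ω) (f i) T| ∂P) ^ 2 ≤
      s.card * ((N:ℝ)⁻¹ * (4 * EI P T μp (ka B g))) := by
  have hi : ∀ i, (∫ ω, |Mt B (fun t => μp t ω) (f i) T| ∂P) ^ 2 ≤ (N:ℝ)⁻¹ * (4 * EI P T μp (ka B (f i))) := by
    intro i
    refine (sq_mean_le (Mt_integrable hd hB h (hf i) (h0 i) (h1 i) T).aestronglyMeasurable
      (K := 2 * 1 + 8 * 1 * N * T)
      fun ω => Mt_bd hd hB (fun t => h.mem t ω) (fun v _ => by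
        rw [abs_of_nonneg (h0 i v)]; exact h1 i v) hT).trans ?_
    have e := kac_var hd hB h (hf i) (h0 i) (h1 i) hT
    refine e.le.trans ?_
    simp only [integral_const_mul]
    gcongr
    rw [← EI_const_mul]
    refine EI_mono h (kq_good hd hB (hf i) (h0 i) (h1 i) N) ?_ (fun v vs _ _ =>
      kq_le_ka hd hB (hf i) (h0 i) (h1 i) v vs) T
    obtain ⟨hm, K, hK⟩ := ka_good hd hB (hf i) (h0 i) (h1 i) N
    exact ⟨hm.const_mul 4, 4 * K, fun v vs hv hvs => by
      rw [abs_mul]; have := hK v vs hv hvs; norm_num; linarith⟩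
  refine sq_sum_le_card_mul_sum_sq.trans ?_
  gcongr
  refine (sum_le_sum fun i _ => hi i).trans ?_
  rw [← Finset.mul_sum, ← Finset.mul_sum]
  gcongr
  exact EI_ka_sum hd hB s f g hf h0 h1 hg g0 g1 hle h T
end
def shell (k : ℕ) (v : Vd d) : ℝ := if kk v = k then 1 else 0
theorem shell_meas (k : ℕ) : Measurable (shell (d := d) k) := by
  unfold shell
  exact Measurable.ite (kk_meas (measurableSet_singleton k)) measurable_const measurable_const
theorem shell_0 (k : ℕ) (v : Vd d) : 0 ≤ shell k v := by unfold shell; split_ifs <;> simp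
theorem shell_1 (k : ℕ) (v : Vd d) : shell k v ≤ 1 := by unfold shell; split_ifs <;> simp
theorem shell_sum (j k : ℕ) (s : Finset (Fin d → ℤ)) (v : Vd d) :
    ∑ z ∈ s, cell j (k, z) v ≤ shell k v := by
  classical
  unfold shell cell key
  split_ifs with h
  · simp only [h, Prod.mk.injEq, true_and]
    rw [Finset.sum_ite_eq]
    split_ifs <;> simp
  · simp [h]
def rr (p : ℝ) : ℝ := 2 ^ (-p / 2)
theorem rr_pos (p : ℝ) : 0 < rr p := by unfold rr; positivity
theorem shell_mom (k : ℕ) {p : ℝ} (hp : 0 ≤ p) (v : Vd d) :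
    shell k v ≤ ((rr p)⁻¹ ^ 2 * rr p ^ (2 * k)) * (1 + ‖v‖ ^ p) := by
  have hr := rr_pos p
  have hv : 0 ≤ ‖v‖ ^ p := by positivity
  unfold shell
  split_ifs with h
  · have e1 : (rr p)⁻¹ ^ 2 = 2 ^ p := by
      unfold rr
      rw [← Real.rpow_neg (by norm_num), ← Real.rpow_natCast, ← Real.rpow_mul (by norm_num)]
      congr 1; push_cast; ring
    cases k with
    | zero =>
      have : (1:ℝ) ≤ (rr p)⁻¹ ^ 2 := by rw [e1]; exact Real.one_le_rpow (by norm_num) hp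
      simp only [mul_zero, pow_zero, mul_one]
      nlinarith
    | succ k =>
      have h2 : (2:ℝ) ^ k ≤ ‖v‖ := by
        by_contra hc
        push Not at hc
        have := kk_le.2 hc
        omega
      have h3 : ((rr p)⁻¹ ^ 2) ^ k ≤ ‖v‖ ^ p := by
        rw [e1]
        calc ((2:ℝ) ^ p) ^ k = ((2:ℝ) ^ k) ^ p := by
              rw [← Real.rpow_natCast, ← Real.rpow_mul (by norm_num), mul_comm,
                Real.rpow_mul (by norm_num), Real.rpow_natCast]
          _ ≤ _ := by gcongr
      have e2 : (rr p)⁻¹ ^ 2 * rr p ^ (2 * (k + 1)) = (((rr p)⁻¹ ^ 2) ^ k)⁻¹ := by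
        rw [inv_pow, inv_pow, inv_inv, ← pow_mul, mul_add, pow_add]
        field_simp
      rw [e2, inv_mul_eq_div, one_le_div (by positivity)]
      linarith
  · positivity
theorem zcard (d j : ℕ) : (Fintype.piFinset fun _ : Fin d => Finset.Ico (-2 ^ j : ℤ) (2 ^ j)).card = 2 ^ d * (2 ^ j) ^ d := by
  rw [Fintype.card_piFinset]
  simp
  have : ((2:ℤ) ^ j + 2 ^ j).toNat = 2 * 2 ^ j := by
    have : ((2:ℤ) ^ j + 2 ^ j) = ((2 * 2 ^ j : ℕ) : ℤ) := by push_cast; ring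
    rw [this, Int.toNat_natCast]
  rw [this, mul_pow]
section
variable {B : Vd d → Measure (Vd d)} (hd : 2 ≤ d) (hB : IsCollisionKernel B)
include hd hB
theorem cellsum {p : ℝ} (hp : 2 < p) {lam T : ℝ} (hlam : 0 ≤ lam) (hT : 0 ≤ T) :
    ∃ C : ℝ, 0 ≤ C ∧ ∀ (Ω : Type) (m : MeasurableSpace Ω) (P : Measure Ω),
      IsProbabilityMeasure P → ∀ (𝓕 : Filtration ℝ m) (N : ℕ) (μp : ℝ → Ω → Measure (Vd d)),
      IsKacProcess B N P 𝓕 μp → (∀ ω, momentL p (μp 0 ω) ≤ ENNReal.ofReal lam) →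
      ∀ j k : ℕ, ∑ z ∈ Fintype.piFinset fun _ : Fin d => Finset.Ico (-2 ^ j : ℤ) (2 ^ j),
        ∫ ω, |Mt B (fun t => μp t ω) (cell j (k, z)) T| ∂P
        ≤ C * (rr p ^ k * min (sqrt ((2 ^ j) ^ d / N)) 1) := by
  obtain ⟨C, hC, hmom⟩ := moments hd hB hp hlam hT
  have hr := rr_pos p
  have hr1 : rr p ≤ 1 := by
    unfold rr; exact Real.rpow_le_one_of_one_le_of_nonpos (by norm_num) (by linarith)
  set D1 := (rr p)⁻¹ ^ 2 * (1 + C) with hD1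
  set D2 := 8 * (rr p)⁻¹ ^ 2 * 2 ^ (p + 1) * (T + 2 * C) with hD2
  have hD10 : 0 ≤ D1 := by positivity
  have hD20 : 0 ≤ D2 := by positivity
  refine ⟨max (2 * D1 + D2) (sqrt (2 ^ d * (4 * D2))), le_max_of_le_left (by positivity), ?_⟩
  intro Ω m P hP 𝓕 N μp h h0 j k
  obtain ⟨hm1, hm2⟩ := hmom Ω m P hP 𝓕 N μp h h0
  have hs : ∀ t ∈ Icc 0 T, ∫ ω, ∫ v, shell k v ∂(μp t ω) ∂P ≤ D1 * rr p ^ (2 * k) := by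
    intro t ht
    have i1 : Integrable (fun ω => ∫ v, ‖v‖ ^ p ∂(μp t ω)) P := by
      refine Integrable.of_bound (int_meas (proc_meas h t) (fun ω => emp_prob (h.mem t ω))
        (by fun_prop)).aestronglyMeasurable ((N:ℝ) ^ (p / 2))
        (Eventually.of_forall fun ω => emp_abs_le (h.mem t ω) fun v hv => ?_)
      rw [abs_of_nonneg (by positivity)]
      exact norm_rpow_ball (by linarith) hv
    calc ∫ ω, ∫ v, shell k v ∂(μp t ω) ∂P
        ≤ ∫ ω, ((rr p)⁻¹ ^ 2 * rr p ^ (2 * k)) * (1 + ∫ v, ‖v‖ ^ p ∂(μp t ω)) ∂P := by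
          refine integral_mono (int01 h (shell_meas k) (shell_0 k) (shell_1 k) t)
            (((integrable_const _).fun_add i1).const_mul _) fun ω => ?_
          have := emp_prob (h.mem t ω)
          have e : ∫ v, ((rr p)⁻¹ ^ 2 * rr p ^ (2 * k)) * (1 + ‖v‖ ^ p) ∂(μp t ω)
            = ((rr p)⁻¹ ^ 2 * rr p ^ (2 * k)) * (1 + ∫ v, ‖v‖ ^ p ∂(μp t ω)) := by
            rw [integral_const_mul, integral_add (emp_integrable (h.mem t ω) _) (emp_integrable (h.mem t ω) _)]
            simp
          dsimp only
          rw [← e]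
          exact emp_le (h.mem t ω) fun v _ => shell_mom k (by linarith) v
      _ = ((rr p)⁻¹ ^ 2 * rr p ^ (2 * k)) * (1 + ∫ ω, ∫ v, ‖v‖ ^ p ∂(μp t ω) ∂P) := by
          rw [integral_const_mul, integral_add (integrable_const _) i1]; simp
      _ ≤ ((rr p)⁻¹ ^ 2 * rr p ^ (2 * k)) * (1 + C) :=
          mul_le_mul_of_nonneg_left (by linarith [hm1 t ht]) (by positivity)
      _ = _ := by rw [hD1]; ring
  have hk : EI P T μp (ka B (shell k)) ≤ D2 * rr p ^ (2 * k) := by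
    have hG : Good N fun v vs : Vd d => 1 + ‖v‖ ^ (p + 1) + ‖vs‖ ^ (p + 1) := by
      refine ⟨by fun_prop, 1 + (N:ℝ) ^ ((p + 1) / 2) + (N:ℝ) ^ ((p + 1) / 2), fun v vs hv hvs => ?_⟩
      rw [abs_of_nonneg (by positivity)]
      exact add_le_add (add_le_add le_rfl (norm_rpow_ball (by linarith) hv)) (norm_rpow_ball (by linarith) hvs)
    set c := 8 * ((rr p)⁻¹ ^ 2 * rr p ^ (2 * k)) * 2 ^ (p + 1) with hc
    have hc0 : 0 ≤ c := by positivity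
    have hG' : Good N fun v vs : Vd d => c * (1 + ‖v‖ ^ (p + 1) + ‖vs‖ ^ (p + 1)) := by
      obtain ⟨hm, K, hK⟩ := hG
      exact ⟨hm.const_mul c, c * K, fun v vs hv hvs => by
        rw [abs_mul, abs_of_nonneg hc0]; gcongr; exact hK v vs hv hvs⟩
    have h1 := EI_mono h (ka_good hd hB (shell_meas k) (shell_0 k) (shell_1 k) N) hG'
      (fun v vs _ _ => ka_moment hd hB (by linarith) (by positivity) (shell_0 k)
        (fun v => shell_mom k (by linarith) v) v vs) T
    rw [EI_const_mul] at h1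
    have h2 : EI P T μp (fun v vs : Vd d => 1 + ‖v‖ ^ (p + 1) + ‖vs‖ ^ (p + 1)) ≤ T + 2 * C := by
      have hG1 : Good N fun v _ : Vd d => ‖v‖ ^ (p + 1) := by
        refine ⟨by fun_prop, (N:ℝ) ^ ((p + 1) / 2), fun v vs hv hvs => ?_⟩
        rw [abs_of_nonneg (by positivity)]
        exact norm_rpow_ball (by linarith) hv
      have hI := EI_int h hG1 T
      have hpr : ∀ s ω, IsProbabilityMeasure (μp s ω) := fun s ω => emp_prob (h.mem s ω)
      simp only [integral_const, probReal_univ, one_smul] at hI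
      have e : EI P T μp (fun v vs : Vd d => 1 + ‖v‖ ^ (p + 1) + ‖vs‖ ^ (p + 1))
          = T + 2 * ∫ ω, (∫ s in Ioc 0 T, ∫ v, ‖v‖ ^ (p + 1) ∂(μp s ω)) ∂P := by
        unfold EI
        have e1 : ∀ s ω, ∫ v, ∫ vs, (1 + ‖v‖ ^ (p + 1) + ‖vs‖ ^ (p + 1)) ∂(μp s ω) ∂(μp s ω)
            = 1 + 2 * ∫ v, ‖v‖ ^ (p + 1) ∂(μp s ω) := by
          intro s ω
          have I := fun f : Vd d → ℝ => emp_integrable (h.mem s ω) f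
          have e2 : ∀ v : Vd d, ∫ vs, (1 + ‖v‖ ^ (p + 1) + ‖vs‖ ^ (p + 1)) ∂(μp s ω)
            = 1 + ‖v‖ ^ (p + 1) + ∫ v, ‖v‖ ^ (p + 1) ∂(μp s ω) := by
            intro v
            rw [integral_add (I _) (I _)]; simp
          simp only [e2]
          rw [integral_add (I _) (I _), integral_add (I _) (I _)]
          simp; ring
        simp only [e1]
        have e3 : ∀ ω, ∫ s in Ioc 0 T, (1 + 2 * ∫ v, ‖v‖ ^ (p + 1) ∂(μp s ω)) = T + 2 * ∫ s in Ioc 0 T, ∫ v, ‖v‖ ^ (p + 1) ∂(μp s ω) := by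
          intro ω
          rw [integral_add (integrable_const _) ((hI.1 ω).const_mul 2), integral_const_mul]
          simp [hT]
        simp only [e3]
        rw [integral_add (integrable_const _) (hI.2.const_mul 2), integral_const_mul]
        simp
      rw [e]
      linarith
    calc _ ≤ _ := h1
      _ ≤ c * (T + 2 * C) := by gcongr
      _ = _ := by rw [hc, hD2]; ring
  have sa := sum_a hd hB (P := P) (Fintype.piFinset fun _ : Fin d => Finset.Ico (-2 ^ j : ℤ) (2 ^ j))
    (fun z => cell j (k, z)) (shell k) (fun z => cell_meas _ _) (fun z v => (cell_01 _ _ v).1)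
    (fun z v => (cell_01 _ _ v).2) (shell_meas k) (shell_0 k) (shell_1 k) (shell_sum j k _) h hT
  have sb := sum_b hd hB (P := P) (Fintype.piFinset fun _ : Fin d => Finset.Ico (-2 ^ j : ℤ) (2 ^ j))
    (fun z => cell j (k, z)) (shell k) (fun z => cell_meas _ _) (fun z v => (cell_01 _ _ v).1)
    (fun z v => (cell_01 _ _ v).2) (shell_meas k) (shell_0 k) (shell_1 k) (shell_sum j k _) h T
  rw [zcard] at sa
  set X := ∑ z ∈ Fintype.piFinset fun _ : Fin d => Finset.Ico (-2 ^ j : ℤ) (2 ^ j),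
        ∫ ω, |Mt B (fun t => μp t ω) (cell j (k, z)) T| ∂P with hX
  rcases min_cases (sqrt ((2 ^ j) ^ d / N)) 1 with ⟨hmin, -⟩ | ⟨hmin, -⟩
  · rw [hmin]
    have h3 : X ≤ sqrt (2 ^ d * (4 * D2)) * (rr p ^ k * sqrt ((2 ^ j) ^ d / N)) := by
      refine le_of_sq_le_sq (sa.trans ?_) (by positivity)
      rw [mul_pow, mul_pow, Real.sq_sqrt (by positivity), Real.sq_sqrt (by positivity)]
      calc _ ≤ ((2 ^ d * (2 ^ j) ^ d : ℕ) : ℝ) * ((N:ℝ)⁻¹ * (4 * (D2 * rr p ^ (2 * k)))) := by gcongr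
        _ = _ := by push_cast; ring
    refine h3.trans ?_
    gcongr
    exact le_max_right _ _
  · rw [hmin, mul_one]
    have h4 : rr p ^ (2 * k) ≤ rr p ^ k := pow_le_pow_of_le_one hr.le hr1 (by omega)
    calc X ≤ (2 * D1 + D2) * rr p ^ (2 * k) := by
          have := hs T ⟨hT, le_rfl⟩; have := hs 0 ⟨le_rfl, hT⟩; linarith
      _ ≤ _ := by gcongr; exact le_max_left _ _
end
theorem emp_N_two {N : ℕ} {μ : Measure (Vd d)} (h : μ ∈ empiricalSphere d N) : 2 ≤ N := by
  have hN := emp_N_ne h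
  by_contra hc
  have h1 : N = 1 := by omega
  subst h1
  obtain ⟨⟨_, h1, h2⟩, x, rfl⟩ := h
  simp [integral_dirac] at h1 h2
  simp [h1] at h2
def rate (d N : ℕ) : ℝ := if 3 ≤ d then (N:ℝ) ^ (-(1:ℝ)/d) else (N:ℝ) ^ (-(1:ℝ)/2) * Real.log N
theorem rate_pos {N : ℕ} (hN : 2 ≤ N) : 0 < rate d N := by
  have : (1:ℝ) < N := by exact_mod_cast hN
  have := log_pos this
  unfold rate
  split_ifs <;> positivity
theorem half_eq (x : ℕ) : (x:ℝ) ^ (-(1:ℝ)/2) = (sqrt x)⁻¹ := by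
  rw [Real.sqrt_eq_rpow, neg_div, Real.rpow_neg (Nat.cast_nonneg x)]
theorem geo_le {r : ℝ} (h0 : 0 ≤ r) (h1 : r < 1) (n : ℕ) : ∑ i ∈ range n, r ^ i ≤ (1 - r)⁻¹ := by
  rw [← tsum_geometric_of_lt_one h0 h1]
  exact (summable_geometric_of_lt_one h0 h1).sum_le_tsum _ fun i _ => by positivity
theorem rate_sum (hd : 2 ≤ d) : ∃ C : ℝ, 0 ≤ C ∧ ∀ N : ℕ, 2 ≤ N → ∀ J : ℕ,
    ∑ j ∈ range (J + 1), (1 / 2 ^ j : ℝ) * min (sqrt ((2 ^ j) ^ d / N)) 1 ≤ C * rate d N := by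
  have split : ∀ (t : ℕ → ℝ), (∀ j, 0 ≤ t j) → ∀ L J : ℕ, ∑ j ∈ range (J + 1), t j ≤
      ∑ j ∈ range L, t j + ∑ i ∈ range (J + 1), t (L + i) := by
    intro t ht L J
    rw [← Finset.sum_range_add]
    exact Finset.sum_le_sum_of_subset_of_nonneg (Finset.range_mono (by omega)) fun j _ _ => ht j
  by_cases h3 : 3 ≤ d
  · set r := sqrt (1 / 2) with hr
    have hr0 : 0 ≤ r := sqrt_nonneg _
    have hr2 : r ^ 2 = 1 / 2 := Real.sq_sqrt (by norm_num)
    have hr1 : r < 1 := by nlinarith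
    have h1r : 0 < 1 - r := by linarith
    refine ⟨(1 - r)⁻¹ + 2, by positivity, fun N hN J => ?_⟩
    have hN1 : (1:ℝ) ≤ N := by exact_mod_cast (by omega : 1 ≤ N)
    have hN0 : (0:ℝ) < N := by linarith
    obtain ⟨x, hx1, hxd, hxr⟩ : ∃ x : ℝ, 1 ≤ x ∧ x ^ d = N ∧ rate d N = x⁻¹ := by
      refine ⟨(N:ℝ) ^ ((1:ℝ)/d), Real.one_le_rpow hN1 (by positivity), ?_, ?_⟩
      · rw [← Real.rpow_natCast, ← Real.rpow_mul hN0.le, one_div_mul_cancel (by positivity), Real.rpow_one]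
      · unfold rate; rw [if_pos h3, neg_div, Real.rpow_neg hN0.le]
    have hx0 : 0 < x := by linarith
    obtain ⟨L, hL1, hL2⟩ := exists_nat_pow_near hx1 (by norm_num : (1:ℝ) < 2)
    refine (split _ (fun j => by positivity) (L + 1) J).trans ?_
    rw [hxr, add_mul]
    gcongr
    · rw [← Finset.sum_range_reflect]
      refine le_trans ?_ (mul_le_mul_of_nonneg_right (geo_le hr0 hr1 (L + 1)) (by positivity))
      rw [Finset.sum_mul]
      refine sum_le_sum fun i hi => ?_
      rw [Finset.mem_range] at hi
      obtain ⟨j, rfl⟩ : ∃ j, L = i + j := ⟨L - i, by omega⟩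
      rw [show i + j + 1 - 1 - i = j by omega, ← hxd, ← div_pow]
      set y := (2:ℝ) ^ j / x with hy
      have hy0 : 0 < y := by positivity
      have hyi : y ≤ (1 / 2) ^ i := by
        rw [hy, div_le_iff₀ hx0, one_div, inv_pow, inv_mul_eq_div, le_div_iff₀ (by positivity)]
        calc (2:ℝ) ^ j * 2 ^ i = 2 ^ (i + j) := by ring
          _ ≤ x := hL1
      have hy1 : y ≤ 1 := hyi.trans (pow_le_one₀ (by norm_num) (by norm_num))
      have h2 : sqrt (y ^ d) ≤ y * r ^ i := by
        rw [Real.sqrt_le_left (by positivity)]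
        calc y ^ d ≤ y ^ 3 := pow_le_pow_of_le_one hy0.le hy1 h3
          _ = y ^ 2 * y := by ring
          _ ≤ y ^ 2 * (1 / 2) ^ i := by gcongr
          _ = (y * r ^ i) ^ 2 := by rw [← hr2]; ring
      calc 1 / 2 ^ j * min (sqrt (y ^ d)) 1 ≤ 1 / 2 ^ j * (y * r ^ i) := by
            gcongr; exact (min_le_left _ _).trans h2
        _ = r ^ i * x⁻¹ := by rw [hy]; field_simp
    · have := geo_le (by norm_num : (0:ℝ) ≤ 1 / 2) (by norm_num) (J + 1)
      refine le_trans ?_ (mul_le_mul_of_nonneg_right (this.trans (by norm_num)) (by positivity))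
      rw [Finset.sum_mul]
      refine sum_le_sum fun i hi => ?_
      calc (1 / 2 ^ (L + 1 + i) : ℝ) * min _ 1 ≤ 1 / 2 ^ (L + 1 + i) * 1 := by gcongr; exact min_le_right _ _
        _ = (1 / 2) ^ i * (2 ^ (L + 1))⁻¹ := by rw [pow_add, one_div_pow]; field_simp
        _ ≤ _ := by gcongr
  · have hd2 : d = 2 := by omega
    subst hd2
    have hl2 := log_pos (by norm_num : (1:ℝ) < 2)
    refine ⟨4 / Real.log 2, by positivity, fun N hN J => ?_⟩
    have hN1 : (1:ℝ) ≤ N := by exact_mod_cast (by omega : 1 ≤ N)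
    have hN0 : (0:ℝ) < N := by linarith
    have hl : Real.log 2 ≤ Real.log N := Real.log_le_log (by norm_num) (by exact_mod_cast hN)
    have hs0 : 0 < sqrt N := Real.sqrt_pos.2 hN0
    unfold rate
    rw [if_neg (by norm_num), half_eq]
    set L := Nat.log 2 N + 1 with hL
    have hL1 : sqrt N ≤ 2 ^ L := by
      have h1 : (N:ℝ) < 2 ^ L := by exact_mod_cast Nat.lt_pow_succ_log_self (by norm_num) N
      have h2 : sqrt N ≤ N := by
        rw [Real.sqrt_le_left hN0.le]; nlinarith
      linarith
    have hL2 : (L:ℝ) ≤ 2 * (Real.log N / Real.log 2) := by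
      have h1 := Real.natLog_le_logb N 2
      have h2 : 1 ≤ Real.log N / Real.log 2 := (one_le_div hl2).2 hl
      rw [Real.logb] at h1
      rw [hL]; push_cast at h1 ⊢; linarith
    refine (split _ (fun j => by positivity) L J).trans ?_
    have e1 : ∑ j ∈ range L, (1 / 2 ^ j : ℝ) * min (sqrt ((2 ^ j) ^ 2 / N)) 1 ≤ L * (sqrt N)⁻¹ := by
      rw [← nsmul_eq_mul, ← Finset.card_range L, ← Finset.sum_const, Finset.card_range]
      refine sum_le_sum fun j _ => ?_
      rw [Real.sqrt_div (by positivity), Real.sqrt_sq (by positivity)]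
      calc (1 / 2 ^ j : ℝ) * min (2 ^ j / sqrt N) 1 ≤ 1 / 2 ^ j * (2 ^ j / sqrt N) := by
            gcongr; exact min_le_left _ _
        _ = _ := by field_simp
    have e2 : ∑ i ∈ range (J + 1), (1 / 2 ^ (L + i) : ℝ) * min (sqrt ((2 ^ (L + i)) ^ 2 / N)) 1 ≤ 2 * (sqrt N)⁻¹ := by
      have := geo_le (by norm_num : (0:ℝ) ≤ 1 / 2) (by norm_num) (J + 1)
      refine le_trans ?_ (mul_le_mul_of_nonneg_right (this.trans (by norm_num)) (by positivity))
      rw [Finset.sum_mul]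
      refine sum_le_sum fun i hi => ?_
      calc (1 / 2 ^ (L + i) : ℝ) * min _ 1 ≤ 1 / 2 ^ (L + i) * 1 := by gcongr; exact min_le_right _ _
        _ = (1 / 2) ^ i * (2 ^ L)⁻¹ := by rw [pow_add, one_div_pow]; field_simp
        _ ≤ _ := by gcongr
    have h2 : 1 ≤ Real.log N / Real.log 2 := (one_le_div hl2).2 hl
    calc _ ≤ L * (sqrt N)⁻¹ + 2 * (sqrt N)⁻¹ := add_le_add e1 e2
      _ = (L + 2) * (sqrt N)⁻¹ := by ring
      _ ≤ (4 * (Real.log N / Real.log 2)) * (sqrt N)⁻¹ := by gcongr; linarith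
      _ = _ := by field_simp
theorem rate_mono (d : ℕ) : ∃ C : ℝ, 0 ≤ C ∧ ∀ N N' : ℕ, 2 ≤ N → N ≤ N' → rate d N' ≤ C * rate d N := by
  have hl2 := log_pos (by norm_num : (1:ℝ) < 2)
  refine ⟨1 + 2 / Real.log 2, by positivity, fun N N' hN hNN => ?_⟩
  have hp := rate_pos (d := d) hN
  have hN1 : (2:ℝ) ≤ N := by exact_mod_cast hN
  have hNN1 : (N:ℝ) ≤ N' := by exact_mod_cast hNN
  have hN0 : (0:ℝ) < N := by linarith
  have hN0' : (0:ℝ) < N' := by linarith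
  have hl : Real.log 2 ≤ Real.log N := Real.log_le_log (by norm_num) hN1
  unfold rate at *
  split_ifs at * with h3
  · refine le_trans ?_ (le_mul_of_one_le_left hp.le (by simp; positivity))
    refine Real.rpow_le_rpow_of_nonpos hN0 hNN1 ?_
    rw [neg_div]; simp
  · rw [half_eq, half_eq]
    have hs : 0 < sqrt N := Real.sqrt_pos.2 hN0
    have hs' : 0 < sqrt N' := Real.sqrt_pos.2 hN0'
    have hss : sqrt N ≤ sqrt N' := Real.sqrt_le_sqrt hNN1
    have key : Real.log N' ≤ Real.log N + 2 * (sqrt N' / sqrt N) := by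
      have h1 : Real.log (sqrt N' / sqrt N) ≤ sqrt N' / sqrt N :=
        Real.log_le_self (by positivity)
      rw [Real.log_div hs'.ne' hs.ne', Real.log_sqrt hN0'.le, Real.log_sqrt hN0.le] at h1
      linarith
    calc (sqrt N')⁻¹ * Real.log N' ≤ (sqrt N')⁻¹ * (Real.log N + 2 * (sqrt N' / sqrt N)) := by gcongr
      _ = (sqrt N')⁻¹ * Real.log N + 2 * (sqrt N)⁻¹ := by field_simp
      _ ≤ (sqrt N)⁻¹ * Real.log N + (2 * (Real.log N / Real.log 2)) * (sqrt N)⁻¹ := by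
          gcongr
          have := (one_le_div hl2).2 hl
          linarith
      _ = _ := by field_simp
theorem dyadic_seq {t T : ℝ} (ht : t ∈ Icc 0 T) : ∃ k : ℕ → ℕ, (∀ n, k n ≤ 2 ^ n) ∧
    Tendsto (fun n => (k n : ℝ) * T / 2 ^ n) atTop (nhdsWithin t (Ici t)) := by
  rcases eq_or_lt_of_le (ht.1.trans ht.2) with h0 | h0
  · refine ⟨fun _ => 0, fun n => by positivity, ?_⟩
    have : t = 0 := le_antisymm (ht.2.trans h0.ge) ht.1
    simp [this]
    exact tendsto_nhdsWithin_iff.2 ⟨tendsto_const_nhds, by simp⟩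
  · refine ⟨fun n => ⌈t * 2 ^ n / T⌉₊, fun n => ?_, ?_⟩
    · rw [Nat.ceil_le, div_le_iff₀ h0]
      push_cast
      nlinarith [ht.2, (by positivity : (0:ℝ) < 2 ^ n)]
    · have hle : ∀ n : ℕ, t ≤ (⌈t * 2 ^ n / T⌉₊ : ℝ) * T / 2 ^ n := by
        intro n
        rw [le_div_iff₀ (by positivity), ← div_le_iff₀ h0]
        exact Nat.le_ceil _
      rw [tendsto_nhdsWithin_iff]
      refine ⟨?_, Eventually.of_forall hle⟩
      refine tendsto_of_tendsto_of_tendsto_of_le_of_le (g := fun _ => t) (h := fun n : ℕ => t + T * (1 / 2) ^ n)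
        tendsto_const_nhds ?_ hle fun n => ?_
      · have := (tendsto_pow_atTop_nhds_zero_of_lt_one (by norm_num : (0:ℝ) ≤ 1 / 2) (by norm_num)).const_mul T
        simpa using this.const_add t
      · have h1 := (Nat.ceil_lt_add_one (a := t * 2 ^ n / T) (by have := ht.1; positivity)).le
        dsimp only
        calc (⌈t * 2 ^ n / T⌉₊ : ℝ) * T / 2 ^ n ≤ (t * 2 ^ n / T + 1) * T / 2 ^ n := by gcongr
          _ = _ := by rw [one_div_pow]; field_simp
section
variable {B : Vd d → Measure (Vd d)} (hd : 2 ≤ d) (hB : IsCollisionKernel B)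
include hd hB
theorem path_meas {Ω : Type*} [m : MeasurableSpace Ω] {P : Measure Ω} {𝓕 : Filtration ℝ m} {N : ℕ}
    {μp : ℝ → Ω → Measure (Vd d)} (h : IsKacProcess B N P 𝓕 μp) (ω : Ω) : Measurable fun t => μp t ω :=
  (proc_joint h).comp measurable_prodMk_right
theorem chain {p : ℝ} (hp : 8 < p) {lam T : ℝ} (hlam : 0 ≤ lam) (hT : 0 ≤ T) :
    ∃ C : ℝ, 0 ≤ C ∧ ∀ (Ω : Type) (m : MeasurableSpace Ω) (P : Measure Ω),
      IsProbabilityMeasure P → ∀ (𝓕 : Filtration ℝ m) (N : ℕ) (μp : ℝ → Ω → Measure (Vd d)),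
      IsKacProcess B N P 𝓕 μp → (∀ ω, momentL p (μp 0 ω) ≤ ENNReal.ofReal lam) →
      ∀ a > 0, P {ω | ∃ f, CA 3 f ∧ ∃ t ∈ Icc 0 T, a < |Mt B (fun t => μp t ω) f t|} ≤
        ENNReal.ofReal (C * rate d N / a) := by
  obtain ⟨C0, hC0, hcell⟩ := cellsum hd hB (by linarith : 2 < p) hlam hT
  obtain ⟨C1, hC1, hrate⟩ := rate_sum hd
  have hr := rr_pos p
  have hq : 16 * rr p < 1 := by
    have : rr p < 2 ^ (-(4:ℝ)) := by
      unfold rr; exact Real.rpow_lt_rpow_of_exponent_lt (by norm_num) (by linarith)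
    have h2 : (2:ℝ) ^ (-(4:ℝ)) = 1 / 16 := by
      rw [Real.rpow_neg (by norm_num), show (4:ℝ) = ((4:ℕ):ℝ) by norm_num, Real.rpow_natCast]; norm_num
    rw [h2] at this; linarith
  have hDD : 0 < DD d := by unfold DD; positivity
  have h1q : 0 < 1 - 16 * rr p := by linarith
  refine ⟨2 * (DD d * C0 * (1 - 16 * rr p)⁻¹ * C1), by positivity, ?_⟩
  intro Ω m P hP 𝓕 N μp h h0 a ha
  obtain ⟨ω0⟩ : Nonempty Ω := by
    by_contra hc
    rw [not_nonempty_iff] at hc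
    have := hP.measure_univ
    rw [Set.univ_eq_empty_iff.2 hc] at this
    simp at this
  have hN := emp_N_two (h.mem 0 ω0)
  obtain ⟨J, hJ⟩ := pow_unbounded_of_one_lt (DD d * 2 ^ (4 * N) * (2 + 8 * N * T) / (a / 2)) (by norm_num : (1:ℝ) < 2)
  rw [div_lt_iff₀ (by positivity)] at hJ
  set s := (range (J + 1)).sigma (fun j => kset d j N) with hs
  let c : ((_ : ℕ) × (ℕ × (Fin d → ℤ))) → ℝ := fun i => DD d * (2 ^ (4 * i.2.1) / 2 ^ i.1)
  let Z : ((_ : ℕ) × (ℕ × (Fin d → ℤ))) → ℝ → Ω → ℝ := fun i t ω => (∫ v, cell i.1 i.2 v ∂(μp t ω)) -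
      ∫ s in Ioc (0:ℝ) t, QInt B (cell i.1 i.2) (μp s ω) (μp s ω)
  have hZM : ∀ i t ω, Z i t ω - Z i 0 ω = Mt B (fun t => μp t ω) (cell i.1 i.2) t := by
    intro i t ω
    simp only [Z, Mt, Set.Ioc_self, Measure.restrict_empty, integral_zero_measure]
    ring
  have hZ : ∀ i ∈ s, Martingale (Z i) 𝓕 P := fun i _ =>
    kac_mart hd hB h (cell_meas i.1 i.2) (fun v => (cell_01 i.1 i.2 v).1) (fun v => (cell_01 i.1 i.2 v).2)
  have hmax := max_dyadic s c (fun i => by simp only [c]; positivity) Z hZ hT (half_pos ha)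
  simp only [hZM] at hmax
  have hE : ∫ ω, ∑ i ∈ s, c i * |Mt B (fun t => μp t ω) (cell i.1 i.2) T| ∂P ≤
      DD d * C0 * (1 - 16 * rr p)⁻¹ * C1 * rate d N := by
    rw [integral_finsetSum _ fun i _ => ((Mt_integrable hd hB h (cell_meas i.1 i.2) (fun v => (cell_01 i.1 i.2 v).1)
      (fun v => (cell_01 i.1 i.2 v).2) T).abs.const_mul _)]
    simp only [integral_const_mul]
    rw [hs, Finset.sum_sigma]
    simp only [kset, Finset.sum_product, c]
    calc _ ≤ ∑ j ∈ range (J + 1), DD d * C0 * (1 - 16 * rr p)⁻¹ *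
          (1 / 2 ^ j * min (sqrt ((2 ^ j) ^ d / N)) 1) := by
          refine sum_le_sum fun j _ => ?_
          calc _ ≤ ∑ k ∈ range (N + 1), (DD d * C0 * (1 / 2 ^ j * min (sqrt ((2 ^ j) ^ d / N)) 1)) * (16 * rr p) ^ k := by
                refine sum_le_sum fun k _ => ?_
                rw [← Finset.mul_sum]
                refine (mul_le_mul_of_nonneg_left (hcell Ω m P hP 𝓕 N μp h h0 j k) (by positivity)).trans_eq ?_
                rw [mul_pow, pow_mul]; norm_num; ring
            _ ≤ (DD d * C0 * (1 / 2 ^ j * min (sqrt ((2 ^ j) ^ d / N)) 1)) * (1 - 16 * rr p)⁻¹ := by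
                rw [← Finset.mul_sum]
                exact mul_le_mul_of_nonneg_left (geo_le (by positivity) hq _) (by positivity)
            _ = _ := by ring
      _ = DD d * C0 * (1 - 16 * rr p)⁻¹ * ∑ j ∈ range (J + 1), (1 / 2 ^ j * min (sqrt ((2 ^ j) ^ d / N)) 1) := by
          rw [Finset.mul_sum]
      _ ≤ DD d * C0 * (1 - 16 * rr p)⁻¹ * (C1 * rate d N) :=
          mul_le_mul_of_nonneg_left (hrate N hN J) (by positivity)
      _ = _ := by ring
  refine (measure_mono ?_).trans (hmax.trans (ENNReal.ofReal_le_ofReal ?_))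
  · rintro ω ⟨f, hf, t, ht, hlt⟩
    by_contra hc
    simp only [mem_ofPred_eq, not_exists, not_and, not_le] at hc
    obtain ⟨k, hk, hlim⟩ := dyadic_seq ht
    have hm := path_meas hd hB h ω
    have hrc := Mt_rc hd hB hm (fun s => h.mem s ω) hf (fun K hK g hg t => proc_rc h hK hg ω t) ht.1
    have h2 := (hrc.tendsto.comp hlim).abs
    refine absurd (le_of_tendsto h2 (Eventually.of_forall fun n => ?_)) (not_le.2 hlt)
    have hτ0 : 0 ≤ (k n : ℝ) * T / 2 ^ n := by positivity
    have hτ1 : (k n : ℝ) * T / 2 ^ n ≤ T := by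
      rw [div_le_iff₀ (by positivity), mul_comm]
      have : (k n : ℝ) ≤ 2 ^ n := by exact_mod_cast hk n
      gcongr
    have h3 := chain_det hd hB hm (fun s => h.mem s ω) hf J hτ0
    have h4 := hc n (k n) (hk n)
    have h5 : DD d * (2 ^ (4 * N) / 2 ^ J) * (2 + 8 * N * ((k n : ℝ) * T / 2 ^ n)) ≤ a / 2 := by
      calc _ ≤ DD d * (2 ^ (4 * N) / 2 ^ J) * (2 + 8 * N * T) := by gcongr
        _ = (DD d * 2 ^ (4 * N) * (2 + 8 * N * T)) / 2 ^ J := by ring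
        _ ≤ a / 2 := by rw [div_le_iff₀ (by positivity)]; linarith
    simp only [Function.comp]
    simp only [c] at h4
    linarith
  · rw [div_le_div_iff₀ (by positivity) ha]
    nlinarith
end
theorem poly1 {a b n : ℝ} (ha : 0 ≤ a) (hb : 0 ≤ b) (hn : n ≤ a + b) :
    n * (1 + b ^ 2) ≤ 4 * ((1 + a ^ 2) * (1 + b ^ 3)) := by
  have h1 : (1 + b) * (1 + b ^ 2) ≤ 2 * (1 + b ^ 3) := by
    nlinarith [mul_nonneg (sq_nonneg (1 - b)) (by linarith : 0 ≤ 1 + b)]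
  have h2 : 1 + a ≤ 2 * (1 + a ^ 2) := by nlinarith [sq_nonneg (a - 1)]
  calc n * (1 + b ^ 2) ≤ ((1 + a) * (1 + b)) * (1 + b ^ 2) := by gcongr; nlinarith [mul_nonneg ha hb]
    _ = (1 + a) * ((1 + b) * (1 + b ^ 2)) := by ring
    _ ≤ (2 * (1 + a ^ 2)) * (2 * (1 + b ^ 3)) := by gcongr
    _ = _ := by ring
theorem poly2 {b : ℝ} (hb : 0 ≤ b) : b ^ 2 ≤ 1 + b ^ 3 := by
  nlinarith [mul_nonneg (sq_nonneg (1 - b)) (by linarith : 0 ≤ 1 + b)]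
theorem poly2' {b : ℝ} (hb : 0 ≤ b) : b ≤ 1 + b ^ 3 := by
  nlinarith [mul_nonneg (sq_nonneg (1 - b)) (by linarith : 0 ≤ 1 + b), sq_nonneg (b - 1)]
theorem poly3 {a a' b n : ℝ} (ha : 0 ≤ a) (ha' : 0 ≤ a') (hb : 0 ≤ b) (hn : n ≤ a + b) :
    n * (1 + a ^ 2 + a' ^ 2) ≤ 8 * ((1 + a ^ 3 + a' ^ 3) * (1 + b ^ 3)) := by
  have h1 : (1 + a) * (1 + a ^ 2 + a' ^ 2) ≤ 4 * (1 + a ^ 3 + a' ^ 3) := by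
    have : a * a' ^ 2 ≤ a ^ 3 + a' ^ 3 := by
      rcases le_total a a' with h | h
      · nlinarith [pow_nonneg ha 3, mul_le_mul_of_nonneg_right h (sq_nonneg a')]
      · nlinarith [pow_nonneg ha' 3, mul_le_mul_of_nonneg_left (pow_le_pow_left₀ ha' h 2) ha]
    nlinarith [poly2 ha, poly2' ha, poly2 ha', pow_nonneg ha 3, pow_nonneg ha' 3]
  calc n * (1 + a ^ 2 + a' ^ 2) ≤ ((1 + a) * (1 + b)) * (1 + a ^ 2 + a' ^ 2) := by
        gcongr; nlinarith [mul_nonneg ha hb]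
    _ = ((1 + a) * (1 + a ^ 2 + a' ^ 2)) * (1 + b) := by ring
    _ ≤ (4 * (1 + a ^ 3 + a' ^ 3)) * (2 * (1 + b ^ 3)) := by
        gcongr; linarith [poly2' hb, pow_nonneg hb 3]
    _ = _ := by ring
section
variable {B : Vd d → Measure (Vd d)} (hd : 2 ≤ d) (hB : IsCollisionKernel B)
  {κ : ℝ} (hBL : IsLipschitzKernel B κ)
def gn (f : Vd d → ℝ) (v vs σ : Vd d) : ℝ := f (postV v vs σ) + f (postVs v vs σ) - f vs
theorem gn_meas {f : Vd d → ℝ} (hf : Measurable f) (v vs : Vd d) : Measurable fun σ => gn f v vs σ := by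
  unfold gn
  exact ((hf.comp (postV_meas v vs)).add (hf.comp (postVs_meas v vs))).sub measurable_const
theorem gn_le {f : Vd d → ℝ} (hf : CA 2 f) (v vs σ : Vd d) (hσ : ‖σ‖ = 1) :
    |gn f v vs σ| ≤ 3 + ‖v‖ ^ 2 + 2 * ‖vs‖ ^ 2 := by
  have h1 := hf.1 (postV v vs σ)
  have h2 := hf.1 (postVs v vs σ)
  have h3 := hf.1 vs
  have h4 := post_energy v vs σ hσ
  unfold gn
  rw [abs_le] at *
  constructor <;> linarith [h1.1, h1.2, h2.1, h2.2, h3.1, h3.2]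
theorem gn_lip {f : Vd d → ℝ} (hf : CA 2 f) (v w vs σ : Vd d) (hσ : ‖σ‖ = 1) :
    |gn f v vs σ - gn f w vs σ| ≤ ‖v - w‖ * (2 + ‖v‖ ^ 2 + ‖w‖ ^ 2 + 2 * ‖vs‖ ^ 2) := by
  have h1 := (hf.2 (postV v vs σ) (postV w vs σ)).trans
    (mul_le_mul_of_nonneg_right (postV_lip v w vs σ hσ) (by positivity))
  have h2 := (hf.2 (postVs v vs σ) (postVs w vs σ)).trans
    (mul_le_mul_of_nonneg_right (postVs_lip v w vs σ hσ) (by positivity))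
  have h4 := post_energy v vs σ hσ
  have h5 := post_energy w vs σ hσ
  have e : ‖v - w‖ * (1 + ‖postV v vs σ‖ ^ 2 + ‖postV w vs σ‖ ^ 2) + ‖v - w‖ * (1 + ‖postVs v vs σ‖ ^ 2 + ‖postVs w vs σ‖ ^ 2)
      = ‖v - w‖ * (2 + ‖v‖ ^ 2 + ‖w‖ ^ 2 + 2 * ‖vs‖ ^ 2) := by
    rw [← mul_add]; congr 1; linarith
  rw [← e]
  unfold gn
  refine le_trans (le_of_eq (congrArg _ ?_)) ((abs_add_le _ _).trans (add_le_add h1 h2))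
  ring
include hd hB
theorem kf_gn {f : Vd d → ℝ} (hf : CA 2 f) (v vs : Vd d) :
    kf B f v vs = (∫ σ, gn f v vs σ ∂(B (v - vs))) - ‖v - vs‖ * f v := by
  have := B_fin hd hB (v - vs)
  unfold kf
  rw [show (fun σ => dlt f v vs σ) = fun σ => gn f v vs σ - f v from by
    funext σ; unfold dlt gn; ring]
  rw [integral_sub (B_integrable hd hB _ (gn_meas (CA_meas hf) v vs) fun σ hσ => gn_le hf v vs σ hσ) (integrable_const _)]
  rw [integral_const, B_real_univ hd hB, smul_eq_mul]
theorem kf_pt {f : Vd d → ℝ} (hf : CA 2 f) {h θ : ℝ} (hh : 0 ≤ h) (v vs : Vd d) (hθ : h * ‖v - vs‖ ≤ θ) :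
    |θ * f v + h * kf B f v vs| ≤ (1 + ‖v‖ ^ 2) * (θ + h * (8 * (1 + ‖vs‖ ^ 3))) := by
  rw [kf_gn hd hB hf]
  have h1 := B_int_le hd hB (v - vs) fun σ hσ => gn_le hf v vs σ hσ
  have h2 := poly1 (norm_nonneg v) (norm_nonneg vs) (norm_sub_le v vs)
  have e : θ * f v + h * ((∫ σ, gn f v vs σ ∂(B (v - vs))) - ‖v - vs‖ * f v) =
    (θ - h * ‖v - vs‖) * f v + h * ∫ σ, gn f v vs σ ∂(B (v - vs)) := by ring
  rw [e]
  calc _ ≤ |(θ - h * ‖v - vs‖) * f v| + |h * ∫ σ, gn f v vs σ ∂(B (v - vs))| := abs_add_le _ _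
    _ ≤ (θ - h * ‖v - vs‖) * (1 + ‖v‖ ^ 2) + h * ((3 + ‖v‖ ^ 2 + 2 * ‖vs‖ ^ 2) * ‖v - vs‖) := by
        rw [abs_mul, abs_mul, abs_of_nonneg hh, abs_of_nonneg (sub_nonneg.2 hθ)]
        exact add_le_add (mul_le_mul_of_nonneg_left (hf.1 v) (sub_nonneg.2 hθ)) (mul_le_mul_of_nonneg_left h1 hh)
    _ = θ * (1 + ‖v‖ ^ 2) + h * (2 * (‖v - vs‖ * (1 + ‖vs‖ ^ 2))) := by ring
    _ ≤ θ * (1 + ‖v‖ ^ 2) + h * (2 * (4 * ((1 + ‖v‖ ^ 2) * (1 + ‖vs‖ ^ 3)))) := by gcongr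
    _ = _ := by ring
include hBL
theorem kf_lip {f : Vd d → ℝ} (hf : CA 2 f) {h θ : ℝ} (hh : 0 ≤ h) (v w vs : Vd d) (hθ : h * ‖v - vs‖ ≤ θ) :
    |θ * (f v - f w) + h * (kf B f v vs - kf B f w vs)| ≤
      ‖v - w‖ * (1 + ‖v‖ ^ 2 + ‖w‖ ^ 2) * (θ + h * ((8 + 8 * κ) * (1 + ‖vs‖ ^ 3))) := by
  have hκ := hBL.1
  set φ : Vd d → ℝ := fun σ => gn f w vs σ - f w with hφ
  have hφm : Measurable φ := (gn_meas (CA_meas hf) w vs).sub measurable_const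
  have hφb : ∀ σ, ‖σ‖ = 1 → |φ σ| ≤ 4 + 2 * ‖w‖ ^ 2 + 2 * ‖vs‖ ^ 2 := by
    intro σ hσ
    have h1 := gn_le hf w vs σ hσ
    have h2 := hf.1 w
    rw [hφ]
    rw [abs_le] at *
    constructor <;> linarith [h1.1, h1.2, h2.1, h2.2]
  have iv := B_integrable hd hB (v - vs) (gn_meas (CA_meas hf) v vs) fun σ hσ => gn_le hf v vs σ hσ
  have iw := B_integrable hd hB (v - vs) (gn_meas (CA_meas hf) w vs) fun σ hσ => gn_le hf w vs σ hσ
  have := B_fin hd hB (v - vs)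
  have := B_fin hd hB (w - vs)
  have e1 : kf B f v vs - kf B f w vs = (∫ σ, (gn f v vs σ - gn f w vs σ) ∂(B (v - vs))) - ‖v - vs‖ * (f v - f w) +
      ((∫ σ, φ σ ∂(B (v - vs))) - ∫ σ, φ σ ∂(B (w - vs))) := by
    have iw' := B_integrable hd hB (w - vs) (gn_meas (CA_meas hf) w vs) fun σ hσ => gn_le hf w vs σ hσ
    rw [kf_gn hd hB hf, kf_gn hd hB hf, integral_sub iv iw, hφ, integral_sub iw (integrable_const _),
      integral_sub iw' (integrable_const _), integral_const, integral_const, B_real_univ hd hB, B_real_univ hd hB]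
    simp only [smul_eq_mul]
    ring
  have h1 := B_int_le hd hB (v - vs) fun σ hσ => gn_lip hf v w vs σ hσ
  have h3 := B_tv hd hB hBL (v - vs) (w - vs) hφm (by positivity) hφb
  rw [show v - vs - (w - vs) = v - w by abel] at h3
  have h2 := poly1 (norm_nonneg v) (norm_nonneg vs) (norm_sub_le v vs)
  set A := ∫ σ, (gn f v vs σ - gn f w vs σ) ∂(B (v - vs))
  set A' := (∫ σ, φ σ ∂(B (v - vs))) - ∫ σ, φ σ ∂(B (w - vs))
  have e : θ * (f v - f w) + h * (kf B f v vs - kf B f w vs) =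
    (θ - h * ‖v - vs‖) * (f v - f w) + h * A + h * A' := by rw [e1]; ring
  rw [e]
  have hp2 := poly2 (norm_nonneg vs)
  have hn := norm_nonneg (v - w)
  calc _ ≤ |(θ - h * ‖v - vs‖) * (f v - f w)| + |h * A| + |h * A'| := abs_add_three _ _ _
    _ ≤ (θ - h * ‖v - vs‖) * (‖v - w‖ * (1 + ‖v‖ ^ 2 + ‖w‖ ^ 2))
        + h * (‖v - w‖ * (2 + ‖v‖ ^ 2 + ‖w‖ ^ 2 + 2 * ‖vs‖ ^ 2) * ‖v - vs‖)
        + h * ((4 + 2 * ‖w‖ ^ 2 + 2 * ‖vs‖ ^ 2) * (κ * ‖v - w‖)) := by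
        rw [abs_mul, abs_mul, abs_mul, abs_of_nonneg hh, abs_of_nonneg (sub_nonneg.2 hθ)]
        exact add_le_add (add_le_add (mul_le_mul_of_nonneg_left (hf.2 v w) (sub_nonneg.2 hθ))
          (mul_le_mul_of_nonneg_left h1 hh)) (mul_le_mul_of_nonneg_left h3 hh)
    _ = ‖v - w‖ * (θ * (1 + ‖v‖ ^ 2 + ‖w‖ ^ 2) + h * (‖v - vs‖ * (1 + 2 * ‖vs‖ ^ 2))
        + h * (κ * (4 + 2 * ‖w‖ ^ 2 + 2 * ‖vs‖ ^ 2))) := by ring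
    _ ≤ ‖v - w‖ * (θ * (1 + ‖v‖ ^ 2 + ‖w‖ ^ 2) + h * (8 * ((1 + ‖v‖ ^ 2 + ‖w‖ ^ 2) * (1 + ‖vs‖ ^ 3)))
        + h * (κ * (8 * ((1 + ‖v‖ ^ 2 + ‖w‖ ^ 2) * (1 + ‖vs‖ ^ 3))))) := by
        have hb3 := pow_nonneg (norm_nonneg vs) 3
        have g1 : ‖v - vs‖ * (1 + 2 * ‖vs‖ ^ 2) ≤ 8 * ((1 + ‖v‖ ^ 2 + ‖w‖ ^ 2) * (1 + ‖vs‖ ^ 3)) := by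
          nlinarith [norm_nonneg (v - vs), mul_nonneg (sq_nonneg ‖w‖) (by linarith : 0 ≤ 1 + ‖vs‖ ^ 3)]
        have g2 : 4 + 2 * ‖w‖ ^ 2 + 2 * ‖vs‖ ^ 2 ≤ 8 * ((1 + ‖v‖ ^ 2 + ‖w‖ ^ 2) * (1 + ‖vs‖ ^ 3)) := by
          nlinarith [mul_nonneg (sq_nonneg ‖w‖) hb3, mul_nonneg (sq_nonneg ‖v‖) hb3, sq_nonneg ‖v‖, sq_nonneg ‖w‖]
        gcongr
    _ = _ := by ring
theorem kf_c3 {f : Vd d → ℝ} (hf : CA 2 f) (v w vs : Vd d) :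
    |kf B f v vs - kf B f w vs| ≤ ‖v - w‖ * (1 + ‖v‖ ^ 3 + ‖w‖ ^ 3) * ((40 + 24 * κ) * (1 + ‖vs‖ ^ 3)) := by
  have hκ := hBL.1
  have h1 := kf_lip hd hB hBL hf zero_le_one v w vs (one_mul ‖v - vs‖).le
  have h2 := hf.2 v w
  have h3 := poly3 (norm_nonneg v) (norm_nonneg w) (norm_nonneg vs) (norm_sub_le v vs)
  have h4 : 1 + ‖v‖ ^ 2 + ‖w‖ ^ 2 ≤ 3 * (1 + ‖v‖ ^ 3 + ‖w‖ ^ 3) := by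
    linarith [poly2 (norm_nonneg v), poly2 (norm_nonneg w), pow_nonneg (norm_nonneg v) 3, pow_nonneg (norm_nonneg w) 3]
  have hn := norm_nonneg (v - w)
  have hb3 := pow_nonneg (norm_nonneg vs) 3
  calc |kf B f v vs - kf B f w vs| = |(‖v - vs‖ * (f v - f w) + 1 * (kf B f v vs - kf B f w vs)) - ‖v - vs‖ * (f v - f w)| := by
        congr 1; ring
    _ ≤ ‖v - w‖ * (1 + ‖v‖ ^ 2 + ‖w‖ ^ 2) * (‖v - vs‖ + 1 * ((8 + 8 * κ) * (1 + ‖vs‖ ^ 3))) + ‖v - vs‖ * (‖v - w‖ * (1 + ‖v‖ ^ 2 + ‖w‖ ^ 2)) := by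
        refine (abs_sub _ _).trans (add_le_add h1 ?_)
        rw [abs_mul, abs_of_nonneg (norm_nonneg _)]
        gcongr
    _ = ‖v - w‖ * (2 * (‖v - vs‖ * (1 + ‖v‖ ^ 2 + ‖w‖ ^ 2)) + (1 + ‖v‖ ^ 2 + ‖w‖ ^ 2) * ((8 + 8 * κ) * (1 + ‖vs‖ ^ 3))) := by ring
    _ ≤ ‖v - w‖ * (2 * (8 * ((1 + ‖v‖ ^ 3 + ‖w‖ ^ 3) * (1 + ‖vs‖ ^ 3))) + (3 * (1 + ‖v‖ ^ 3 + ‖w‖ ^ 3)) * ((8 + 8 * κ) * (1 + ‖vs‖ ^ 3))) := by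
        gcongr
    _ = _ := by ring
theorem kf_b3 {f : Vd d → ℝ} (hf : CA 2 f) (v vs : Vd d) :
    |kf B f v vs| ≤ (1 + ‖v‖ ^ 3) * ((40 + 24 * κ) * (1 + ‖vs‖ ^ 3)) := by
  have hκ := hBL.1
  have h1 := kf_pt hd hB hf zero_le_one v vs (one_mul ‖v - vs‖).le
  have h2 := hf.1 v
  have h3 := poly3 (norm_nonneg v) le_rfl (norm_nonneg vs) (norm_sub_le v vs)
  have h4 : 1 + ‖v‖ ^ 2 ≤ 3 * (1 + ‖v‖ ^ 3) := by
    linarith [poly2 (norm_nonneg v), pow_nonneg (norm_nonneg v) 3]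
  simp only [ne_eq, OfNat.ofNat_ne_zero, not_false_eq_true, zero_pow, add_zero] at h3
  calc |kf B f v vs| = |(‖v - vs‖ * f v + 1 * kf B f v vs) - ‖v - vs‖ * f v| := by
        congr 1; ring
    _ ≤ (1 + ‖v‖ ^ 2) * (‖v - vs‖ + 1 * (8 * (1 + ‖vs‖ ^ 3))) + ‖v - vs‖ * (1 + ‖v‖ ^ 2) := by
        refine (abs_sub _ _).trans (add_le_add h1 ?_)
        rw [abs_mul, abs_of_nonneg (norm_nonneg _)]
        gcongr
    _ = 2 * (‖v - vs‖ * (1 + ‖v‖ ^ 2)) + (1 + ‖v‖ ^ 2) * (8 * (1 + ‖vs‖ ^ 3)) := by ring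
    _ ≤ 2 * (8 * ((1 + ‖v‖ ^ 3) * (1 + ‖vs‖ ^ 3))) + (3 * (1 + ‖v‖ ^ 3)) * (8 * (1 + ‖vs‖ ^ 3)) := by gcongr
    _ = (1 + ‖v‖ ^ 3) * ((40 + 24 * 0) * (1 + ‖vs‖ ^ 3)) := by ring
    _ ≤ _ := by gcongr; linarith
end
def m3 (μ μ' : Measure (Vd d)) : ℝ := 1 + ∫ v, ‖v‖ ^ 3 ∂μ + ∫ v, ‖v‖ ^ 3 ∂μ'
theorem m3_pos (μ μ' : Measure (Vd d)) : 1 ≤ m3 μ μ' := by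
  unfold m3
  have h1 : 0 ≤ ∫ v, ‖v‖ ^ 3 ∂μ := integral_nonneg fun v => by positivity
  have h2 : 0 ≤ ∫ v, ‖v‖ ^ 3 ∂μ' := integral_nonneg fun v => by positivity
  linarith
theorem ball_mem {N N' : ℕ} (hNN : N ≤ N') {v : Vd d} (hv : ‖v‖ ^ 2 ≤ (N:ℝ)) : ‖v‖ ≤ sqrt N' := by
  have : (N:ℝ) ≤ N' := by exact_mod_cast hNN
  exact Real.le_sqrt_of_sq_le (by linarith)
theorem m3_le {N N' : ℕ} (hNN : N ≤ N') {μ μ' : Measure (Vd d)} (h : μ ∈ empiricalSphere d N)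
    (h' : μ' ∈ empiricalSphere d N') : m3 μ μ' ≤ 1 + 2 * sqrt N' ^ 3 := by
  unfold m3
  have key : ∀ (M : ℕ) (ν : Measure (Vd d)), M ≤ N' → ν ∈ empiricalSphere d M → ∫ v, ‖v‖ ^ 3 ∂ν ≤ sqrt N' ^ 3 := by
    intro M ν hM hν
    refine (le_abs_self _).trans (emp_abs_le hν fun v hv => ?_)
    rw [abs_of_nonneg (by positivity)]
    gcongr
    exact ball_mem hM hv
  linarith [key N μ hNN h, key N' μ' le_rfl h']
theorem two_avg {N N' : ℕ} (hNN : N ≤ N') {μ μ' : Measure (Vd d)} (h : μ ∈ empiricalSphere d N)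
    (h' : μ' ∈ empiricalSphere d N') {F : Vd d → ℝ} {X θ c : ℝ} (hX : 0 ≤ X) (hc : 0 ≤ c)
    (hF : ∀ vs : Vd d, ‖vs‖ ≤ sqrt N' → |F vs| ≤ X * (θ + c * (1 + ‖vs‖ ^ 3))) :
    |∫ vs, F vs ∂μ + ∫ vs, F vs ∂μ'| ≤ X * (2 * θ + 2 * c * m3 μ μ') := by
  have key : ∀ (M : ℕ) (ν : Measure (Vd d)), M ≤ N' → ν ∈ empiricalSphere d M →
      |∫ vs, F vs ∂ν| ≤ X * (θ + c * (1 + ∫ v, ‖v‖ ^ 3 ∂ν)) := by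
    intro M ν hM hν
    have := emp_prob hν
    have e : ∫ vs, X * (θ + c * (1 + ‖vs‖ ^ 3)) ∂ν = X * (θ + c * (1 + ∫ v, ‖v‖ ^ 3 ∂ν)) := by
      rw [integral_const_mul, integral_add (emp_integrable hν _) (emp_integrable hν _), integral_const_mul,
        integral_add (emp_integrable hν _) (emp_integrable hν _)]
      simp
    rw [← e]
    exact (norm_integral_le_integral_norm F).trans (emp_le hν (ψ := fun v => ‖F v‖) fun v hv => hF v (ball_mem hM hv))
  refine (abs_add_le _ _).trans ((add_le_add (key N μ hNN h) (key N' μ' le_rfl h')).trans ?_)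
  rw [← mul_add]
  refine mul_le_mul_of_nonneg_left ?_ hX
  have := m3_pos μ μ'
  unfold m3 at *
  nlinarith
def Lk (B : Vd d → Measure (Vd d)) (f : Vd d → ℝ) (μ μ' : Measure (Vd d)) (v : Vd d) : ℝ :=
  ∫ vs, kf B f v vs ∂μ + ∫ vs, kf B f v vs ∂μ'
section
variable {B : Vd d → Measure (Vd d)} (hd : 2 ≤ d) (hB : IsCollisionKernel B)
  {κ : ℝ} (hBL : IsLipschitzKernel B κ) {N N' : ℕ} (hNN : N ≤ N')
section static
variable {μ μ' : Measure (Vd d)} (h : μ ∈ empiricalSphere d N) (h' : μ' ∈ empiricalSphere d N')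
  {f : Vd d → ℝ} (hf : CA 2 f)
include h h'
theorem Lk_aff (v : Vd d) (a : ℝ) : f v + a * Lk B f μ μ' v =
    ∫ vs, (1 / 2 * f v + a * kf B f v vs) ∂μ + ∫ vs, (1 / 2 * f v + a * kf B f v vs) ∂μ' := by
  have := emp_prob h
  have := emp_prob h'
  rw [integral_add (emp_integrable h _) (emp_integrable h _), integral_add (emp_integrable h' _) (emp_integrable h' _)]
  unfold Lk
  simp only [integral_const_mul, integral_const, probReal_univ, one_smul]
  ring
include hd hB hf
theorem Q_diff : QInt B f μ μ - QInt B f μ' μ' = ∫ v, Lk B f μ μ' v ∂μ - ∫ v, Lk B f μ μ' v ∂μ' := by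
  unfold Lk
  rw [integral_add (emp_integrable h _) (emp_integrable h _), integral_add (emp_integrable h' _) (emp_integrable h' _),
    QInt_eq, QInt_eq]
  have e : ∫ v, ∫ vs, kf B f v vs ∂μ' ∂μ = ∫ v, ∫ vs, kf B f v vs ∂μ ∂μ' := by
    obtain ⟨x, -, hx, -⟩ := emp_rep h
    obtain ⟨y, -, hy, -⟩ := emp_rep h'
    simp only [hx, hy, Finset.mul_sum]
    rw [Finset.sum_comm]
    refine Finset.sum_congr rfl fun j _ => Finset.sum_congr rfl fun i _ => ?_
    rw [kf_symm hd hB (CA_meas hf)]; ring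
  rw [e]; ring
include hBL hNN
theorem Lk_b3 (v : Vd d) : |Lk B f μ μ' v| ≤ 2 * (40 + 24 * κ) * m3 μ μ' * (1 + ‖v‖ ^ 3) := by
  have hκ := hBL.1
  have := two_avg hNN h h' (F := fun vs => kf B f v vs) (X := 1 + ‖v‖ ^ 3) (θ := 0) (c := 40 + 24 * κ) (by positivity) (by positivity)
    fun vs _ => by rw [zero_add]; exact kf_b3 hd hB hBL hf v vs
  unfold Lk
  linarith
theorem Lk_c3 (v w : Vd d) : |Lk B f μ μ' v - Lk B f μ μ' w| ≤
    2 * (40 + 24 * κ) * m3 μ μ' * (‖v - w‖ * (1 + ‖v‖ ^ 3 + ‖w‖ ^ 3)) := by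
  have hκ := hBL.1
  have := two_avg hNN h h' (F := fun vs => kf B f v vs - kf B f w vs) (X := ‖v - w‖ * (1 + ‖v‖ ^ 3 + ‖w‖ ^ 3))
    (θ := 0) (c := 40 + 24 * κ) (by positivity) (by positivity)
    fun vs _ => by rw [zero_add]; exact kf_c3 hd hB hBL hf v w vs
  rw [integral_sub (emp_integrable h _) (emp_integrable h _), integral_sub (emp_integrable h' _) (emp_integrable h' _)] at this
  unfold Lk
  rw [show ∀ a b c d : ℝ, a + b - (c + d) = a - c + (b - d) by intros; ring]
  linarith
omit hd hB hBL hNN h h' hf in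
theorem rate_small {a : ℝ} (ha : 0 ≤ a) (ha2 : a * (2 * sqrt N') ≤ 1 / 2) {v vs : Vd d} (hv : ‖v‖ ≤ sqrt N')
    (hvs : ‖vs‖ ≤ sqrt N') : a * ‖v - vs‖ ≤ 1 / 2 :=
  (mul_le_mul_of_nonneg_left ((norm_sub_le v vs).trans (by linarith)) ha).trans ha2
theorem FL_b {a : ℝ} (ha : 0 ≤ a) (ha2 : a * (2 * sqrt N') ≤ 1 / 2) {v : Vd d} (hv : ‖v‖ ≤ sqrt N') :
    |f v + a * Lk B f μ μ' v| ≤ (1 + a * (2 * (8 + 8 * κ)) * m3 μ μ') * (1 + ‖v‖ ^ 2) := by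
  have hκ := hBL.1
  rw [Lk_aff h h']
  have := two_avg hNN h h' (F := fun vs => 1 / 2 * f v + a * kf B f v vs) (X := 1 + ‖v‖ ^ 2) (θ := 1 / 2)
    (c := a * (8 + 8 * κ)) (by positivity) (by positivity) fun vs hvs => by
      refine (kf_pt hd hB hf ha v vs (rate_small ha ha2 hv hvs)).trans ?_
      rw [mul_assoc]
      gcongr
      linarith
  linarith
theorem FL_l {a : ℝ} (ha : 0 ≤ a) (ha2 : a * (2 * sqrt N') ≤ 1 / 2) {v w : Vd d} (hv : ‖v‖ ≤ sqrt N') :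
    |(f v + a * Lk B f μ μ' v) - (f w + a * Lk B f μ μ' w)| ≤
      (1 + a * (2 * (8 + 8 * κ)) * m3 μ μ') * (‖v - w‖ * (1 + ‖v‖ ^ 2 + ‖w‖ ^ 2)) := by
  have hκ := hBL.1
  rw [Lk_aff h h', Lk_aff h h']
  have := two_avg hNN h h' (F := fun vs => (1 / 2 * f v + a * kf B f v vs) - (1 / 2 * f w + a * kf B f w vs))
    (X := ‖v - w‖ * (1 + ‖v‖ ^ 2 + ‖w‖ ^ 2)) (θ := 1 / 2)
    (c := a * (8 + 8 * κ)) (by positivity) (by positivity) fun vs hvs => by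
      have h1 := kf_lip hd hB hBL hf ha v w vs (rate_small ha ha2 hv hvs)
      rw [show 1 / 2 * f v + a * kf B f v vs - (1 / 2 * f w + a * kf B f w vs) =
        1 / 2 * (f v - f w) + a * (kf B f v vs - kf B f w vs) by ring, mul_assoc a]
      exact h1
  rw [integral_sub (emp_integrable h _) (emp_integrable h _), integral_sub (emp_integrable h' _) (emp_integrable h' _)] at this
  rw [show ∀ a b c d : ℝ, a + b - (c + d) = a - c + (b - d) by intros; ring]
  linarith
end static
end
def Et (B : Vd d → Measure (Vd d)) (μ μ' : ℝ → Measure (Vd d)) (t : ℝ) (f : Vd d → ℝ) : ℝ :=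
  (∫ v, f v ∂(μ t) - ∫ v, f v ∂(μ' t)) - (Mt B μ f t - Mt B μ' f t)
section
variable {B : Vd d → Measure (Vd d)} (hd : 2 ≤ d) (hB : IsCollisionKernel B)
  {κ : ℝ} (hBL : IsLipschitzKernel B κ) {N N' : ℕ} (hNN : N ≤ N')
  {μ μ' : ℝ → Measure (Vd d)} (hμ : Measurable μ) (he : ∀ s, μ s ∈ empiricalSphere d N)
  (hμ' : Measurable μ') (he' : ∀ s, μ' s ∈ empiricalSphere d N')
include hd hB hμ he in
theorem Mt_lin {f g : Vd d → ℝ} (hf : Measurable f) (hg : Measurable g) {K : ℝ} (hfK : ∀ v, |f v| ≤ K)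
    (hgK : ∀ v, |g v| ≤ K) (a b t : ℝ) :
    Mt B μ (fun v => a * f v + b * g v) t = a * Mt B μ f t + b * Mt B μ g t := by
  have := Mt_sum hd hB hμ he Finset.univ ![a, b] ![f, g] (by
    intro i _; fin_cases i <;> simpa) (by intro i _; fin_cases i <;> exact ⟨K, by simpa⟩) t
  simp [Fin.sum_univ_two] at this
  exact this
include hd hB hμ he hμ' he'
theorem Et_lin {f g : Vd d → ℝ} (hf : Measurable f) (hg : Measurable g) {K : ℝ} (hfK : ∀ v, |f v| ≤ K)
    (hgK : ∀ v, |g v| ≤ K) (a b t : ℝ) :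
    Et B μ μ' t (fun v => a * f v + b * g v) = a * Et B μ μ' t f + b * Et B μ μ' t g := by
  unfold Et
  rw [Mt_lin hd hB hμ he hf hg hfK hgK, Mt_lin hd hB hμ' he' hf hg hfK hgK,
    integral_add (emp_integrable (he t) _) (emp_integrable (he t) _),
    integral_add (emp_integrable (he' t) _) (emp_integrable (he' t) _)]
  simp only [integral_const_mul]
  ring
include hNN
omit hμ hμ' in
theorem Et_congr {f g : Vd d → ℝ} (hfg : ∀ v, ‖v‖ ≤ sqrt N' → f v = g v) (t : ℝ) :
    Et B μ μ' t f = Et B μ μ' t g := by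
  unfold Et
  rw [Mt_congr hd hB he (fun v hv => hfg v (ball_mem hNN hv)), Mt_congr hd hB he' (fun v hv => hfg v (ball_mem le_rfl hv)),
    emp_congr (he t) (fun v hv => hfg v (ball_mem hNN hv)), emp_congr (he' t) (fun v hv => hfg v (ball_mem le_rfl hv))]
theorem Q_int {f : Vd d → ℝ} (hf : Measurable f) {K : ℝ} (hK : ∀ v, ‖v‖ ≤ sqrt N' → |f v| ≤ K) (t s : ℝ) :
    IntegrableOn (fun r => QInt B f (μ r) (μ r) - QInt B f (μ' r) (μ' r)) (Ioc t s) :=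
  (path_int hd hB hμ he hf (fun v hv => hK v (ball_mem hNN hv)) t s).sub'
    (path_int hd hB hμ' he' hf (fun v hv => hK v (ball_mem le_rfl hv)) t s)
theorem Et_incr {f : Vd d → ℝ} (hf : Measurable f) {K : ℝ} (hK : ∀ v, ‖v‖ ≤ sqrt N' → |f v| ≤ K) {t s : ℝ}
    (ht : 0 ≤ t) (hts : t ≤ s) : Et B μ μ' s f = Et B μ μ' t f +
      ∫ r in Ioc t s, (QInt B f (μ r) (μ r) - QInt B f (μ' r) (μ' r)) := by
  have a1 := fun x y => path_int hd hB hμ he hf (fun v hv => hK v (ball_mem hNN hv)) x y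
  have a2 := fun x y => path_int hd hB hμ' he' hf (fun v hv => hK v (ball_mem le_rfl hv)) x y
  have hu : Ioc 0 s = Ioc 0 t ∪ Ioc t s := (Set.Ioc_union_Ioc_eq_Ioc ht hts).symm
  have hdj : Disjoint (Ioc 0 t) (Ioc t s) := Set.Ioc_disjoint_Ioc_of_le le_rfl
  rw [integral_sub (a1 t s) (a2 t s)]
  unfold Et Mt
  rw [hu, setIntegral_union hdj measurableSet_Ioc (a1 0 t) (a1 t s),
    setIntegral_union hdj measurableSet_Ioc (a2 0 t) (a2 t s)]
  ring
omit hd hB in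
theorem m3_int (t s : ℝ) : IntegrableOn (fun r => m3 (μ r) (μ' r)) (Ioc t s) := by
  refine Integrable.of_bound (C := 1 + 2 * sqrt N' ^ 3) ?_ (Eventually.of_forall fun r => ?_)
  · unfold m3
    exact (((int_meas hμ (fun a => emp_prob (he a)) (by fun_prop)).const_add 1).add
      (int_meas hμ' (fun a => emp_prob (he' a)) (by fun_prop))).aestronglyMeasurable
  · have := m3_pos (μ r) (μ' r)
    rw [norm_of_nonneg (by linarith)]
    exact m3_le hNN (he r) (he' r)
include hBL
theorem step_pt {f : Vd d → ℝ} (hf : CA 2 f) {t s a D δ : ℝ} (ht : 0 ≤ t) (hts : t ≤ s) (hsa : s ≤ t + a) (ha : 0 < a)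
    (ha2 : a * (2 * sqrt N') ≤ 1 / 2) (hD : ∀ g, CA 2 g → Et B μ μ' t g ≤ D)
    (h1 : ∀ g, CA 3 g → |Mt B μ g s| ≤ δ) (h2 : ∀ g, CA 3 g → |Mt B μ' g s| ≤ δ) :
    QInt B f (μ s) (μ s) - QInt B f (μ' s) (μ' s) ≤
      ((D - Et B μ μ' t f) / a + a * (2 * (40 + 24 * κ) * (1 + 2 * sqrt N' ^ 3) * (16 * (1 + sqrt N' ^ 3) * N')))
      + (2 * (8 + 8 * κ) * D + 2 * (2 * (40 + 24 * κ)) * δ) * m3 (μ s) (μ' s) := by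
  have hκ := hBL.1
  have hN' : (0:ℝ) < N' := by have := emp_N_ne (he' 0); positivity
  have hR : 0 < sqrt N' := Real.sqrt_pos.2 hN'
  obtain ⟨π, p1, p2, p3, p4⟩ := proj_exists (d := d) hR
  set R := sqrt N' with hRdef
  have hm := m3_pos (μ s) (μ' s)
  have hmR := m3_le hNN (he s) (he' s)
  set mm := m3 (μ s) (μ' s) with hmm
  set c := 2 * (40 + 24 * κ) * mm with hc
  have hc0 : 0 < c := by positivity
  set L := Lk B f (μ s) (μ' s) with hL
  set g : Vd d → ℝ := fun v => c⁻¹ * L (π v) with hg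
  have hg3 : CA 3 g := CA_proj p1 p2 p3 hc0 (fun v _ => Lk_b3 hd hB hBL hNN (he s) (he' s) hf v)
    (fun v w _ _ => Lk_c3 hd hB hBL hNN (he s) (he' s) hf v w)
  have hgR : ∀ v, |g v| ≤ 1 + R ^ 3 := by
    intro v
    rw [hg]
    dsimp only
    rw [abs_mul, abs_of_pos (inv_pos.2 hc0), inv_mul_le_iff₀ hc0]
    refine (Lk_b3 hd hB hBL hNN (he s) (he' s) hf (π v)).trans ?_
    gcongr
    exact p1 v
  have hfp : CA 2 fun v => (1:ℝ)⁻¹ * f (π v) := CA_proj p1 p2 p3 one_pos (fun v _ => by rw [one_mul]; exact hf.1 v)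
    (fun v w _ _ => by rw [one_mul]; exact hf.2 v w)
  simp only [inv_one, one_mul] at hfp
  have hfR : ∀ v, |f (π v)| ≤ 1 + R ^ 2 := fun v => (hf.1 _).trans (by gcongr; exact p1 v)
  set c' := 1 + a * (2 * (8 + 8 * κ)) * mm with hc'
  have hc'0 : 0 < c' := by positivity
  have hF : CA 2 fun v => c'⁻¹ * (f (π v) + a * L (π v)) :=
    CA_proj (g := fun v => f v + a * L v) p1 p2 p3 hc'0 (fun v hv => FL_b hd hB hBL hNN (he s) (he' s) hf ha.le ha2 hv)
      (fun v w hv _ => FL_l hd hB hBL hNN (he s) (he' s) hf ha.le ha2 hv)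
  have hE1 : c' * Et B μ μ' t (fun v => c'⁻¹ * (f (π v) + a * L (π v))) = Et B μ μ' t f + a * c * Et B μ μ' t g := by
    have e : (fun v => c'⁻¹ * (f (π v) + a * L (π v))) = fun v => c'⁻¹ * (f (π v)) + (c'⁻¹ * a * c) * g v := by
      funext v; rw [hg]; field_simp
    rw [e, Et_lin hd hB hμ he hμ' he' (f := fun v => f (π v)) (CA_meas hfp) (CA_meas hg3) (K := 1 + R ^ 2 + (1 + R ^ 3))
      (fun v => (hfR v).trans (by linarith [pow_pos hR 3])) (fun v => (hgR v).trans (by linarith [pow_pos hR 2])),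
      Et_congr hd hB hNN he he' (f := fun v => f (π v)) (g := f) (fun v hv => by rw [p4 v hv])]
    field_simp
  have hE2 := mul_le_mul_of_nonneg_left (hD _ hF) hc'0.le
  rw [hE1] at hE2
  have hE3 : Et B μ μ' s g ≤ Et B μ μ' t g + a * (16 * (1 + R ^ 3) * N') := by
    rw [Et_incr hd hB hNN hμ he hμ' he' (CA_meas hg3) (fun v _ => hgR v) ht hts]
    have hb : ∀ r, ‖QInt B g (μ r) (μ r) - QInt B g (μ' r) (μ' r)‖ ≤ 16 * (1 + R ^ 3) * N' := by
      intro r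
      have b1 := QInt_abs hd hB (he r) (fun v _ => hgR v)
      have b2 := QInt_abs hd hB (he' r) (fun v _ => hgR v)
      have b3 : (N:ℝ) ≤ N' := by exact_mod_cast hNN
      have b4 : 8 * (1 + R ^ 3) * N ≤ 8 * (1 + R ^ 3) * N' := by gcongr
      refine (norm_sub_le _ _).trans ?_
      rw [norm_eq_abs, norm_eq_abs]
      linarith
    have := norm_setIntegral_le_of_norm_le_const (μ := volume) (s := Ioc t s)
      (f := fun r => QInt B g (μ r) (μ r) - QInt B g (μ' r) (μ' r)) (C := 16 * (1 + R ^ 3) * N') (by simp) (fun r _ => hb r)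
    rw [volume_real_Ioc_of_le hts] at this
    have h4 := (le_abs_self _).trans this
    have h5 : 16 * (1 + R ^ 3) * N' * (s - t) ≤ a * (16 * (1 + R ^ 3) * N') := by
      rw [mul_comm]; gcongr; linarith
    linarith
  have hQ : QInt B f (μ s) (μ s) - QInt B f (μ' s) (μ' s) = c * (∫ v, g v ∂(μ s) - ∫ v, g v ∂(μ' s)) := by
    rw [Q_diff hd hB (he s) (he' s) hf,
      emp_congr (he s) (ψ := Lk B f (μ s) (μ' s)) (φ := fun v => c * g v) (fun v hv => by
        rw [hg]; dsimp only; rw [p4 v (ball_mem hNN hv)]; field_simp; rfl),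
      emp_congr (he' s) (ψ := Lk B f (μ s) (μ' s)) (φ := fun v => c * g v) (fun v hv => by
        rw [hg]; dsimp only; rw [p4 v (ball_mem le_rfl hv)]; field_simp; rfl)]
    have i1 : ∫ v, c * g v ∂(μ s) = c * ∫ v, g v ∂(μ s) := integral_const_mul _ _
    have i2 : ∫ v, c * g v ∂(μ' s) = c * ∫ v, g v ∂(μ' s) := integral_const_mul _ _
    rw [i1, i2]; ring
  have hEs : ∫ v, g v ∂(μ s) - ∫ v, g v ∂(μ' s) ≤ Et B μ μ' s g + 2 * δ := by
    have b1 := abs_le.1 (h1 g hg3)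
    have b2 := abs_le.1 (h2 g hg3)
    unfold Et
    linarith [b1.2, b2.1]
  rw [hQ]
  have hE4 : c * Et B μ μ' t g ≤ (c' * D - Et B μ μ' t f) / a := by
    rw [le_div_iff₀ ha]; linarith
  calc c * (∫ v, g v ∂(μ s) - ∫ v, g v ∂(μ' s)) ≤ c * ((Et B μ μ' t g + a * (16 * (1 + R ^ 3) * N')) + 2 * δ) := by
        refine mul_le_mul_of_nonneg_left ?_ hc0.le; linarith
    _ = c * Et B μ μ' t g + a * (c * (16 * (1 + R ^ 3) * N')) + 2 * c * δ := by ring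
    _ ≤ (c' * D - Et B μ μ' t f) / a + a * (2 * (40 + 24 * κ) * (1 + 2 * R ^ 3) * (16 * (1 + R ^ 3) * N')) + 2 * c * δ := by
        gcongr
        rw [hc]; gcongr
    _ = _ := by rw [hc', hc]; field_simp; ring
theorem step {T t a D δ : ℝ} (ht : 0 ≤ t) (htT : t + a ≤ T) (ha : 0 < a)
    (ha2 : a * (2 * sqrt N') ≤ 1 / 2) (hD : ∀ g, CA 2 g → Et B μ μ' t g ≤ D)
    (h1 : ∀ s ∈ Icc 0 T, ∀ g, CA 3 g → |Mt B μ g s| ≤ δ) (h2 : ∀ s ∈ Icc 0 T, ∀ g, CA 3 g → |Mt B μ' g s| ≤ δ)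
    {f : Vd d → ℝ} (hf : CA 2 f) :
    Et B μ μ' (t + a) f ≤ D + a ^ 2 * (2 * (40 + 24 * κ) * (1 + 2 * sqrt N' ^ 3) * (16 * (1 + sqrt N' ^ 3) * N'))
      + (2 * (8 + 8 * κ) * D + 2 * (2 * (40 + 24 * κ)) * δ) * ∫ s in Ioc t (t + a), m3 (μ s) (μ' s) := by
  have hfK : ∀ v : Vd d, ‖v‖ ≤ sqrt N' → |f v| ≤ 1 + sqrt N' ^ 2 := fun v hv => (hf.1 v).trans (by gcongr)
  rw [Et_incr hd hB hNN hμ he hμ' he' (CA_meas hf) hfK ht (by linarith : t ≤ t + a)]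
  set K := (2 * (40 + 24 * κ) * (1 + 2 * sqrt N' ^ 3) * (16 * (1 + sqrt N' ^ 3) * N'))
  set b := (2 * (8 + 8 * κ) * D + 2 * (2 * (40 + 24 * κ)) * δ)
  have hmi := m3_int hNN hμ he hμ' he' t (t + a)
  have h3 : ∫ r in Ioc t (t + a), (QInt B f (μ r) (μ r) - QInt B f (μ' r) (μ' r)) ≤
      ∫ r in Ioc t (t + a), (((D - Et B μ μ' t f) / a + a * K) + b * m3 (μ r) (μ' r)) := by
    refine setIntegral_mono_on (Q_int hd hB hNN hμ he hμ' he' (CA_meas hf) hfK _ _)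
      (Integrable.fun_add (integrable_const _) (hmi.const_mul b)) measurableSet_Ioc fun s hs => ?_
    have hs' : s ∈ Icc 0 T := ⟨by linarith [hs.1], by linarith [hs.2]⟩
    exact step_pt hd hB hBL hNN hμ he hμ' he' hf ht hs.1.le hs.2 ha ha2 hD (h1 s hs') (h2 s hs')
  rw [integral_add (integrable_const _) (hmi.const_mul b), integral_const_mul, setIntegral_const,
    volume_real_Ioc_of_le (by linarith), smul_eq_mul] at h3
  have e : (t + a - t) * ((D - Et B μ μ' t f) / a + a * K) = D - Et B μ μ' t f + a ^ 2 * K := by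
    field_simp; ring
  rw [e] at h3
  linarith
end
theorem CA_testF {f : Vd d → ℝ} (hf : CA 2 f) : (fun v => f v / 3) ∈ testF d := by
  have key : ∀ v w : Vd d, ‖w‖ ≤ ‖v‖ → |f v / 3 / (1 + ‖v‖ ^ 2) - f w / 3 / (1 + ‖w‖ ^ 2)| ≤ ‖v - w‖ := by
    intro v w hwv
    have hw := norm_nonneg w
    have hn := norm_nonneg (v - w)
    have hvw := norm_sub_norm_le v w
    have pv : 0 < 1 + ‖v‖ ^ 2 := by positivity
    have pw : 0 < 1 + ‖w‖ ^ 2 := by positivity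
    have e : f v / 3 / (1 + ‖v‖ ^ 2) - f w / 3 / (1 + ‖w‖ ^ 2) =
        ((f v - f w) + (f w / (1 + ‖w‖ ^ 2)) * (‖w‖ ^ 2 - ‖v‖ ^ 2)) / (3 * (1 + ‖v‖ ^ 2)) := by
      field_simp; ring
    have h1 : |f w / (1 + ‖w‖ ^ 2)| ≤ 1 := by
      rw [abs_div, abs_of_pos pw, div_le_one pw]; exact hf.1 w
    have h2 : |‖w‖ ^ 2 - ‖v‖ ^ 2| ≤ ‖v - w‖ * (‖v‖ + ‖w‖) := by
      rw [abs_sub_comm, abs_of_nonneg (by nlinarith)]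
      nlinarith
    rw [e, abs_div, abs_of_pos (by positivity : 0 < 3 * (1 + ‖v‖ ^ 2)), div_le_iff₀ (by positivity)]
    refine (abs_add_le _ _).trans ?_
    rw [abs_mul]
    have h3 := mul_le_mul h1 h2 (abs_nonneg _) zero_le_one
    have h4 := hf.2 v w
    have h5 : 1 + ‖v‖ ^ 2 + ‖w‖ ^ 2 + (‖v‖ + ‖w‖) ≤ 3 * (1 + ‖v‖ ^ 2) := by
      nlinarith [sq_nonneg (‖v‖ - 1)]
    have h6 := mul_le_mul_of_nonneg_left h5 hn
    linarith
  refine ⟨fun v => ?_, fun v w => ?_⟩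
  · have pv : 0 < 1 + ‖v‖ ^ 2 := by positivity
    dsimp only
    rw [abs_div, abs_of_pos pv, div_le_one pv, abs_div, abs_of_pos (by norm_num : (0:ℝ) < 3)]
    have := hf.1 v
    linarith
  · rcases le_total ‖w‖ ‖v‖ with h | h
    · exact key v w h
    · rw [abs_sub_comm, norm_sub_rev]; exact key w v h
theorem testF_CA {f : Vd d → ℝ} (hf : f ∈ testF d) : CA 2 (fun v => f v / 2) := by
  have hb : ∀ v, |f v| ≤ 1 + ‖v‖ ^ 2 := fun v => by
    have pv : 0 < 1 + ‖v‖ ^ 2 := by positivity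
    have := hf.1 v
    rwa [abs_div, abs_of_pos pv, div_le_one pv] at this
  refine ⟨fun v => ?_, fun v w => ?_⟩
  · rw [abs_div, abs_of_pos (by norm_num : (0:ℝ) < 2)]
    have := hb v
    have := abs_nonneg (f v)
    linarith
  · have hw := norm_nonneg w
    have hv := norm_nonneg v
    have hn := norm_nonneg (v - w)
    have pv : 0 < 1 + ‖v‖ ^ 2 := by positivity
    have pw : 0 < 1 + ‖w‖ ^ 2 := by positivity
    have e : f v / 2 - f w / 2 = ((f v / (1 + ‖v‖ ^ 2) - f w / (1 + ‖w‖ ^ 2)) * (1 + ‖v‖ ^ 2) +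
        (f w / (1 + ‖w‖ ^ 2)) * (‖v‖ ^ 2 - ‖w‖ ^ 2)) / 2 := by field_simp; ring
    have h1 := hf.1 w
    have h2 : |‖v‖ ^ 2 - ‖w‖ ^ 2| ≤ ‖v - w‖ * (‖v‖ + ‖w‖) := by
      rw [show ‖v‖ ^ 2 - ‖w‖ ^ 2 = (‖v‖ - ‖w‖) * (‖v‖ + ‖w‖) by ring, abs_mul, abs_of_nonneg (by positivity : 0 ≤ ‖v‖ + ‖w‖)]
      gcongr
      exact abs_norm_sub_norm_le v w
    have h3 := mul_le_mul h1 h2 (abs_nonneg _) zero_le_one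
    have h4 := mul_le_mul_of_nonneg_right (hf.2 v w) pv.le
    rw [e, abs_div, abs_of_pos (by norm_num : (0:ℝ) < 2), div_le_iff₀ (by norm_num)]
    refine (abs_add_le _ _).trans ?_
    rw [abs_mul, abs_mul, abs_of_pos pv]
    have h5 : 1 + ‖v‖ ^ 2 + (‖v‖ + ‖w‖) ≤ (1 + ‖v‖ ^ 2 + ‖w‖ ^ 2) * 2 := by
      nlinarith [sq_nonneg (‖v‖ - 1), sq_nonneg (‖w‖ - 1)]
    have h6 := mul_le_mul_of_nonneg_left h5 hn
    linarith
theorem CA_23 {f : Vd d → ℝ} (hf : CA 2 f) : CA 3 (fun v => f v / 3) := by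
  have hb : ∀ v : Vd d, ‖v‖ ^ 2 ≤ 1 + ‖v‖ ^ 3 := fun v => by
    have := norm_nonneg v
    nlinarith [sq_nonneg (‖v‖ - 1), mul_nonneg this (sq_nonneg (‖v‖ - 1))]
  refine ⟨fun v => ?_, fun v w => ?_⟩
  · rw [abs_div, abs_of_pos (by norm_num : (0:ℝ) < 3)]
    have h1 := hf.1 v
    have h2 := hb v
    have : 0 ≤ ‖v‖ ^ 3 := by positivity
    linarith
  · rw [show f v / 3 - f w / 3 = (f v - f w) / 3 by ring, abs_div, abs_of_pos (by norm_num : (0:ℝ) < 3), div_le_iff₀ (by norm_num)]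
    refine (hf.2 v w).trans ?_
    rw [mul_assoc]
    refine mul_le_mul_of_nonneg_left ?_ (norm_nonneg _)
    have h1 := hb v
    have h2 := hb w
    have : 0 ≤ ‖v‖ ^ 3 := by positivity
    have : 0 ≤ ‖w‖ ^ 3 := by positivity
    linarith
theorem zero_testF : (fun _ => 0) ∈ testF d := by
  constructor <;> simp
theorem le_Wdist {N N' : ℕ} {μ μ' : Measure (Vd d)} (h : μ ∈ empiricalSphere d N) (h' : μ' ∈ empiricalSphere d N')
    {f : Vd d → ℝ} (hf : f ∈ testF d) : ∫ v, f v ∂μ - ∫ v, f v ∂μ' ≤ Wdist μ μ' := by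
  unfold Wdist
  refine le_ciSup (f := fun f : testF d => (∫ v, (f : Vd d → ℝ) v ∂μ) - ∫ v, (f : Vd d → ℝ) v ∂μ') ?_ ⟨f, hf⟩
  refine ⟨4, ?_⟩
  rintro _ ⟨⟨g, hg⟩, rfl⟩
  have hb : ∀ v, |g v| ≤ 1 + ‖v‖ ^ 2 := fun v => by
    have pv : 0 < 1 + ‖v‖ ^ 2 := by positivity
    have := hg.1 v
    rwa [abs_div, abs_of_pos pv, div_le_one pv] at this
  have key : ∀ (M : ℕ) (ν : Measure (Vd d)), ν ∈ empiricalSphere d M → |∫ v, g v ∂ν| ≤ 2 := by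
    intro M ν hν
    have := emp_prob hν
    refine (abs_integral_le_integral_abs).trans ?_
    refine (emp_le hν fun v _ => hb v).trans ?_
    rw [integral_add (integrable_const _) (emp_integrable hν _), emp_m2 hν]
    simp only [integral_const, probReal_univ, one_smul]
    norm_num
  have h1 := abs_le.1 (key _ _ h)
  have h2 := abs_le.1 (key _ _ h')
  show ∫ v, g v ∂μ - ∫ v, g v ∂μ' ≤ 4
  linarith [h1.2, h2.1]
theorem Wdist_nonneg {N N' : ℕ} {μ μ' : Measure (Vd d)} (h : μ ∈ empiricalSphere d N) (h' : μ' ∈ empiricalSphere d N') :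
    0 ≤ Wdist μ μ' := by
  simpa using le_Wdist h h' zero_testF
theorem Mt_div (B : Vd d → Measure (Vd d)) (μ : ℝ → Measure (Vd d)) (f : Vd d → ℝ) (t c : ℝ) :
    Mt B μ (fun v => f v / c) t = Mt B μ f t / c := by
  unfold Mt QInt
  simp only [← add_div, ← sub_div, integral_div]
section
variable {B : Vd d → Measure (Vd d)} (hd : 2 ≤ d) (hB : IsCollisionKernel B)
  {κ : ℝ} (hBL : IsLipschitzKernel B κ) {N N' : ℕ} (hNN : N ≤ N')
  {μ μ' : ℝ → Measure (Vd d)} (hμ : Measurable μ) (he : ∀ s, μ s ∈ empiricalSphere d N)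
  (hμ' : Measurable μ') (he' : ∀ s, μ' s ∈ empiricalSphere d N')
include hd hB hμ he hμ' he' hNN hBL
theorem iter {T a δ : ℝ} (ha : 0 < a) (hδ : 0 ≤ δ)
    (ha2 : a * (2 * sqrt N') ≤ 1 / 2)
    (h1 : ∀ s ∈ Icc 0 T, ∀ g, CA 3 g → |Mt B μ g s| ≤ δ) (h2 : ∀ s ∈ Icc 0 T, ∀ g, CA 3 g → |Mt B μ' g s| ≤ δ)
    (k : ℕ) (hk : k * a ≤ T) : ∀ f, CA 2 f → Et B μ μ' (k * a) f ≤
      exp (2 * (8 + 8 * κ) * ∫ s in Ioc 0 (k * a), m3 (μ s) (μ' s)) *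
      (3 * Wdist (μ 0) (μ' 0) + k * (a ^ 2 * (2 * (40 + 24 * κ) * (1 + 2 * sqrt N' ^ 3) * (16 * (1 + sqrt N' ^ 3) * N')))
      + 2 * (2 * (40 + 24 * κ)) * δ * ∫ s in Ioc 0 (k * a), m3 (μ s) (μ' s)) := by
  have hκ := hBL.1
  have hW := Wdist_nonneg (he 0) (he' 0)
  induction k with
  | zero =>
    intro f hf
    have := le_Wdist (he 0) (he' 0) (CA_testF hf)
    simp only [integral_div] at this
    simp [Et, Mt]
    linarith
  | succ k ih =>
    intro f hf
    have hka : 0 ≤ (k:ℝ) * a := by positivity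
    push_cast at hk ⊢
    have e : ((k:ℝ) + 1) * a = k * a + a := by ring
    have hs := step hd hB hBL hNN hμ he hμ' he' hka (by linarith) ha ha2 (ih (by linarith)) h1 h2 hf
    have hI : ∫ s in Ioc 0 (k * a + a), m3 (μ s) (μ' s) = (∫ s in Ioc 0 (k * a), m3 (μ s) (μ' s)) +
        ∫ s in Ioc (k * a) (k * a + a), m3 (μ s) (μ' s) := by
      rw [← Set.Ioc_union_Ioc_eq_Ioc hka (by linarith : k * a ≤ k * a + a),
        setIntegral_union (Set.Ioc_disjoint_Ioc_of_le le_rfl) measurableSet_Ioc (m3_int hNN hμ he hμ' he' _ _)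
          (m3_int hNN hμ he hμ' he' _ _)]
    have pos : ∀ x y, 0 ≤ ∫ s in Ioc x y, m3 (μ s) (μ' s) := fun x y =>
      integral_nonneg fun s => by have := m3_pos (μ s) (μ' s); simp only [Pi.zero_apply]; linarith
    rw [e, hI]
    have p1 := pos 0 (k * a)
    have p2 := pos (k * a) (k * a + a)
    set I := ∫ s in Ioc 0 (k * a), m3 (μ s) (μ' s)
    set J := ∫ s in Ioc (k * a) (k * a + a), m3 (μ s) (μ' s)
    set K := (2 * (40 + 24 * κ) * (1 + 2 * sqrt N' ^ 3) * (16 * (1 + sqrt N' ^ 3) * N')) with hK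
    have hK0 : 0 ≤ K := by positivity
    set W := Wdist (μ 0) (μ' 0)
    set c := 2 * (8 + 8 * κ) with hc
    have hc0 : 0 ≤ c := by positivity
    set c1 := 2 * (2 * (40 + 24 * κ)) * δ with hc1
    have hc10 : 0 ≤ c1 := by positivity
    rw [mul_add c, Real.exp_add]
    have x1 := Real.add_one_le_exp (c * J)
    have x0 := one_le_exp (by positivity : 0 ≤ c * I)
    have x2 := one_le_exp (by positivity : 0 ≤ c * J)
    set X := exp (c * I)
    set Y := exp (c * J)
    set U := 3 * W + k * (a ^ 2 * K) + c1 * I with hU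
    have hU0 : 0 ≤ U := by positivity
    have x3 : 1 ≤ X * Y := by nlinarith
    have x4 : (c * J + 1) * (X * U) ≤ Y * (X * U) := mul_le_mul_of_nonneg_right x1 (by positivity)
    have x5 : a ^ 2 * K + c1 * J ≤ X * Y * (a ^ 2 * K + c1 * J) := le_mul_of_one_le_left (by positivity) x3
    calc _ ≤ _ := hs
      _ = (c * J + 1) * (X * U) + (a ^ 2 * K + c1 * J) := by ring
      _ ≤ Y * (X * U) + X * Y * (a ^ 2 * K + c1 * J) := add_le_add x4 x5
      _ = _ := by rw [hU]; ring
theorem stab {T δ I0 : ℝ} (hδ : 0 ≤ δ)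
    (h1 : ∀ s ∈ Icc 0 T, ∀ g, CA 3 g → |Mt B μ g s| ≤ δ) (h2 : ∀ s ∈ Icc 0 T, ∀ g, CA 3 g → |Mt B μ' g s| ≤ δ)
    (hI0 : ∫ s in Ioc 0 T, m3 (μ s) (μ' s) ≤ I0) (t : ℝ) (ht : t ∈ Icc 0 T) :
    Wdist (μ t) (μ' t) ≤ 2 * (exp (2 * (8 + 8 * κ) * I0) * (3 * Wdist (μ 0) (μ' 0) + 2 * (2 * (40 + 24 * κ)) * δ * I0) + 6 * δ) := by
  have hκ := hBL.1
  have hW := Wdist_nonneg (he 0) (he' 0)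
  have pos : ∀ x y, 0 ≤ ∫ s in Ioc x y, m3 (μ s) (μ' s) := fun x y =>
    integral_nonneg fun s => by have := m3_pos (μ s) (μ' s); simp only [Pi.zero_apply]; linarith
  have hIt : ∫ s in Ioc 0 t, m3 (μ s) (μ' s) ≤ I0 := by
    refine le_trans (setIntegral_mono_set (m3_int hNN hμ he hμ' he' _ _) (Eventually.of_forall fun s => ?_)
      (Set.Ioc_subset_Ioc_right ht.2).eventuallyLE) hI0
    have := m3_pos (μ s) (μ' s); simp only [Pi.zero_apply]; linarith
  have hI00 : 0 ≤ I0 := (pos _ _).trans hIt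
  have hE : ∀ f, CA 2 f → Et B μ μ' t f ≤ exp (2 * (8 + 8 * κ) * I0) * (3 * Wdist (μ 0) (μ' 0) + 2 * (2 * (40 + 24 * κ)) * δ * I0) := by
    intro f hf
    rcases ht.1.eq_or_lt with h0 | h0
    · have h3 := iter hd hB hBL hNN hμ he hμ' he' (T := T) (a := (2 * (2 * sqrt N') + 1)⁻¹) (by positivity) hδ (by
        rw [inv_mul_le_iff₀ (by positivity)]; linarith [sqrt_nonneg N']) h1 h2 0 (by simpa using ht.1.trans ht.2) f hf
      simp only [Nat.cast_zero, zero_mul, Set.Ioc_self, setIntegral_empty, mul_zero, Real.exp_zero, one_mul, add_zero] at h3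
      rw [← h0]
      have h4 : 0 ≤ 2 * (2 * (40 + 24 * κ)) * δ * I0 := by positivity
      exact h3.trans (le_trans (by linarith) (le_mul_of_one_le_left (by positivity) (one_le_exp (by positivity))))
    · set K := (2 * (40 + 24 * κ) * (1 + 2 * sqrt N' ^ 3) * (16 * (1 + sqrt N' ^ 3) * N')) with hK
      have hlim : Tendsto (fun n : ℕ => exp (2 * (8 + 8 * κ) * I0) *
          (3 * Wdist (μ 0) (μ' 0) + t ^ 2 * K / n + 2 * (2 * (40 + 24 * κ)) * δ * I0)) atTop
          (nhds (exp (2 * (8 + 8 * κ) * I0) * (3 * Wdist (μ 0) (μ' 0) + 0 + 2 * (2 * (40 + 24 * κ)) * δ * I0))) :=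
        (((tendsto_const_div_atTop_nhds_zero_nat _).const_add _).add_const _).const_mul _
      rw [add_zero] at hlim
      refine ge_of_tendsto hlim ?_
      filter_upwards [eventually_ge_atTop (⌈2 * (t * (2 * sqrt N'))⌉₊ + 1)] with n hn
      have hn1 : 2 * (t * (2 * sqrt N')) ≤ n :=
        (Nat.le_ceil _).trans (by exact_mod_cast (Nat.le_succ _).trans hn)
      have hn0 : (0:ℝ) < n := by
        have : 0 < n := by omega
        exact_mod_cast this
      have e : (n:ℝ) * (t / n) = t := by field_simp
      have h3 := iter hd hB hBL hNN hμ he hμ' he' (T := T) (a := t / n) (by positivity) hδ (by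
        rw [div_mul_eq_mul_div, div_le_iff₀ hn0]; linarith) h1 h2 n (by rw [e]; exact ht.2) f hf
      rw [e, ← hK] at h3
      have e2 : n * ((t / n) ^ 2 * K) = t ^ 2 * K / n := by field_simp
      rw [e2] at h3
      refine h3.trans ?_
      have := pos 0 t
      gcongr
  unfold Wdist
  have : Nonempty (testF d) := ⟨⟨_, zero_testF⟩⟩
  refine ciSup_le ?_
  rintro ⟨f, hf⟩
  have hf2 := testF_CA hf
  have h3 := hE _ hf2
  have h4 := abs_le.1 (h1 t ht _ (CA_23 hf2))
  have h5 := abs_le.1 (h2 t ht _ (CA_23 hf2))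
  unfold Et at h3
  rw [Mt_div] at h4 h5
  simp only [integral_div] at h3
  unfold Wdist at h3
  dsimp only
  linarith [h4.2, h5.1]
end
section
variable {B : Vd d → Measure (Vd d)} (hd : 2 ≤ d) (hB : IsCollisionKernel B)
include hd hB
theorem J_int {p : ℝ} (hp : 8 < p) {T : ℝ} {Ω : Type*} [m : MeasurableSpace Ω] {P : Measure Ω}
    [IsProbabilityMeasure P] {𝓕 : Filtration ℝ m} {N : ℕ} {μp : ℝ → Ω → Measure (Vd d)} (h : IsKacProcess B N P 𝓕 μp) :
    (∀ ω, IntegrableOn (fun s => ∫ v, ‖v‖ ^ (p + 1) ∂(μp s ω)) (Ioc 0 T)) ∧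
    Integrable (fun ω => ∫ s in Ioc 0 T, ∫ v, ‖v‖ ^ (p + 1) ∂(μp s ω)) P := by
  have hG : Good N (fun (v _ : Vd d) => ‖v‖ ^ (p + 1)) := by
    refine ⟨by fun_prop, (N:ℝ) ^ ((p + 1) / 2), fun v _ hv _ => ?_⟩
    rw [abs_of_nonneg (by positivity)]
    exact norm_rpow_ball (by linarith) hv
  have := EI_int h hG T
  have e : ∀ s ω, ∫ v, ∫ _, ‖v‖ ^ (p + 1) ∂(μp s ω) ∂(μp s ω) = ∫ v, ‖v‖ ^ (p + 1) ∂(μp s ω) := by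
    intro s ω
    have := emp_prob (h.mem s ω)
    simp
  simpa only [e] using this
theorem J_tail {p : ℝ} (hp : 8 < p) {lam T : ℝ} (hlam : 0 ≤ lam) (hT : 0 ≤ T) :
    ∃ C : ℝ, 0 ≤ C ∧ ∀ (Ω : Type) (m : MeasurableSpace Ω) (P : Measure Ω),
      IsProbabilityMeasure P → ∀ (𝓕 : Filtration ℝ m) (N : ℕ) (μp : ℝ → Ω → Measure (Vd d)),
      IsKacProcess B N P 𝓕 μp → (∀ ω, momentL p (μp 0 ω) ≤ ENNReal.ofReal lam) →
      ∀ a > 0, P {ω | a ≤ ∫ s in Ioc 0 T, ∫ v, ‖v‖ ^ (p + 1) ∂(μp s ω)} ≤ ENNReal.ofReal (C / a) := by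
  obtain ⟨C, hC, hm⟩ := moments hd hB (by linarith : 2 < p) hlam hT
  refine ⟨C, hC, fun Ω m P hP 𝓕 N μp h h0 a ha => ?_⟩
  have h1 := (hm Ω m P hP 𝓕 N μp h h0).2
  have h2 := mul_meas_ge_le_integral_of_nonneg (μ := P)
    (f := fun ω => ∫ s in Ioc 0 T, ∫ v, ‖v‖ ^ (p + 1) ∂(μp s ω))
    (Eventually.of_forall fun ω => integral_nonneg fun s => integral_nonneg fun v => by positivity)
    (J_int hd hB hp h).2 a
  rw [← ofReal_measureReal]
  refine ENNReal.ofReal_le_ofReal ?_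
  rw [le_div_iff₀ ha, mul_comm]
  exact h2.trans h1
theorem m3_J {p : ℝ} (hp : 8 < p) {T : ℝ} (hT : 0 ≤ T) {Ω : Type*} [m : MeasurableSpace Ω] {P : Measure Ω}
    [IsProbabilityMeasure P] {𝓕 : Filtration ℝ m} {N N' : ℕ} (hNN : N ≤ N') {μp μp' : ℝ → Ω → Measure (Vd d)}
    (h : IsKacProcess B N P 𝓕 μp) (h' : IsKacProcess B N' P 𝓕 μp') (ω : Ω) :
    ∫ s in Ioc 0 T, m3 (μp s ω) (μp' s ω) ≤ 3 * T + (∫ s in Ioc 0 T, ∫ v, ‖v‖ ^ (p + 1) ∂(μp s ω))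
      + ∫ s in Ioc 0 T, ∫ v, ‖v‖ ^ (p + 1) ∂(μp' s ω) := by
  have i1 := (J_int hd hB hp (T := T) h).1 ω
  have i2 := (J_int hd hB hp (T := T) h').1 ω
  have key : ∀ (M : ℕ) (ν : Measure (Vd d)), ν ∈ empiricalSphere d M → ∫ v, ‖v‖ ^ 3 ∂ν ≤ 1 + ∫ v, ‖v‖ ^ (p + 1) ∂ν := by
    intro M ν hν
    have := emp_prob hν
    refine (emp_le hν (φ := fun v => 1 + ‖v‖ ^ (p + 1)) fun v _ => ?_).trans ?_
    · rcases le_total ‖v‖ 1 with hv | hv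
      · have h1 : ‖v‖ ^ 3 ≤ 1 := pow_le_one₀ (norm_nonneg _) hv
        have h2 : 0 ≤ ‖v‖ ^ (p + 1) := by positivity
        linarith
      · have h1 : ‖v‖ ^ (3:ℝ) ≤ ‖v‖ ^ (p + 1) := Real.rpow_le_rpow_of_exponent_le hv (by linarith)
        rw [show (3:ℝ) = ((3:ℕ):ℝ) by norm_num, Real.rpow_natCast] at h1
        linarith
    · rw [integral_add (integrable_const _) (emp_integrable hν _)]
      simp only [integral_const, probReal_univ, one_smul]
      exact le_rfl
  have h1 : ∫ s in Ioc 0 T, m3 (μp s ω) (μp' s ω) ≤ ∫ s in Ioc 0 T, ((3 + ∫ v, ‖v‖ ^ (p + 1) ∂(μp s ω))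
      + ∫ v, ‖v‖ ^ (p + 1) ∂(μp' s ω)) := by
    refine integral_mono (m3_int hNN (path_meas hd hB h ω) (fun s => h.mem s ω) (path_meas hd hB h' ω) (fun s => h'.mem s ω) 0 T)
      (Integrable.fun_add (Integrable.fun_add (integrable_const _) i1) i2) fun s => ?_
    have a1 := key _ _ (h.mem s ω)
    have a2 := key _ _ (h'.mem s ω)
    simp only [m3]
    linarith
  rw [integral_add (Integrable.fun_add (integrable_const _) i1) i2, integral_add (integrable_const _) i1, setIntegral_const,
    volume_real_Ioc_of_le hT, smul_eq_mul] at h1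
  linarith
theorem core {κ : ℝ} (hBL : IsLipschitzKernel B κ) {ε : ℝ} (hε0 : 0 < ε) (hε1 : ε ≤ 1)
    {lam : ℝ} (hlam : 0 ≤ lam) {p : ℝ} (hp : 8 < p) {T : ℝ} (hT : 0 ≤ T) :
    ∃ C : ℝ, 0 ≤ C ∧
      ∀ (Ω : Type) (m : MeasurableSpace Ω) (P : Measure Ω),
        IsProbabilityMeasure P →
      ∀ (𝓕 : MeasureTheory.Filtration ℝ m) (N N' : ℕ), N ≤ N' →
      ∀ (μN : ℝ → Ω → Measure (Vd d)) (μN' : ℝ → Ω → Measure (Vd d)),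
        IsKacProcess B N P 𝓕 μN → IsKacProcess B N' P 𝓕 μN' →
        (∀ ω, momentL p (μN 0 ω) ≤ ENNReal.ofReal lam) →
        (∀ ω, momentL p (μN' 0 ω) ≤ ENNReal.ofReal lam) →
          ENNReal.ofReal (1 - ε) <
            P {ω | ∀ t ∈ Icc (0:ℝ) T,
              Wdist (μN t ω) (μN' t ω) ≤ C * (Wdist (μN 0 ω) (μN' 0 ω) + rate d N)} := by
  have hκ := hBL.1
  obtain ⟨C1, hC1, hch⟩ := chain hd hB hp hlam hT
  obtain ⟨C2, hC2, hJ⟩ := J_tail hd hB hp hlam hT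
  obtain ⟨C3, hC3, hr⟩ := rate_mono d
  set A := 8 * (C1 + 1) / ε with hA
  have hA0 : 0 < A := by positivity
  set a := 8 * (C2 + 1) / ε with ha
  have ha0 : 0 < a := by positivity
  set I0 := 3 * T + a + a with hI0
  have hI00 : 0 ≤ I0 := by positivity
  set E := exp (2 * (8 + 8 * κ) * I0) with hE
  have hE0 : 0 < E := Real.exp_pos _
  set C' := 2 * (E * (2 * (2 * (40 + 24 * κ)) * I0) + 6) * (A * (1 + C3)) with hC'
  have hC'0 : 0 ≤ C' := by positivity
  refine ⟨6 * E + C', by positivity, fun Ω m P hP 𝓕 N N' hNN μN μN' h h' h0 h0' => ?_⟩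
  have hne : Nonempty Ω := P.nonempty_of_neZero
  obtain ⟨ω0⟩ := hne
  have hN := emp_N_two (h.mem 0 ω0)
  have hrN := rate_pos (d := d) hN
  have hrN' := rate_pos (d := d) (hN.trans hNN)
  set G := {ω | ∀ t ∈ Icc (0:ℝ) T,
    Wdist (μN t ω) (μN' t ω) ≤ (6 * E + C') * (Wdist (μN 0 ω) (μN' 0 ω) + rate d N)} with hG
  have small : ∀ x : ℝ, 0 ≤ x → x / (8 * (x + 1) / ε) ≤ ε / 8 := by
    intro x hx
    rw [div_div_eq_mul_div, div_le_div_iff₀ (by positivity) (by norm_num)]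
    nlinarith
  have b1 : ∀ (M : ℕ) (μp : ℝ → Ω → Measure (Vd d)), 0 < rate d M → IsKacProcess B M P 𝓕 μp →
      (∀ ω, momentL p (μp 0 ω) ≤ ENNReal.ofReal lam) →
      P {ω | ∃ f, CA 3 f ∧ ∃ t ∈ Icc 0 T, A * rate d M < |Mt B (fun t => μp t ω) f t|} ≤ ENNReal.ofReal (ε / 8) := by
    intro M μp hM hk hk0
    refine (hch Ω m P hP 𝓕 M μp hk hk0 _ (by positivity)).trans (ENNReal.ofReal_le_ofReal ?_)
    rw [mul_div_mul_right _ _ hM.ne']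
    exact small C1 hC1
  have b2 : ∀ (M : ℕ) (μp : ℝ → Ω → Measure (Vd d)), IsKacProcess B M P 𝓕 μp →
      (∀ ω, momentL p (μp 0 ω) ≤ ENNReal.ofReal lam) →
      P {ω | a ≤ ∫ s in Ioc 0 T, ∫ v, ‖v‖ ^ (p + 1) ∂(μp s ω)} ≤ ENNReal.ofReal (ε / 8) := by
    intro M μp hk hk0
    exact (hJ Ω m P hP 𝓕 M μp hk hk0 _ ha0).trans (ENNReal.ofReal_le_ofReal (small C2 hC2))
  set S1 := {ω | ∃ f, CA 3 f ∧ ∃ t ∈ Icc 0 T, A * rate d N < |Mt B (fun t => μN t ω) f t|} with hS1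
  set S2 := {ω | ∃ f, CA 3 f ∧ ∃ t ∈ Icc 0 T, A * rate d N' < |Mt B (fun t => μN' t ω) f t|} with hS2
  set S3 := {ω | a ≤ ∫ s in Ioc 0 T, ∫ v, ‖v‖ ^ (p + 1) ∂(μN s ω)} with hS3
  set S4 := {ω | a ≤ ∫ s in Ioc 0 T, ∫ v, ‖v‖ ^ (p + 1) ∂(μN' s ω)} with hS4
  have hcov : Set.univ ⊆ G ∪ ((S1 ∪ S2) ∪ (S3 ∪ S4)) := by
    intro ω _
    by_contra hω
    simp only [Set.mem_union, not_or] at hω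
    obtain ⟨hg, ⟨n1, n2⟩, n3, n4⟩ := hω
    apply hg
    rw [hS3, mem_ofPred_eq, not_le] at n3
    rw [hS4, mem_ofPred_eq, not_le] at n4
    rw [hS1, mem_ofPred_eq] at n1
    rw [hS2, mem_ofPred_eq] at n2
    push Not at n1 n2
    have hrr := hr N N' hN hNN
    have d1 : A * rate d N ≤ A * (1 + C3) * rate d N := by
      rw [mul_assoc]; gcongr; nlinarith
    have d2 : A * rate d N' ≤ A * (1 + C3) * rate d N := by
      rw [mul_assoc]; gcongr; nlinarith
    intro t ht
    have hs := stab hd hB hBL hNN (path_meas hd hB h ω) (fun s => h.mem s ω) (path_meas hd hB h' ω) (fun s => h'.mem s ω)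
      (T := T) (δ := A * (1 + C3) * rate d N) (I0 := I0) (by positivity)
      (fun s hs g hg => (n1 g hg s hs).trans d1) (fun s hs g hg => (n2 g hg s hs).trans d2)
      ((m3_J hd hB hp hT hNN h h' ω).trans (by linarith)) t ht
    refine hs.trans ?_
    have hW := Wdist_nonneg (h.mem 0 ω) (h'.mem 0 ω)
    have e : 2 * (E * (3 * Wdist (μN 0 ω) (μN' 0 ω) + 2 * (2 * (40 + 24 * κ)) * (A * (1 + C3) * rate d N) * I0) + 6 * (A * (1 + C3) * rate d N))
        = 6 * E * Wdist (μN 0 ω) (μN' 0 ω) + C' * rate d N := by rw [hC']; ring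
    rw [e]
    have e1 : 0 ≤ C' * Wdist (μN 0 ω) (μN' 0 ω) := by positivity
    have e2 : 0 ≤ 6 * E * rate d N := by positivity
    linarith
  have hbad : P ((S1 ∪ S2) ∪ (S3 ∪ S4)) ≤ ENNReal.ofReal (ε / 2) := by
    have e : ENNReal.ofReal (ε / 2) = (ENNReal.ofReal (ε / 8) + ENNReal.ofReal (ε / 8)) + (ENNReal.ofReal (ε / 8) + ENNReal.ofReal (ε / 8)) := by
      rw [← ENNReal.ofReal_add (by positivity) (by positivity), ← ENNReal.ofReal_add (by positivity) (by positivity)]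
      congr 1; ring
    rw [e]
    exact (measure_union_le _ _).trans (add_le_add ((measure_union_le _ _).trans (add_le_add (b1 N μN hrN h h0) (b1 N' μN' hrN' h' h0')))
      ((measure_union_le _ _).trans (add_le_add (b2 N μN h h0) (b2 N' μN' h' h0'))))
  have h1 : (1:ℝ≥0∞) ≤ P G + ENNReal.ofReal (ε / 2) := by
    rw [← measure_univ (μ := P)]
    exact (measure_mono hcov).trans ((measure_union_le _ _).trans (by gcongr))
  refine lt_of_lt_of_le ((ENNReal.ofReal_lt_ofReal_iff (by linarith : 0 < 1 - ε / 2)).2 (by linarith)) ?_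
  rw [ENNReal.ofReal_sub _ (by positivity), ENNReal.ofReal_one]
  exact tsub_le_iff_right.2 h1
end
end KacProof
/-- Theorem 1.2 (consistency with optimal rate N^{-1/d} under an 8th-moment condition). -/
theorem kac_consistency_optimal_rate
    (d : ℕ) (hd : 2 ≤ d) (B : Vd d → Measure (Vd d)) (κ : ℝ)
    (hB : IsCollisionKernel B) (hBL : IsLipschitzKernel B κ)
    (ε : ℝ) (hε0 : 0 < ε) (hε1 : ε ≤ 1)
    (lam : ℝ) (hlam : 1 ≤ lam)
    (p : ℝ) (hp : 8 < p) (T : ℝ) (hT : 0 ≤ T) :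
    ∃ C : ℝ, 0 ≤ C ∧
      ∀ (Ω : Type) (m : MeasurableSpace Ω) (P : Measure Ω),
        IsProbabilityMeasure P →
      ∀ (𝓕 : MeasureTheory.Filtration ℝ m) (N N' : ℕ), N ≤ N' →
      ∀ (μN : ℝ → Ω → Measure (Vd d)) (μN' : ℝ → Ω → Measure (Vd d)),
        IsKacProcess B N P 𝓕 μN → IsKacProcess B N' P 𝓕 μN' →
        (∀ ω, momentL p (μN 0 ω) ≤ ENNReal.ofReal lam) →
        (∀ ω, momentL p (μN' 0 ω) ≤ ENNReal.ofReal lam) →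
        (3 ≤ d →
          ENNReal.ofReal (1 - ε) <
            P {ω | ∀ t ∈ Set.Icc (0:ℝ) T,
              Wdist (μN t ω) (μN' t ω) ≤
                C * (Wdist (μN 0 ω) (μN' 0 ω) + (N : ℝ) ^ (-(1:ℝ)/d))}) ∧
        (d = 2 →
          ENNReal.ofReal (1 - ε) <
            P {ω | ∀ t ∈ Set.Icc (0:ℝ) T,
              Wdist (μN t ω) (μN' t ω) ≤
                C * (Wdist (μN 0 ω) (μN' 0 ω) +
                  (N : ℝ) ^ (-(1:ℝ)/2) * Real.log N)}) := by
  obtain ⟨C, hC, h⟩ := KacProof.core hd hB hBL hε0 hε1 (by linarith : 0 ≤ lam) hp hT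
  refine ⟨C, hC, fun Ω m P hP 𝓕 N N' hNN μN μN' h1 h2 h3 h4 => ?_⟩
  have key := h Ω m P hP 𝓕 N N' hNN μN μN' h1 h2 h3 h4
  refine ⟨fun hd3 => ?_, fun hd2 => ?_⟩
  · rw [KacProof.rate, if_pos hd3] at key
    exact key
  · rw [KacProof.rate, if_neg (by omega)] at key
    exact key
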